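/- Let G be the non quasi-split unramified unitary group in four variables over F_0 and let n be a positive integer with gcd(n, 4) = 1. Let [Λ_3, n, [n/2], β] and [Λ_3, n, [n/2], γ] be fundamental skew strata both contained in some (one and the same) irreducible smooth representation of G. Then (P_{[n/2]+1}(Λ_3), ψ_γ) is a P_0(Λ_3)-conjugate of (P_{[n/2]+1}(Λ_3), ψ_β), i.e., there exists g ∈ P_0(Λ_3) with ψ_γ = ψ_β ∘ Ad(g^{-1}) on P_{[n/2]+1}(Λ_3). -/

import Mathlib

/-!
Common framework for formalizing statements from
"Representations of non quasi-split U(4) over a p-adic field I" (M. Miyauchi).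

We model the non-archimedean local field `F` with its (possibly trivial) Galois
involution, ring of integers `O`, uniformizer `ϖ`, a finite-dimensional hermitian
space `(V, h)` over `F`, the adjoint involution `σA` on `A = End_F V`, the unitary
group `G = {g ∈ A^× | g σ(g) = 1}` (as a subgroup of `Aˣ`), self-dual lattice
sequences, the filtrations `a_n(Λ)`, the congruence subsets `P_n(Λ)`, skew
(semisimple) strata, characters attached to strata, smooth representations, and
Hecke algebras.
-/

noncomputable section
open scoped Classical Pointwise

universe u v w

/-- The ambient data: a field `F` with involution `conj` (Galois involution of
`F/F₀`), ring of integers `O` (a valuation subring with uniformizer `ϖ` and finite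
residue field), a hermitian space `(V, h)` and the adjoint involution `σA` on
`End_F V` induced by `h`. -/
structure USetting (F : Type u) [Field F] (V : Type v) [AddCommGroup V] [Module F V] where
  /-- the Galois involution `x ↦ x̄` on `F` -/
  conj : F ≃+* F
  conj_invol : ∀ x : F, conj (conj x) = x
  /-- the ring of integers `o_F` -/
  O : Subring F
  /-- a uniformizer `ϖ_F` -/
  ϖ : F
  ϖ_mem : ϖ ∈ O
  ϖ_ne_zero : ϖ ≠ 0
  ϖ_not_unit : ∀ y ∈ O, ϖ * y ≠ 1
  conj_O : ∀ x ∈ O, conj x ∈ O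
  /-- `O` is a valuation ring of `F` -/
  O_val : ∀ x : F, x ≠ 0 → x ∈ O ∨ x⁻¹ ∈ O
  /-- every nonunit of `O` is divisible by `ϖ`: the maximal ideal is `ϖO` -/
  unif : ∀ x ∈ O, (∀ y ∈ O, x * y ≠ 1) → ∃ z ∈ O, x = ϖ * z
  /-- the residue field `o_F/p_F` is finite -/
  res_fin : Finite (O ⧸ (Ideal.span {(⟨ϖ, ϖ_mem⟩ : O)} : Ideal O))
  /-- the hermitian form `h` on `V` -/
  h : V → V → F
  h_add_left : ∀ u v w : V, h (u + v) w = h u w + h v w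
  h_smul_left : ∀ (c : F) (u w : V), h (c • u) w = conj c * h u w
  h_conj_symm : ∀ u w : V, h w u = conj (h u w)
  h_nondeg : ∀ u : V, (∀ w : V, h u w = 0) → u = 0
  /-- the involution on `A = End_F V` induced by `h` -/
  σA : Module.End F V → Module.End F V
  σA_adj : ∀ (X : Module.End F V) (u w : V), h (X u) w = h u (σA X w)
  σA_one : σA 1 = 1
  σA_mul : ∀ X Y, σA (X * Y) = σA Y * σA X
  σA_add : ∀ X Y, σA (X + Y) = σA X + σA Y
  σA_invol : ∀ X, σA (σA X) = X

namespace USetting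

variable {F : Type u} [Field F] {V : Type v} [AddCommGroup V] [Module F V]
variable (S : USetting F V)

/-- the maximal ideal `p_F = ϖ o_F` of `o_F`, as a subset of `F` -/
def pF : Set F := {y : F | ∃ z ∈ S.O, y = S.ϖ * z}

/-- the residue characteristic of `F` -/
def residueChar : ℕ :=
  ringChar (S.O ⧸ (Ideal.span {(⟨S.ϖ, S.ϖ_mem⟩ : S.O)} : Ideal S.O))

/-- An `o_F`-lattice sequence in `V`: a decreasing `ℤ`-indexed family of
`o_F`-submodules of `V`, periodic with (minimal) period `e` under multiplication
by `ϖ`. -/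
structure LatSeq where
  L : ℤ → Set V
  zero_mem : ∀ i, (0 : V) ∈ L i
  add_mem : ∀ i, ∀ v w : V, v ∈ L i → w ∈ L i → v + w ∈ L i
  smul_mem : ∀ i, ∀ c ∈ S.O, ∀ v ∈ L i, c • v ∈ L i
  dec : ∀ i, L (i + 1) ⊆ L i
  e : ℤ
  e_pos : 0 < e
  periodic : ∀ i, L (i + e) = S.ϖ • L i
  e_min : ∀ e' : ℤ, 0 < e' → (∀ i, L (i + e') = S.ϖ • L i) → e ≤ e'

/-- each member of the sequence is a full `o_F`-lattice in `V`
(finitely generated over `o_F` and spanning `V` over `F`) -/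
def IsFull (Λ : S.LatSeq) : Prop :=
  ∀ i : ℤ, Submodule.span F (Λ.L i) = ⊤ ∧
    ∃ s : Finset V, ↑s ⊆ Λ.L i ∧
      ∀ v ∈ Λ.L i, ∃ c : V → F, (∀ w ∈ s, c w ∈ S.O) ∧ v = ∑ w ∈ s, c w • w

/-- the filtration `a_n(Λ)` of `A = End_F V` -/
def aFil (Λ : S.LatSeq) (n : ℤ) : Set (Module.End F V) :=
  {X : Module.End F V | ∀ i : ℤ, ∀ v ∈ Λ.L i, X v ∈ Λ.L (i + n)}

/-- `A_- = {X ∈ A | X + σ(X) = 0}` -/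
def Aminus : Set (Module.End F V) := {X | S.σA X = -X}

/-- the dual lattice `L^# = {v | h(v, L) ⊆ o_F}` -/
def dualLat (L : Set V) : Set V := {v : V | ∀ w ∈ L, S.h v w ∈ S.O}

/-- `Λ` is self-dual with duality invariant `d`: `Λ(i)^# = Λ(d - i)` -/
def selfDualWith (Λ : S.LatSeq) (d : ℤ) : Prop :=
  ∀ i : ℤ, S.dualLat (Λ.L i) = Λ.L (d - i)

def isSelfDual (Λ : S.LatSeq) : Prop := ∃ d : ℤ, S.selfDualWith Λ d

/-- the unitary group `G = {g ∈ A^× | g σ(g) = 1}` as a subgroup of `Aˣ` -/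
def GU : Subgroup (Module.End F V)ˣ where
  carrier := {u : (Module.End F V)ˣ |
    S.σA (u : Module.End F V) = ((u⁻¹ : (Module.End F V)ˣ) : Module.End F V)}
  one_mem' := by simpa using S.σA_one
  mul_mem' := by
    intro a b ha hb
    simp only [Set.mem_setOf_eq] at *
    rw [Units.val_mul, S.σA_mul, ha, hb, mul_inv_rev, Units.val_mul]
  inv_mem' := by
    intro a ha
    simp only [Set.mem_setOf_eq] at *
    rw [← ha, S.σA_invol, inv_inv]

/-- the underlying endomorphism of an element of `G` -/
def toE (g : S.GU) : Module.End F V := ((g : (Module.End F V)ˣ) : Module.End F V)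

/-- `P_k(Λ) = G ∩ (1 + a_k(Λ))` (for `k ≥ 1`) -/
def Pset (Λ : S.LatSeq) (k : ℤ) : Set S.GU := {g : S.GU | S.toE g - 1 ∈ S.aFil Λ k}

/-- `P_0(Λ) = G ∩ a_0(Λ)` -/
def P0set (Λ : S.LatSeq) : Set S.GU := {g : S.GU | S.toE g ∈ S.aFil Λ 0}

/-- `B`, the `A`-centralizer of `β` -/
def Bcent (β : Module.End F V) : Set (Module.End F V) := {X | X * β = β * X}

/-- `B^⊥`, the orthogonal complement of `B` in `A` w.r.t. the pairing `(x,y) ↦ tr_{A/F}(xy)` -/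
def Bperp (β : Module.End F V) : Set (Module.End F V) :=
  {X | ∀ Y ∈ Bcent β, LinearMap.trace F V (X * Y) = 0}

/-- sum of two subsets of `A` -/
def setAdd (s t : Set (Module.End F V)) : Set (Module.End F V) :=
  {z | ∃ x ∈ s, ∃ y ∈ t, z = x + y}

/-- `𝔍 = a'_n ⊕ a^⊥_{[(n+1)/2]}` -/
def frakJ (Λ : S.LatSeq) (n : ℤ) (β : Module.End F V) : Set (Module.End F V) :=
  setAdd (S.aFil Λ n ∩ Bcent β) (S.aFil Λ ((n + 1) / 2) ∩ Bperp β)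

/-- `𝔍₊ = a'_n ⊕ a^⊥_{[n/2]+1}` -/
def frakJplus (Λ : S.LatSeq) (n : ℤ) (β : Module.End F V) : Set (Module.End F V) :=
  setAdd (S.aFil Λ n ∩ Bcent β) (S.aFil Λ (n / 2 + 1) ∩ Bperp β)

/-- `J = (1 + 𝔍) ∩ G` -/
def Jset (Λ : S.LatSeq) (n : ℤ) (β : Module.End F V) : Set S.GU :=
  {g : S.GU | S.toE g - 1 ∈ S.frakJ Λ n β}

/-- `J₊ = (1 + 𝔍₊) ∩ G` -/
def Jplusset (Λ : S.LatSeq) (n : ℤ) (β : Module.End F V) : Set S.GU :=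
  {g : S.GU | S.toE g - 1 ∈ S.frakJplus Λ n β}

/-- `G_E = G ∩ B`, the `G`-centralizer of `β` -/
def GEset (β : Module.End F V) : Set S.GU := {g : S.GU | S.toE g ∈ Bcent β}

/-- the set `J G_E J` -/
def JGEJ (Λ : S.LatSeq) (n : ℤ) (β : Module.End F V) : Set S.GU :=
  {a : S.GU | ∃ j₁ ∈ S.Jset Λ n β, ∃ c ∈ S.GEset β, ∃ j₂ ∈ S.Jset Λ n β, a = j₁ * c * j₂}

/-- `ν_Λ(X) = k`, i.e. `X ∈ a_k(Λ) \ a_{k+1}(Λ)` -/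
def HasVal (Λ : S.LatSeq) (X : Module.End F V) (k : ℤ) : Prop :=
  X ∈ S.aFil Λ k ∧ X ∉ S.aFil Λ (k + 1)

/-- `y_β = ϖ^{n/k} β^{e/k}` where `k = gcd(e(Λ), n)` -/
def ybeta (Λ : S.LatSeq) (n : ℤ) (β : Module.End F V) : Module.End F V :=
  S.ϖ ^ ((n / (Int.gcd Λ.e n : ℤ)).toNat) • β ^ ((Λ.e / (Int.gcd Λ.e n : ℤ)).toNat)

/-- two polynomials over `F` with integral coefficients are coprime modulo `p_F` -/
def CoprimeModP (f g : Polynomial F) : Prop :=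
  ∃ u v : Polynomial F, (∀ i, u.coeff i ∈ S.O) ∧ (∀ i, v.coeff i ∈ S.O) ∧
    ∀ i, (u * f + v * g - 1).coeff i ∈ S.pF

/-- the filtration `a_m(Λ ∩ U)` on `End_F(U)` cut out by a subspace `U ⊆ V` -/
def aFilOn (Λ : S.LatSeq) (U : Submodule F V) (m : ℤ) : Set (Module.End F U) :=
  {X : Module.End F U | ∀ i : ℤ, ∀ v : U, (v : V) ∈ Λ.L i → ((X v : U) : V) ∈ Λ.L (i + m)}

def HasValOn (Λ : S.LatSeq) (U : Submodule F V) (X : Module.End F U) (k : ℤ) : Prop :=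
  X ∈ S.aFilOn Λ U k ∧ X ∉ S.aFilOn Λ U (k + 1)

/-- `x` is integral over `o_F` -/
def IsIntegralO {R : Type*} [Ring R] [Algebra F R] (x : R) : Prop :=
  ∃ p : Polynomial F, p.Monic ∧ (∀ i, p.coeff i ∈ S.O) ∧ Polynomial.aeval x p = 0

/-- `[Λ|U, n, n-1, βU]` is a simple stratum: `E = F[βU]` is a field, `Λ|U` is an
`o_E`-lattice sequence, `ν(βU) = -n`, and `βU` is minimal over `F` (expressed by
the standard equivalent exactness property of `ad(βU)`, cf. Bushnell–Kutzko
(1.4.9), (1.4.15)). -/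
def SimpleOn (Λ : S.LatSeq) (n : ℤ) (U : Submodule F V) (βU : Module.End F U) : Prop :=
  IsField (Algebra.adjoin F ({βU} : Set (Module.End F U))) ∧
  (∀ x : Module.End F U, x ∈ Algebra.adjoin F ({βU} : Set (Module.End F U)) →
      S.IsIntegralO x → ∀ i : ℤ, ∀ v : U, (v : V) ∈ Λ.L i → ((x v : U) : V) ∈ Λ.L i) ∧
  S.HasValOn Λ U βU (-n) ∧
  (∀ m : ℤ, ∀ X ∈ S.aFilOn Λ U m, βU * X - X * βU ∈ S.aFilOn Λ U (m - n + 1) →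
      ∃ Y : Module.End F U, Y * βU = βU * Y ∧ X - Y ∈ S.aFilOn Λ U (m + 1))

/-- `E = F[βU]` is tamely ramified over `F`: the ramification index
`e(E/F) = e(Λ)/g`, where `g` generates the value group `ν_Λ(E^×)`, is prime to
the residue characteristic. -/
def TameOn (Λ : S.LatSeq) (U : Submodule F V) (βU : Module.End F U) : Prop :=
  ∃ g : ℤ, 0 < g ∧
    (∀ x : Module.End F U, x ∈ Algebra.adjoin F ({βU} : Set (Module.End F U)) → x ≠ 0 →
        ∃ m : ℤ, g ∣ m ∧ S.HasValOn Λ U x m) ∧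
    (∃ x : Module.End F U, x ∈ Algebra.adjoin F ({βU} : Set (Module.End F U)) ∧
        S.HasValOn Λ U x g) ∧
    ¬ ((S.residueChar : ℤ) ∣ (Λ.e / g))

/-- restriction of an endomorphism to an invariant subspace -/
def restr (β : Module.End F V) (U : Submodule F V) (hU : ∀ v ∈ U, β v ∈ U) :
    Module.End F U :=
  LinearMap.restrict β hU

lemma pow_inv (β : Module.End F V) (U : Submodule F V) (hU : ∀ v ∈ U, β v ∈ U) :
    ∀ m : ℕ, ∀ v ∈ U, (β ^ m) v ∈ U := by
  intro m
  induction m with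
  | zero => intro v hv; simpa using hv
  | succ t ih =>
      intro v hv
      rw [pow_succ]
      exact ih _ (hU v hv)

lemma ybeta_inv (Λ : S.LatSeq) (n : ℤ) (β : Module.End F V) (U : Submodule F V)
    (hU : ∀ v ∈ U, β v ∈ U) : ∀ v ∈ U, S.ybeta Λ n β v ∈ U := by
  intro v hv
  show (S.ϖ ^ ((n / (Int.gcd Λ.e n : ℤ)).toNat) •
      β ^ ((Λ.e / (Int.gcd Λ.e n : ℤ)).toNat)) v ∈ U
  rw [LinearMap.smul_apply]
  exact U.smul_mem _ (pow_inv β U hU _ v hv)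

variable [FiniteDimensional F V]

/-- `[Λ, n, n-1, β]` is a skew semisimple stratum, split with respect to the
orthogonal `F`-splitting `V = W 0 ⊥ … ⊥ W (k-1)`: `Λ` is a full self-dual
lattice sequence, `β` is skew with `ν_Λ(β) = -n`, the splitting is orthogonal,
compatible with `Λ` and preserved by `β`, each restricted stratum is zero or
simple, no characteristic polynomial of a nonzero component is divisible by `X`
mod `p_F`, and the characteristic polynomials of distinct components are
coprime mod `p_F`. -/
structure IsSkewSS (Λ : S.LatSeq) (n : ℤ) (β : Module.End F V)
    (k : ℕ) (W : Fin k → Submodule F V) : Prop where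
  full : S.IsFull Λ
  selfdual : S.isSelfDual Λ
  n_pos : 0 < n
  skew : β ∈ S.Aminus
  mem : β ∈ S.aFil Λ (-n)
  val : β ∉ S.aFil Λ (1 - n)
  k_pos : 0 < k
  internal : DirectSum.IsInternal W
  orth : ∀ i j, i ≠ j → ∀ v ∈ W i, ∀ w ∈ W j, S.h v w = 0
  lat_compat : ∀ m : ℤ, ∀ f : Fin k → V, (∀ i, f i ∈ W i) →
      ((∑ i, f i) ∈ Λ.L m ↔ ∀ i, f i ∈ Λ.L m)
  β_inv : ∀ i, ∀ v ∈ W i, β v ∈ W i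
  comp : ∀ i, (∀ v ∈ W i, β v = 0) ∨ S.SimpleOn Λ n (W i) (restr β (W i) (β_inv i))
  comp_nondeg : ∀ i, ¬ (∀ v ∈ W i, β v = 0) →
      (LinearMap.charpoly
        (restr (S.ybeta Λ n β) (W i) (S.ybeta_inv Λ n β (W i) (β_inv i)))).coeff 0 ∉ S.pF
  coprime : ∀ i j, i ≠ j →
      S.CoprimeModP
        (LinearMap.charpoly
          (restr (S.ybeta Λ n β) (W i) (S.ybeta_inv Λ n β (W i) (β_inv i))))
        (LinearMap.charpoly
          (restr (S.ybeta Λ n β) (W j) (S.ybeta_inv Λ n β (W j) (β_inv j))))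

/-- the stratum `[Λ, n, n-1, β]` is fundamental: the reduction mod `p_F` of the
characteristic polynomial of `y_β` is not `X^N` -/
def IsFundamental (Λ : S.LatSeq) (n : ℤ) (β : Module.End F V) : Prop :=
  ¬ ∀ i : ℕ, i < Module.finrank F V →
      (LinearMap.charpoly (S.ybeta Λ n β)).coeff i ∈ S.pF

section Char

variable (F₀ : Type w) [Field F₀] [Algebra F₀ F]

/-- `tr_{A/F₀} = tr_{F/F₀} ∘ tr_{A/F}` -/
def trA0 (X : Module.End F V) : F₀ := Algebra.trace F₀ F (LinearMap.trace F V X)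

/-- the character `ψ_β(x) = ψ₀(tr_{A/F₀}(β(x-1)))` -/
def psiCh (ψ₀ : F₀ → ℂ) (β : Module.End F V) (g : S.GU) : ℂ :=
  ψ₀ (trA0 F₀ (β * (S.toE g - 1)))

/-- `ψ₀` is an additive character of `F₀` with conductor `p₀` -/
def IsAddCh (ψ₀ : F₀ → ℂ) : Prop :=
  (∀ x y : F₀, ψ₀ (x + y) = ψ₀ x * ψ₀ y) ∧
  (∀ x : F₀, algebraMap F₀ F x ∈ S.pF → ψ₀ x = 1) ∧
  (∃ x : F₀, algebraMap F₀ F x ∈ S.O ∧ ψ₀ x ≠ 1)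

/-- `F₀` is the fixed field of the involution -/
def FixedField : Prop := ∀ x : F, S.conj x = x ↔ x ∈ (algebraMap F₀ F).range

end Char

section Rep

variable {W : Type*} [AddCommGroup W] [Module ℂ W]

/-- smoothness of a representation of `G` (relative to the lattice sequence `Λ`:
the groups `P_k(Λ)`, `k ≥ 1`, form a basis of neighborhoods of the identity) -/
def SmoothRel (Λ : S.LatSeq) (π : S.GU →* Module.End ℂ W) : Prop :=
  ∀ w : W, ∃ k : ℤ, 1 ≤ k ∧ ∀ g ∈ S.Pset Λ k, π g w = w

/-- smoothness of a representation of `G` -/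
def Smooth (π : S.GU →* Module.End ℂ W) : Prop :=
  ∀ w : W, ∃ Λ : S.LatSeq, S.IsFull Λ ∧ S.isSelfDual Λ ∧
    ∃ k : ℤ, 1 ≤ k ∧ ∀ g ∈ S.Pset Λ k, π g w = w

/-- irreducibility -/
def Irred (π : S.GU →* Module.End ℂ W) : Prop :=
  (∃ w : W, w ≠ 0) ∧
  ∀ U : Submodule ℂ W, (∀ g : S.GU, ∀ w ∈ U, π g w ∈ U) → U = ⊥ ∨ U = ⊤

/-- `π` contains the character `χ` of the subset `K ⊆ G` -/
def ContainsChar (π : S.GU →* Module.End ℂ W) (K : Set S.GU) (χ : S.GU → ℂ) : Prop :=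
  ∃ w : W, w ≠ 0 ∧ ∀ g ∈ K, π g w = χ g • w

/-- `π` has positive level: no nonzero `P_1(Λ)`-fixed vector for any self-dual `Λ` -/
def PositiveLevel (π : S.GU →* Module.End ℂ W) : Prop :=
  ∀ Λ : S.LatSeq, S.IsFull Λ → S.isSelfDual Λ →
    ∀ w : W, (∀ g ∈ S.Pset Λ 1, π g w = w) → w = 0

end Rep

section Hecke

/-- the double coset `KgK` -/
def dCoset (K : Subgroup S.GU) (g : S.GU) : Set S.GU :=
  {a : S.GU | ∃ x ∈ K, ∃ y ∈ K, a = x * g * y}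

/-- the double coset `KgK` for a subset `K` -/
def dCosetSet (K : Set S.GU) (g : S.GU) : Set S.GU :=
  {a : S.GU | ∃ x ∈ K, ∃ y ∈ K, a = x * g * y}

/-- convolution of two functions on `G` relative to the open compact subgroup `K`
(Haar measure normalized by `vol(K) = 1`):
`(f₁ * f₂)(g) = ∑_{xK ∈ G/K} f₁(x) f₂(x⁻¹ g)`. -/
def hConv {M : Type*} [Ring M] (K : Subgroup S.GU) (f₁ f₂ : S.GU → M) : S.GU → M :=
  fun g => ∑ᶠ q : S.GU ⧸ K, f₁ (Quotient.out q) * f₂ ((Quotient.out q)⁻¹ * g)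

/-- `f` belongs to the Hecke algebra `H(G//K, τ)` with support contained in `supp`:
`f(kgk') = τ(k) f(g) τ(k')` for `k, k' ∈ K`, and `f` is compactly supported
(its support meets only finitely many cosets of `K`). -/
def IsHecke {M : Type*} [Ring M] (K : Subgroup S.GU) (supp : Set S.GU)
    (τ : S.GU → M) (f : S.GU → M) : Prop :=
  (∀ k ∈ K, ∀ g : S.GU, ∀ k' ∈ K, f (k * g * k') = τ k * f g * τ k') ∧
  Function.support f ⊆ supp ∧
  ((fun a : S.GU => (QuotientGroup.mk a : S.GU ⧸ K)) '' Function.support f).Finite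

/-- `[KgK : K] = [K : K ∩ gKg⁻¹]`, the number of left cosets of `K` in `KgK` -/
def dcIndex (K : Subgroup S.GU) (g : S.GU) : ℕ :=
  Nat.card ((fun a : S.GU => (QuotientGroup.mk a : S.GU ⧸ K)) '' S.dCoset K g)

end Hecke


section U4

/-! Concrete data for the non quasi-split unramified unitary group in four
variables: `V = F^4`, `h(v,w) = ᵗv̄ H w` with `H = E₁₄ + ϖE₂₂ + E₃₃ + E₄₁`,
the standard lattices `N₀, N₁` and their duals, and the standard self-dual
lattice sequences `Λ₁, …, Λ₅`. -/

variable (T : USetting F (Fin 4 → F))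

/-- the hermitian form of the non quasi-split unramified `U(4)`:
`h(v, w) = ᵗv̄ H w`, `H = E₁₄ + ϖE₂₂ + E₃₃ + E₄₁` -/
def IsU4Form : Prop :=
  ∀ v w : Fin 4 → F, T.h v w =
    T.conj (v 0) * w 3 + T.ϖ * (T.conj (v 1) * w 1) + T.conj (v 2) * w 2 +
      T.conj (v 3) * w 0

/-- `F/F₀` is quadratic unramified with common uniformizer `ϖ`:
`ϖ` is fixed by the involution, and `F = F₀[√ε]` for a non-square unit `ε` of `o₀`. -/
def IsUnramifiedQuadratic : Prop :=
  T.conj T.ϖ = T.ϖ ∧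
  ∃ ε s : F, ε ∈ T.O ∧ (∃ y ∈ T.O, ε * y = 1) ∧ T.conj ε = ε ∧
    (¬ ∃ y : F, T.conj y = y ∧ y ^ 2 = ε) ∧ s ^ 2 = ε ∧ T.conj s = -s

/-- `N₀ = o_F e₁ ⊕ o_F e₂ ⊕ o_F e₃ ⊕ o_F e₄` -/
def N0 : Set (Fin 4 → F) := {v | ∀ j, v j ∈ T.O}

/-- `N₁ = o_F e₁ ⊕ o_F e₂ ⊕ o_F e₃ ⊕ p_F e₄` -/
def N1 : Set (Fin 4 → F) := {v | (∀ j, v j ∈ T.O) ∧ v 3 ∈ T.pF}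

/-- `N₀^# = o_F e₁ ⊕ p_F⁻¹ e₂ ⊕ o_F e₃ ⊕ o_F e₄` -/
def N0s : Set (Fin 4 → F) :=
  {v | v 0 ∈ T.O ∧ T.ϖ * v 1 ∈ T.O ∧ v 2 ∈ T.O ∧ v 3 ∈ T.O}

/-- `N₁^# = p_F⁻¹ e₁ ⊕ p_F⁻¹ e₂ ⊕ o_F e₃ ⊕ o_F e₄` -/
def N1s : Set (Fin 4 → F) :=
  {v | T.ϖ * v 0 ∈ T.O ∧ T.ϖ * v 1 ∈ T.O ∧ v 2 ∈ T.O ∧ v 3 ∈ T.O}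

/-- `Λ₁(2i) = ϖ^i N₀`, `Λ₁(2i+1) = ϖ^{i+1} N₀^#` -/
def IsLam1 (Λ : T.LatSeq) : Prop :=
  Λ.e = 2 ∧ ∀ i : ℤ,
    Λ.L (2*i) = T.ϖ ^ i • T.N0 ∧ Λ.L (2*i+1) = T.ϖ ^ (i+1) • T.N0s

/-- `Λ₂(2i) = ϖ^i N₁`, `Λ₂(2i+1) = ϖ^{i+1} N₁^#` -/
def IsLam2 (Λ : T.LatSeq) : Prop :=
  Λ.e = 2 ∧ ∀ i : ℤ,
    Λ.L (2*i) = T.ϖ ^ i • T.N1 ∧ Λ.L (2*i+1) = T.ϖ ^ (i+1) • T.N1s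

/-- `Λ₃(4i) = ϖ^i N₀`, `Λ₃(4i+1) = ϖ^i N₁`, `Λ₃(4i+2) = ϖ^{i+1} N₁^#`,
`Λ₃(4i+3) = ϖ^{i+1} N₀^#` -/
def IsLam3 (Λ : T.LatSeq) : Prop :=
  Λ.e = 4 ∧ ∀ i : ℤ,
    Λ.L (4*i) = T.ϖ ^ i • T.N0 ∧ Λ.L (4*i+1) = T.ϖ ^ i • T.N1 ∧
    Λ.L (4*i+2) = T.ϖ ^ (i+1) • T.N1s ∧ Λ.L (4*i+3) = T.ϖ ^ (i+1) • T.N0s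

/-- `Λ₄(6i) = Λ₄(6i+1) = ϖ^i N₀`, `Λ₄(6i+2) = ϖ^i N₁`, `Λ₄(6i+3) = ϖ^{i+1} N₁^#`,
`Λ₄(6i+4) = Λ₄(6i+5) = ϖ^{i+1} N₀^#` -/
def IsLam4 (Λ : T.LatSeq) : Prop :=
  Λ.e = 6 ∧ ∀ i : ℤ,
    Λ.L (6*i) = T.ϖ ^ i • T.N0 ∧ Λ.L (6*i+1) = T.ϖ ^ i • T.N0 ∧
    Λ.L (6*i+2) = T.ϖ ^ i • T.N1 ∧ Λ.L (6*i+3) = T.ϖ ^ (i+1) • T.N1s ∧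
    Λ.L (6*i+4) = T.ϖ ^ (i+1) • T.N0s ∧ Λ.L (6*i+5) = T.ϖ ^ (i+1) • T.N0s

/-- `Λ₅(6i-1) = ϖ^i N₀`, `Λ₅(6i) = Λ₅(6i+1) = ϖ^i N₁`,
`Λ₅(6i+2) = Λ₅(6i+3) = ϖ^{i+1} N₁^#`, `Λ₅(6i+4) = ϖ^{i+1} N₀^#` -/
def IsLam5 (Λ : T.LatSeq) : Prop :=
  Λ.e = 6 ∧ ∀ i : ℤ,
    Λ.L (6*i-1) = T.ϖ ^ i • T.N0 ∧ Λ.L (6*i) = T.ϖ ^ i • T.N1 ∧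
    Λ.L (6*i+1) = T.ϖ ^ i • T.N1 ∧ Λ.L (6*i+2) = T.ϖ ^ (i+1) • T.N1s ∧
    Λ.L (6*i+3) = T.ϖ ^ (i+1) • T.N1s ∧ Λ.L (6*i+4) = T.ϖ ^ (i+1) • T.N0s

/-- the matrix of `β = ϖ^{-m}(Y E₂₃ - ϖ Ȳ E₃₂)` -/
def betaMat (m : ℤ) (Y : F) : Matrix (Fin 4) (Fin 4) F :=
  fun i j =>
    if i = 1 ∧ j = 2 then T.ϖ ^ (-m) * Y
    else if i = 2 ∧ j = 1 then -(T.ϖ ^ (1 - m) * T.conj Y) else 0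

/-- the matrix of `s₁ = E₁₄ + E₂₂ + E₃₃ + E₄₁` -/
def s1Mat : Matrix (Fin 4) (Fin 4) F :=
  !![0,0,0,1; 0,1,0,0; 0,0,1,0; 1,0,0,0]

/-- the matrix of `s₂ = ϖ⁻¹E₁₄ + E₂₂ + E₃₃ + ϖE₄₁` -/
def s2Mat : Matrix (Fin 4) (Fin 4) F :=
  !![0,0,0,T.ϖ⁻¹; 0,1,0,0; 0,0,1,0; T.ϖ,0,0,0]

end U4

end USetting

namespace U4P
open USetting

variable {F : Type u} [Field F] {T : USetting F (Fin 4 → F)}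

structure Hyp (T : USetting F (Fin 4 → F)) : Prop where
  odd : ¬ (2 ∣ T.residueChar)
  form : T.IsU4Form
  unram : T.IsUnramifiedQuadratic

/-- `x ∈ ϖ^j O` -/
def I (T : USetting F (Fin 4 → F)) (j : ℤ) (x : F) : Prop := T.ϖ ^ (-j) * x ∈ T.O

lemma I_zero (j : ℤ) : I T j 0 := by simp [I, T.O.zero_mem]
lemma I_add {j : ℤ} {x y : F} (hx : I T j x) (hy : I T j y) : I T j (x + y) := by
  unfold I at *; rw [mul_add]; exact T.O.add_mem hx hy
lemma I_neg {j : ℤ} {x : F} (hx : I T j x) : I T j (-x) := by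
  unfold I at *; rw [mul_neg]; exact T.O.neg_mem hx
lemma I_sub {j : ℤ} {x y : F} (hx : I T j x) (hy : I T j y) : I T j (x - y) := by
  rw [sub_eq_add_neg]; exact I_add hx (I_neg hy)
lemma I_mul {i j : ℤ} {x y : F} (hx : I T i x) (hy : I T j y) : I T (i + j) (x * y) := by
  unfold I at *
  have : T.ϖ ^ (-(i+j)) * (x * y) = (T.ϖ ^ (-i) * x) * (T.ϖ ^ (-j) * y) := by
    rw [neg_add, zpow_add₀ T.ϖ_ne_zero]; ring
  rw [this]; exact T.O.mul_mem hx hy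
lemma I0 {x : F} : I T 0 x ↔ x ∈ T.O := by simp [I]
lemma I1 {x : F} : I T 1 x ↔ x ∈ T.pF := by
  unfold I USetting.pF
  constructor
  · intro h
    refine ⟨_, h, ?_⟩
    rw [zpow_neg_one, mul_inv_cancel_left₀ T.ϖ_ne_zero]
  · rintro ⟨z, hz, rfl⟩
    rw [zpow_neg_one, inv_mul_cancel_left₀ T.ϖ_ne_zero]; exact hz
lemma I_pow (j : ℤ) : I T j (T.ϖ ^ j) := by
  unfold I; rw [← zpow_add₀ T.ϖ_ne_zero]; simp [T.O.one_mem]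
lemma I_ϖ : I T 1 T.ϖ := by simpa using I_pow (T := T) 1
lemma I_one : I T 0 (1 : F) := by simp [I, T.O.one_mem]
lemma I_ofO {j : ℤ} {c x : F} (hc : c ∈ T.O) (hx : I T j x) : I T j (c * x) := by
  simpa using I_mul (I0.2 hc) hx
lemma I_mono {i j : ℤ} (h : i ≤ j) {x : F} (hx : I T j x) : I T i x := by
  have h2 : I T (j - i) (1 : F) → I T i x := by
    intro h; unfold I at *
    obtain ⟨k, hk⟩ := Int.le.dest (show i ≤ j by assumption)
    have : T.ϖ ^ (-i) * x = T.ϖ ^ k * (T.ϖ ^ (-j) * x) := by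
      rw [← zpow_natCast, ← mul_assoc, ← zpow_add₀ T.ϖ_ne_zero]; congr 2; omega
    rw [this]; exact T.O.mul_mem (T.O.pow_mem T.ϖ_mem _) hx
  obtain ⟨k, hk⟩ := Int.le.dest h
  unfold I at *
  have : T.ϖ ^ (-i) * x = T.ϖ ^ k * (T.ϖ ^ (-j) * x) := by
    rw [← zpow_natCast, ← mul_assoc, ← zpow_add₀ T.ϖ_ne_zero]; congr 2; omega
  rw [this]; exact T.O.mul_mem (T.O.pow_mem T.ϖ_mem _) hx
lemma I_shift {i j : ℤ} {x : F} : I T i (T.ϖ ^ j * x) ↔ I T (i - j) x := by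
  unfold I; rw [← mul_assoc, ← zpow_add₀ T.ϖ_ne_zero]; congr! 3; ring
lemma I_sum {ι : Type*} (s : Finset ι) (f : ι → F) (j : ℤ) (h : ∀ i ∈ s, I T j (f i)) :
    I T j (∑ i ∈ s, f i) := by
  induction s using Finset.induction_on with
  | empty => simpa using I_zero j
  | insert a s ha ih =>
    rw [Finset.sum_insert ha]
    exact I_add (h a (Finset.mem_insert_self _ _)) (ih fun i hi => h i (Finset.mem_insert_of_mem hi))
lemma not_pF_one : ¬ I T 1 (1 : F) := by
  rw [I1]; rintro ⟨z, hz, h⟩; exact T.ϖ_not_unit z hz h.symm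
/-- nonintegral below -/
lemma I_inv {j : ℤ} {x : F} (h : ¬ I T (j + 1) x) : I T (-j) x⁻¹ := by
  have hx : x ≠ 0 := by rintro rfl; exact h (I_zero _)
  set y := T.ϖ ^ (-j) * x with hy
  have hy0 : y ≠ 0 := mul_ne_zero (zpow_ne_zero _ T.ϖ_ne_zero) hx
  have key : y⁻¹ ∈ T.O := by
    rcases T.O_val y hy0 with h1 | h1
    · by_contra h2
      obtain ⟨z, hz, hz'⟩ := T.unif y h1 (by
        intro w hw hw'; apply h2
        rw [← eq_inv_of_mul_eq_one_right hw']; exact hw)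
      apply h
      unfold I
      have : T.ϖ ^ (-(j+1)) * x = z := by
        have : T.ϖ ^ (-(j+1)) * x = T.ϖ⁻¹ * y := by
          rw [hy, ← mul_assoc, ← zpow_neg_one, ← zpow_add₀ T.ϖ_ne_zero]; congr 2; ring
        rw [this, hz', inv_mul_cancel_left₀ T.ϖ_ne_zero]
      rw [this]; exact hz
    · exact h1
  unfold I
  rw [hy, mul_inv, ← zpow_neg] at key; simpa using key
lemma O_of_not {x : F} (h : ¬ x ∈ T.O) : I T 1 x⁻¹ := by
  by_contra h2
  have h3 := I_inv (T := T) (j := 0) (x := x⁻¹) (by simpa using h2)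
  rw [inv_inv] at h3; exact h (I0.1 (by simpa using h3))
lemma I_total (x y : F) (hy : y ≠ 0) : (∃ c ∈ T.O, x = c * y) ∨ (∃ c ∈ T.O, y = c * x) := by
  by_cases hx : x = 0
  · left; exact ⟨0, T.O.zero_mem, by simp [hx]⟩
  rcases T.O_val (x / y) (div_ne_zero hx hy) with h | h
  · left; exact ⟨_, h, by field_simp⟩
  · right; exact ⟨_, h, by field_simp⟩


lemma Hyp.conjϖ (H : Hyp T) : T.conj T.ϖ = T.ϖ := H.unram.1
lemma Hyp.I_conj (H : Hyp T) {j : ℤ} {x : F} (hx : I T j x) : I T j (T.conj x) := by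
  unfold I at *
  have := T.conj_O _ hx
  rwa [map_mul, map_zpow₀, H.conjϖ] at this

lemma Hyp.two (H : Hyp T) : ∃ z ∈ T.O, 2 * z = 1 := by
  by_contra hcon
  push Not at hcon
  have h2 : (2:F) ∈ T.O := by
    have := T.O.add_mem T.O.one_mem T.O.one_mem
    rwa [one_add_one_eq_two] at this
  obtain ⟨z, hz, hz'⟩ := T.unif 2 h2 hcon
  apply H.odd
  unfold USetting.residueChar
  have hd : ringChar (T.O ⧸ (Ideal.span {(⟨T.ϖ, T.ϖ_mem⟩ : T.O)} : Ideal T.O)) ∣ 2 := by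
    rw [← ringChar.spec]
    have : ((2:ℕ) : T.O ⧸ (Ideal.span {(⟨T.ϖ, T.ϖ_mem⟩ : T.O)} : Ideal T.O)) =
        Ideal.Quotient.mk _ (1 + 1 : T.O) := by
      rw [map_add, map_one, one_add_one_eq_two]; simp
    rw [this, Ideal.Quotient.eq_zero_iff_mem, Ideal.mem_span_singleton]
    refine ⟨⟨z, hz⟩, Subtype.ext ?_⟩
    show ((1:F) + 1) = T.ϖ * z
    rw [one_add_one_eq_two, hz']
  rcases (Nat.dvd_prime Nat.prime_two).1 hd with h1 | h1
  · exfalso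
    have h3 : ((1:ℕ) : T.O ⧸ (Ideal.span {(⟨T.ϖ, T.ϖ_mem⟩ : T.O)} : Ideal T.O)) = 0 := by
      rw [ringChar.spec, h1]
    have : ((1:ℕ) : T.O ⧸ (Ideal.span {(⟨T.ϖ, T.ϖ_mem⟩ : T.O)} : Ideal T.O)) =
        Ideal.Quotient.mk _ (1 : T.O) := by simp
    rw [this, Ideal.Quotient.eq_zero_iff_mem, Ideal.mem_span_singleton] at h3
    obtain ⟨c, hc⟩ := h3
    apply T.ϖ_not_unit c.1 c.2
    have := congrArg Subtype.val hc
    simpa using this.symm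
  · rw [h1]

lemma Hyp.two_ne (H : Hyp T) : (2:F) ≠ 0 := by
  obtain ⟨z, -, h⟩ := H.two
  rintro h2; rw [h2] at h; simp at h
lemma Hyp.half (H : Hyp T) : (2⁻¹ : F) ∈ T.O := by
  obtain ⟨z, hz, h⟩ := H.two
  rwa [← eq_inv_of_mul_eq_one_right h]
lemma half_conj : T.conj (2⁻¹ : F) = 2⁻¹ := by
  rw [map_inv₀, map_ofNat]

/-- skew unit -/
lemma Hyp.s0 (H : Hyp T) : ∃ s : F, s ∈ T.O ∧ s⁻¹ ∈ T.O ∧ s ≠ 0 ∧ T.conj s = -s := by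
  obtain ⟨-, ε, s, hε, ⟨y, hy, hy'⟩, -, -, hs, hsc⟩ := H.unram
  have hs0 : s ≠ 0 := by
    rintro rfl; simp at hs; rw [← hs] at hy'; simp at hy'
  have hsq : s * s * y = 1 := by rw [← sq, hs, hy']
  have hinv : s⁻¹ = s * y := by
    rw [mul_assoc] at hsq; exact (eq_inv_of_mul_eq_one_right hsq).symm
  have hinv2 : s = s⁻¹ * ε := by rw [← hs]; field_simp
  rcases T.O_val s hs0 with h | h
  · exact ⟨s, h, hinv ▸ T.O.mul_mem h hy, hs0, hsc⟩
  · exact ⟨s, hinv2 ▸ T.O.mul_mem h hε, h, hs0, hsc⟩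

lemma unit_one_add {z : F} (hz : I T 1 z) : 1 + z ≠ 0 ∧ (1 + z)⁻¹ ∈ T.O := by
  have h : ¬ I T 1 (1 + z) := by
    intro h; apply not_pF_one (T := T)
    have := I_sub h hz; simpa using this
  refine ⟨by intro h0; rw [h0] at h; exact h (I_zero _), ?_⟩
  have := I_inv (T := T) (j := 0) (x := 1 + z) (by simpa using h)
  exact I0.1 (by simpa using this)

lemma Hyp.noUnit (H : Hyp T) {x : F} (h : I T 0 (T.ϖ * (x * T.conj x))) :
    I T 1 (T.ϖ * (x * T.conj x)) := by
  by_cases hx : x ∈ T.O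
  · have := I_mul (I_ϖ (T := T)) (I_mul (I0.2 hx) (H.I_conj (I0.2 hx)))
    simpa using this
  · exfalso
    have hx0 : x ≠ 0 := by rintro rfl; exact hx T.O.zero_mem
    have hx1 : T.conj x ≠ 0 := by simpa using hx0
    have h1 := O_of_not hx
    have h2 := I_mul h (I_mul h1 (H.I_conj h1))
    have : T.ϖ * (x * T.conj x) * (x⁻¹ * T.conj x⁻¹) = T.ϖ := by
      rw [map_inv₀]; field_simp
    rw [this] at h2
    have h3 : I T (2 - 1) (1:F) := by
      rw [← I_shift, zpow_one, mul_one]; simpa using h2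
    exact not_pF_one (by simpa using h3)

lemma Hyp.aniso (H : Hyp T) (x y A : F) (hA : A = T.ϖ * (x * T.conj x) + y * T.conj y) :
    ∃ o₁ ∈ T.O, ∃ o₂ ∈ T.O, T.ϖ * (x * T.conj x) = A * o₁ ∧ y * T.conj y = A * o₂ := by
  by_cases hx : x = 0
  · exact ⟨0, T.O.zero_mem, 1, T.O.one_mem, by simp [hA, hx]⟩
  by_cases hy : y = 0
  · exact ⟨1, T.O.one_mem, 0, T.O.zero_mem, by simp [hA, hy]⟩
  have hx1 : T.conj x ≠ 0 := by simpa using hx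
  have hy1 : T.conj y ≠ 0 := by simpa using hy
  have hϖ := T.ϖ_ne_zero
  by_cases hr : I T 1 (y * x⁻¹)
  · have h1 : I T 1 (T.ϖ⁻¹ * ((y * x⁻¹) * T.conj (y * x⁻¹))) := by
      have := I_mul (I_pow (T := T) (-1)) (I_mul hr (H.I_conj hr))
      simpa using this
    obtain ⟨hn, hu⟩ := unit_one_add h1
    have h0 := I_mono (show (0:ℤ) ≤ 1 by norm_num) h1
    set z := T.ϖ⁻¹ * ((y * x⁻¹) * T.conj (y * x⁻¹)) with hz
    have hAz : A = T.ϖ * (x * T.conj x) * (1 + z) := by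
      rw [hA, hz, map_mul, map_inv₀]; field_simp
    have hyz : y * T.conj y = T.ϖ * (x * T.conj x) * z := by
      rw [hz, map_mul, map_inv₀]; field_simp
    refine ⟨(1+z)⁻¹, hu, z * (1+z)⁻¹, T.O.mul_mem (I0.1 h0) hu, ?_, ?_⟩
    · rw [hAz]; field_simp
    · rw [hAz, hyz]; field_simp
  · have hr1 : I T 0 (y * x⁻¹)⁻¹ := by
      have := I_inv (T := T) (j := 0) (x := y * x⁻¹) (by simpa using hr)
      simpa using this
    have h1 : I T 1 (T.ϖ * ((y * x⁻¹)⁻¹ * T.conj (y * x⁻¹)⁻¹)) := by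
      have := I_mul (I_ϖ (T := T)) (I_mul hr1 (H.I_conj hr1))
      simpa using this
    obtain ⟨hn, hu⟩ := unit_one_add h1
    have h0 := I_mono (show (0:ℤ) ≤ 1 by norm_num) h1
    set z := T.ϖ * ((y * x⁻¹)⁻¹ * T.conj (y * x⁻¹)⁻¹) with hz
    have hyz : T.ϖ * (x * T.conj x) = y * T.conj y * z := by
      rw [hz, map_inv₀, map_mul, map_inv₀]; field_simp
    have hAz : A = y * T.conj y * (1 + z) := by
      rw [hA, hyz]; ring
    refine ⟨z * (1+z)⁻¹, T.O.mul_mem (I0.1 h0) hu, (1+z)⁻¹, hu, ?_, ?_⟩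
    · rw [hAz, hyz]; field_simp
    · rw [hAz]; field_simp

/-! base field -/
structure Hyp0 (T : USetting F (Fin 4 → F)) (F₀ : Type w) [Field F₀] [Algebra F₀ F]
    (ψ₀ : F₀ → ℂ) : Prop where
  fd : FiniteDimensional F₀ F
  fix : T.FixedField F₀
  deg : Module.finrank F₀ F = 2
  ψ : T.IsAddCh F₀ ψ₀

section base
variable {F₀ : Type w} [Field F₀] [Algebra F₀ F] {ψ₀ : F₀ → ℂ}

def conjAlg (hf : T.FixedField F₀) : F ≃ₐ[F₀] F :=
  AlgEquiv.ofRingEquiv (f := T.conj) (fun x => (hf _).2 ⟨x, rfl⟩)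

lemma trace_eq (H : Hyp T) (H0 : Hyp0 T F₀ ψ₀) (x : F) :
    algebraMap F₀ F (Algebra.trace F₀ F x) = x + T.conj x := by
  have h1 : ∀ x, Algebra.trace F₀ F (T.conj x) = Algebra.trace F₀ F x := fun x =>
    Algebra.trace_eq_of_algEquiv (conjAlg H0.fix) x
  have h2 : (2:F₀) ≠ 0 := by
    intro h; apply H.two_ne
    have := congrArg (algebraMap F₀ F) h
    rwa [map_ofNat, map_zero] at this
  have hsk : ∀ x, T.conj x = -x → Algebra.trace F₀ F x = 0 := by
    intro x hx
    have := h1 x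
    rw [hx, map_neg] at this
    have h3 : 2 * Algebra.trace F₀ F x = 0 := by linear_combination -this
    exact (mul_eq_zero.1 h3).resolve_left h2
  obtain ⟨y, hy⟩ := (H0.fix (x + T.conj x)).1 (by rw [map_add, T.conj_invol, add_comm])
  have h4 : Algebra.trace F₀ F (x - T.conj x) = 0 := hsk _ (by
    rw [map_sub, T.conj_invol]; ring)
  have h5 : Algebra.trace F₀ F (x + T.conj x) = 2 * y := by
    rw [← hy, Algebra.trace_algebraMap, H0.deg]; simp
  rw [map_sub] at h4; rw [map_add] at h5
  have h6 : Algebra.trace F₀ F x = y := by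
    apply mul_left_cancel₀ h2; linear_combination h4 + h5
  rw [h6, hy]

/-- the character of `F` -/
def chi (ψ₀ : F₀ → ℂ) (x : F) : ℂ := ψ₀ (Algebra.trace F₀ F x)

lemma chi_add (H0 : Hyp0 T F₀ ψ₀) (x y : F) : chi ψ₀ (x + y) = chi ψ₀ x * chi ψ₀ y := by
  unfold chi; rw [map_add, H0.ψ.1]
lemma chi_p (H : Hyp T) (H0 : Hyp0 T F₀ ψ₀) {x : F} (hx : I T 1 x) : chi ψ₀ x = 1 := by
  unfold chi; apply H0.ψ.2.1
  rw [trace_eq H H0, ← I1]; exact I_add hx (H.I_conj hx)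
lemma chi_nondeg (H : Hyp T) (H0 : Hyp0 T F₀ ψ₀) {x : F}
    (h : ∀ c ∈ T.O, chi ψ₀ (c * x) = 1) : I T 1 x := by
  by_contra hx
  have hx0 : x ≠ 0 := by rintro rfl; exact hx (I_zero _)
  have hi := I_inv (T := T) (j := 0) (x := x) (by simpa using hx)
  obtain ⟨y, hy, hy1⟩ := H0.ψ.2.2
  apply hy1
  have := h (x⁻¹ * (2⁻¹ * algebraMap F₀ F y))
    (T.O.mul_mem (I0.1 (by simpa using hi)) (T.O.mul_mem H.half hy))
  rw [← this]; unfold chi; congr 1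
  apply (algebraMap F₀ F).injective
  have hc : T.conj (algebraMap F₀ F y) = algebraMap F₀ F y := (H0.fix _).2 ⟨y, rfl⟩
  have h2 := H.two_ne
  rw [trace_eq H H0]
  have : x⁻¹ * (2⁻¹ * algebraMap F₀ F y) * x = 2⁻¹ * algebraMap F₀ F y := by field_simp
  rw [this, map_mul, half_conj, hc]; field_simp; ring
end base

end U4P

namespace U4P
open USetting
variable {F : Type u} [Field F] {T : USetting F (Fin 4 → F)}

abbrev cc : Fin 4 → ℤ := ![1, 0, 2, 3]

/-- the standard lattice chain -/
def LL (T : USetting F (Fin 4 → F)) (i : ℤ) : Set (Fin 4 → F) :=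
  {v | ∀ j, I T ((i + cc j) / 4) (v j)}

lemma mem_LL {i : ℤ} {v : Fin 4 → F} : v ∈ LL T i ↔ ∀ j, I T ((i + cc j) / 4) (v j) := Iff.rfl

lemma mem_LL' {i : ℤ} {v : Fin 4 → F} : v ∈ LL T i ↔ I T ((i + 1) / 4) (v 0) ∧
    I T (i / 4) (v 1) ∧ I T ((i + 2) / 4) (v 2) ∧ I T ((i + 3) / 4) (v 3) := by
  rw [mem_LL, Fin.forall_fin_succ, Fin.forall_fin_succ, Fin.forall_fin_succ, Fin.forall_fin_succ]
  simp [cc]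

lemma L_eq {Λ : T.LatSeq} (hΛ : T.IsLam3 Λ) (i : ℤ) : Λ.L i = LL T i := by
  have hz : ∀ (k : ℤ) (v : Fin 4 → F) (S : Set (Fin 4 → F)),
      v ∈ T.ϖ ^ k • S ↔ T.ϖ ^ (-k) • v ∈ S := by
    intro k v S
    rw [Set.mem_smul_set_iff_inv_smul_mem₀ (zpow_ne_zero _ T.ϖ_ne_zero), zpow_neg]
  have hϖ : ∀ (k : ℤ) (x : F), T.ϖ * (T.ϖ ^ (-(k + 1)) * x) = T.ϖ ^ (-k) * x := by
    intro k x
    rw [← mul_assoc]; congr 1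
    rw [← zpow_one_add₀ T.ϖ_ne_zero]; congr 1; ring
  obtain ⟨k, hk⟩ : ∃ k, k = i / 4 := ⟨_, rfl⟩
  have h4 : i = 4 * k ∨ i = 4 * k + 1 ∨ i = 4 * k + 2 ∨ i = 4 * k + 3 := by omega
  obtain ⟨h0, h1, h2, h3⟩ := hΛ.2 k
  ext v
  rw [mem_LL']
  rcases h4 with rfl | rfl | rfl | rfl
  · rw [h0, hz]
    have e1 : (4 * k + 1) / 4 = k := by omega
    have e2 : (4 * k) / 4 = k := by omega
    have e3 : (4 * k + 2) / 4 = k := by omega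
    have e4 : (4 * k + 3) / 4 = k := by omega
    rw [e1, e2, e3, e4]
    simp only [USetting.N0, I, Set.mem_ofPred_eq, Pi.smul_apply, smul_eq_mul, Fin.forall_fin_succ]
    simp
  · rw [h1, hz]
    have e1 : (4 * k + 1 + 1) / 4 = k := by omega
    have e2 : (4 * k + 1) / 4 = k := by omega
    have e3 : (4 * k + 1 + 2) / 4 = k := by omega
    have e4 : (4 * k + 1 + 3) / 4 = k + 1 := by omega
    rw [e1, e2, e3, e4]
    simp only [USetting.N1, Set.mem_ofPred_eq, Pi.smul_apply, smul_eq_mul, Fin.forall_fin_succ,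
      ← I1, I_shift]
    have e5 : I T (k+1) (v 3) → I T k (v 3) := I_mono (by omega)
    have e6 : (1 : ℤ) - -k = k + 1 := by ring
    rw [e6]
    simp only [I] at *
    simp at e5 ⊢
    tauto
  · rw [h2, hz]
    have e1 : (4 * k + 2 + 1) / 4 = k := by omega
    have e2 : (4 * k + 2) / 4 = k := by omega
    have e3 : (4 * k + 2 + 2) / 4 = k + 1 := by omega
    have e4 : (4 * k + 2 + 3) / 4 = k + 1 := by omega
    rw [e1, e2, e3, e4]
    simp only [USetting.N1s, I, Set.mem_ofPred_eq, Pi.smul_apply, smul_eq_mul, hϖ]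
  · rw [h3, hz]
    have e1 : (4 * k + 3 + 1) / 4 = k + 1 := by omega
    have e2 : (4 * k + 3) / 4 = k := by omega
    have e3 : (4 * k + 3 + 2) / 4 = k + 1 := by omega
    have e4 : (4 * k + 3 + 3) / 4 = k + 1 := by omega
    rw [e1, e2, e3, e4]
    simp only [USetting.N0s, I, Set.mem_ofPred_eq, Pi.smul_apply, smul_eq_mul, hϖ]

lemma LL_zero (i : ℤ) : (0 : Fin 4 → F) ∈ LL T i := fun j => I_zero _
lemma LL_add {i : ℤ} {v w : Fin 4 → F} (hv : v ∈ LL T i) (hw : w ∈ LL T i) : v + w ∈ LL T i :=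
  fun j => I_add (hv j) (hw j)
lemma LL_neg {i : ℤ} {v : Fin 4 → F} (hv : v ∈ LL T i) : -v ∈ LL T i :=
  fun j => I_neg (hv j)
lemma LL_sub {i : ℤ} {v w : Fin 4 → F} (hv : v ∈ LL T i) (hw : w ∈ LL T i) : v - w ∈ LL T i :=
  fun j => I_sub (hv j) (hw j)
lemma LL_smul {i k : ℤ} {c : F} (hc : I T k c) {v : Fin 4 → F} (hv : v ∈ LL T i) :
    c • v ∈ LL T (i + 4 * k) := by
  intro j
  have := I_mul hc (hv j)
  have e : (i + 4 * k + cc j) / 4 = k + (i + cc j) / 4 := by omega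
  rw [e]; exact this
lemma LL_smul0 {i : ℤ} {c : F} (hc : c ∈ T.O) {v : Fin 4 → F} (hv : v ∈ LL T i) :
    c • v ∈ LL T i := by
  simpa using LL_smul (I0.2 hc) hv
lemma LL_mono {i k : ℤ} (h : i ≤ k) {v : Fin 4 → F} (hv : v ∈ LL T k) : v ∈ LL T i :=
  fun j => I_mono (by omega) (hv j)

/-- filtration -/
def AA (T : USetting F (Fin 4 → F)) (m : ℤ) : Set (Module.End F (Fin 4 → F)) :=
  {X | ∀ i : ℤ, ∀ v ∈ LL T i, X v ∈ LL T (i + m)}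

lemma aFil_eq {Λ : T.LatSeq} (hΛ : T.IsLam3 Λ) (m : ℤ) : T.aFil Λ m = AA T m := by
  unfold USetting.aFil AA; simp only [L_eq hΛ]

variable {X Y : Module.End F (Fin 4 → F)}
lemma AA_zero (m : ℤ) : (0 : Module.End F (Fin 4 → F)) ∈ AA T m := fun i v _ => LL_zero _
lemma AA_one : (1 : Module.End F (Fin 4 → F)) ∈ AA T 0 := fun i v hv => by simpa using hv
lemma AA_add {m : ℤ} (hX : X ∈ AA T m) (hY : Y ∈ AA T m) : X + Y ∈ AA T m :=
  fun i v hv => LL_add (hX i v hv) (hY i v hv)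
lemma AA_neg {m : ℤ} (hX : X ∈ AA T m) : -X ∈ AA T m := fun i v hv => LL_neg (hX i v hv)
lemma AA_sub {m : ℤ} (hX : X ∈ AA T m) (hY : Y ∈ AA T m) : X - Y ∈ AA T m :=
  fun i v hv => LL_sub (hX i v hv) (hY i v hv)
lemma AA_mul {a b : ℤ} (hX : X ∈ AA T a) (hY : Y ∈ AA T b) : X * Y ∈ AA T (a + b) :=
  fun i v hv => by
    have := hX _ _ (hY i v hv)
    have e : i + b + a = i + (a + b) := by ring
    rw [e] at this; exact this
lemma AA_mono {a b : ℤ} (h : a ≤ b) (hX : X ∈ AA T b) : X ∈ AA T a :=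
  fun i v hv => LL_mono (by omega) (hX i v hv)
lemma AA_smul {m k : ℤ} {c : F} (hc : I T k c) (hX : X ∈ AA T m) : c • X ∈ AA T (m + 4 * k) :=
  fun i v hv => by
    have := LL_smul hc (hX i v hv)
    rw [LinearMap.smul_apply, ← add_assoc]; exact this
lemma AA_smul0 {m : ℤ} {c : F} (hc : c ∈ T.O) (hX : X ∈ AA T m) : c • X ∈ AA T m := by
  simpa using AA_smul (I0.2 hc) hX

/-! hermitian form -/
lemma h_add_right (T : USetting F (Fin 4 → F)) (x y z : Fin 4 → F) :
    T.h x (y + z) = T.h x y + T.h x z := by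
  rw [T.h_conj_symm, T.h_add_left, map_add, ← T.h_conj_symm, ← T.h_conj_symm]
lemma h_smul_right (T : USetting F (Fin 4 → F)) (c : F) (x y : Fin 4 → F) :
    T.h x (c • y) = c * T.h x y := by
  rw [T.h_conj_symm, T.h_smul_left, map_mul, T.conj_invol, ← T.h_conj_symm]
lemma h_neg_right (T : USetting F (Fin 4 → F)) (x y : Fin 4 → F) : T.h x (-y) = - T.h x y := by
  rw [← neg_one_smul F, h_smul_right, neg_one_mul]
lemma h_neg_left (T : USetting F (Fin 4 → F)) (x y : Fin 4 → F) : T.h (-x) y = - T.h x y := by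
  rw [← neg_one_smul F, T.h_smul_left]; simp
lemma h_sub_right (T : USetting F (Fin 4 → F)) (x y z : Fin 4 → F) :
    T.h x (y - z) = T.h x y - T.h x z := by
  rw [sub_eq_add_neg, h_add_right, h_neg_right, sub_eq_add_neg]
lemma h_sub_left (T : USetting F (Fin 4 → F)) (x y z : Fin 4 → F) :
    T.h (x - y) z = T.h x z - T.h y z := by
  rw [sub_eq_add_neg, T.h_add_left, h_neg_left, sub_eq_add_neg]
lemma h_zero_right (T : USetting F (Fin 4 → F)) (x : Fin 4 → F) : T.h x 0 = 0 := by
  have := h_smul_right T 0 x 0; simpa using this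

def hR (T : USetting F (Fin 4 → F)) (x : Fin 4 → F) : (Fin 4 → F) →ₗ[F] F where
  toFun := T.h x
  map_add' := h_add_right T x
  map_smul' := fun c y => h_smul_right T c x y

/-- rank one operator -/
def rk (T : USetting F (Fin 4 → F)) (x y : Fin 4 → F) : Module.End F (Fin 4 → F) :=
  (hR T x).smulRight y
lemma rk_apply (x y z : Fin 4 → F) : rk T x y z = T.h x z • y := rfl
lemma trace_rk (x y : Fin 4 → F) : LinearMap.trace F _ (rk T x y) = T.h x y := by
  unfold rk; rw [LinearMap.trace_smulRight]; rfl
lemma mul_rk (X : Module.End F (Fin 4 → F)) (x y : Fin 4 → F) : X * rk T x y = rk T x (X y) := by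
  refine LinearMap.ext fun z => ?_
  simp [rk_apply]

lemma Hyp.h_mem (H : Hyp T) {a b : ℤ} {x y : Fin 4 → F} (hx : x ∈ LL T a) (hy : y ∈ LL T b) :
    I T ((a + b + 1) / 4) (T.h x y) := by
  rw [H.form]
  rw [mem_LL'] at hx hy
  obtain ⟨x0, x1, x2, x3⟩ := hx
  obtain ⟨y0, y1, y2, y3⟩ := hy
  refine I_add (I_add (I_add ?_ ?_) ?_) ?_
  · exact I_mono (by omega) (I_mul (H.I_conj x0) y3)
  · exact I_mono (by omega) (I_mul I_ϖ (I_mul (H.I_conj x1) y1))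
  · exact I_mono (by omega) (I_mul (H.I_conj x2) y2)
  · exact I_mono (by omega) (I_mul (H.I_conj x3) y0)

lemma Hyp.rk_mem (H : Hyp T) {a b : ℤ} {x y : Fin 4 → F} (hx : x ∈ LL T a) (hy : y ∈ LL T b) :
    rk T x y ∈ AA T (a + b - 2) := by
  intro i v hv
  rw [rk_apply]
  exact LL_mono (by omega) (LL_smul (H.h_mem hx hv) hy)

lemma conj_inj_mem (H : Hyp T) {j : ℤ} {x : F} : I T j (T.conj x) ↔ I T j x :=
  ⟨fun h => by simpa [T.conj_invol] using H.I_conj h, H.I_conj⟩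

lemma single_mem {j : Fin 4} {i : ℤ} {c : F} (h : I T ((i + cc j) / 4) c) :
    Pi.single j c ∈ LL T i := by
  intro k
  by_cases hk : k = j
  · subst hk; simpa using h
  · rw [Pi.single_eq_of_ne hk]; exact I_zero _

lemma Hyp.dual (H : Hyp T) {i : ℤ} {v : Fin 4 → F}
    (h : ∀ w ∈ LL T (-1 - i), I T 0 (T.h v w)) : v ∈ LL T i := by
  rw [mem_LL']
  have key : ∀ (j : Fin 4) (k : ℤ), (-1 - i + cc j) / 4 ≤ k → I T 0 (T.h v (Pi.single j (T.ϖ ^ k))) := by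
    intro j k hk
    exact h _ (single_mem (I_mono hk (I_pow k)))
  have k0 := key 3 (-((i+1)/4)) (by simp [cc]; omega)
  have k1 := key 1 (-((i)/4) - 1) (by simp [cc]; omega)
  have k2 := key 2 (-((i+2)/4)) (by simp [cc]; omega)
  have k3 := key 0 (-((i+3)/4)) (by simp [cc]; omega)
  rw [H.form] at k0 k1 k2 k3
  simp at k0 k1 k2 k3
  rw [← conj_inj_mem H, ← conj_inj_mem H (x := v 1), ← conj_inj_mem H (x := v 2),
    ← conj_inj_mem H (x := v 3)]
  have e : T.ϖ * (T.conj (v 1) * T.ϖ ^ (-(i/4) - 1)) = T.ϖ ^ (-(i/4)) * T.conj (v 1) := by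
    rw [zpow_sub₀ T.ϖ_ne_zero, zpow_one]; have := T.ϖ_ne_zero; field_simp
  rw [e] at k1
  rw [mul_comm, ← zpow_neg, I_shift] at k0 k2 k3
  rw [I_shift] at k1
  simp at k0 k1 k2 k3
  exact ⟨k0, k1, k2, k3⟩

lemma Hyp.σ_mem (H : Hyp T) {m : ℤ} (hX : X ∈ AA T m) : T.σA X ∈ AA T m := by
  intro i v hv
  apply H.dual
  intro w hw
  rw [T.h_conj_symm, ← T.σA_adj] 
  apply H.I_conj
  have := H.h_mem (hX _ _ hw) hv
  exact I_mono (by omega) this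

end U4P

namespace U4P
open USetting
variable {F : Type u} [Field F] {T : USetting F (Fin 4 → F)}

abbrev EE (F : Type u) [Field F] := Module.End F (Fin 4 → F)

lemma exists_dom {ι : Type*} (s : Finset ι) (hs : s.Nonempty) (f : ι → F) :
    ∃ j ∈ s, ∀ k ∈ s, ∃ c ∈ T.O, f k = c * f j := by
  induction hs using Finset.Nonempty.cons_induction with
  | singleton a => exact ⟨a, by simp, fun k hk => ⟨1, T.O.one_mem, by simp at hk; simp [hk]⟩⟩
  | cons a s ha hs ih =>
    obtain ⟨j, hj, h⟩ := ih
    have htot : (∃ c ∈ T.O, f a = c * f j) ∨ (∃ c ∈ T.O, f j = c * f a) := by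
      by_cases h0 : f j = 0
      · right; exact ⟨0, T.O.zero_mem, by simp [h0]⟩
      · exact I_total _ _ h0
    rcases htot with h1 | ⟨c, hc, h1⟩
    · refine ⟨j, by simp [hj], fun k hk => ?_⟩
      rcases Finset.mem_cons.1 hk with rfl | hk
      · exact h1
      · exact h k hk
    · refine ⟨a, by simp, fun k hk => ?_⟩
      rcases Finset.mem_cons.1 hk with rfl | hk
      · exact ⟨1, T.O.one_mem, by simp⟩
      · obtain ⟨d, hd, h2⟩ := h k hk
        exact ⟨d * c, T.O.mul_mem hd hc, by rw [h2, h1, mul_assoc]⟩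

lemma exists_scale (T : USetting F (Fin 4 → F)) {v : Fin 4 → F} (hv : v ≠ 0) :
    ∃ c : F, c ≠ 0 ∧ (∀ j, c * v j ∈ T.O) ∧ ∃ j, c * v j = 1 := by
  obtain ⟨j, -, h⟩ := exists_dom (T := T) Finset.univ Finset.univ_nonempty v
  have hj : v j ≠ 0 := by
    intro h0; apply hv; ext k
    obtain ⟨c, -, hc⟩ := h k (Finset.mem_univ _)
    simp [hc, h0]
  refine ⟨(v j)⁻¹, inv_ne_zero hj, fun k => ?_, j, inv_mul_cancel₀ hj⟩
  obtain ⟨c, hc, hc'⟩ := h k (Finset.mem_univ _)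
  rw [hc', mul_comm c, inv_mul_cancel_left₀ hj]; exact hc

/-! traces -/
/-- dual basis -/
def ed (T : USetting F (Fin 4 → F)) : Fin 4 → (Fin 4 → F) :=
  ![Pi.single 3 1, Pi.single 1 T.ϖ⁻¹, Pi.single 2 1, Pi.single 0 1]
lemma Hyp.h_ed (H : Hyp T) (j : Fin 4) (v : Fin 4 → F) : T.h (ed T j) v = v j := by
  have := T.ϖ_ne_zero
  rw [H.form]
  fin_cases j <;> simp [ed, H.conjϖ]
  field_simp

lemma Hyp.decomp (H : Hyp T) (X : EE F) :
    X = ∑ j, rk T (ed T j) (X (Pi.single j 1)) := by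
  refine LinearMap.ext fun v => ?_
  rw [LinearMap.sum_apply]
  simp only [rk_apply, H.h_ed]
  conv_lhs => rw [show v = ∑ j, v j • (Pi.single j (1:F) : Fin 4 → F) from pi_eq_sum_univ' v]
  rw [map_sum]; simp

lemma Hyp.trace_eq (H : Hyp T) (X : EE F) :
    LinearMap.trace F _ X = ∑ j, (X (Pi.single j 1)) j := by
  conv_lhs => rw [H.decomp X]
  rw [map_sum]; simp only [trace_rk, H.h_ed]

lemma nondeg' {x y : Fin 4 → F} (h : ∀ w, T.h w x = T.h w y) : x = y := by
  rw [← sub_eq_zero]; apply T.h_nondeg; intro w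
  rw [T.h_conj_symm, h_sub_right, h, sub_self, map_zero]

lemma σ_unique {X Y : EE F} (h : ∀ u w, T.h (X u) w = T.h u (Y w)) : T.σA X = Y := by
  refine LinearMap.ext fun w => nondeg' (T := T) fun u => ?_
  rw [← T.σA_adj, h]

lemma σ_smul (c : F) (X : EE F) : T.σA (c • X) = T.conj c • T.σA X := by
  apply σ_unique; intro u w
  simp only [LinearMap.smul_apply]
  rw [T.h_smul_left, h_smul_right, T.σA_adj]
lemma σ_neg (X : EE F) : T.σA (-X) = - T.σA X := by
  rw [← neg_one_smul F, σ_smul, map_neg, map_one]; exact neg_one_smul F (T.σA X)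
lemma σ_sub (X Y : EE F) : T.σA (X - Y) = T.σA X - T.σA Y := by
  rw [sub_eq_add_neg, T.σA_add, σ_neg, sub_eq_add_neg]
lemma σ_rk (x y : Fin 4 → F) : T.σA (rk T x y) = rk T y x := by
  apply σ_unique; intro u w
  rw [rk_apply, rk_apply, T.h_smul_left, h_smul_right, ← T.h_conj_symm, mul_comm]

lemma Hyp.trace_σ (H : Hyp T) (X : EE F) :
    LinearMap.trace F _ (T.σA X) = T.conj (LinearMap.trace F _ X) := by
  have h := H.decomp X
  rw [h, Fin.sum_univ_four, T.σA_add, T.σA_add, T.σA_add]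
  simp only [σ_rk, map_add, trace_rk]
  simp only [← T.h_conj_symm]

lemma Hyp.trace_mem (H : Hyp T) {X : EE F} (hX : X ∈ AA T 1) :
    I T 1 (LinearMap.trace F _ X) := by
  rw [H.trace_eq]
  apply I_sum; intro j _
  have h1 : (Pi.single j 1 : Fin 4 → F) ∈ LL T (3 - cc j) := by
    apply single_mem
    have : (3 - cc j + cc j) / 4 = 0 := by omega
    rw [this]; exact I_one
  have := hX _ _ h1 j
  have e : (3 - cc j + 1 + cc j) / 4 = 1 := by omega
  rwa [e] at this

/-! the group -/
lemma toE_mul (g k : T.GU) : T.toE (g * k) = T.toE g * T.toE k := rfl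
lemma toE_one : T.toE (1 : T.GU) = 1 := rfl
lemma toE_inv (g : T.GU) : T.toE g⁻¹ = T.σA (T.toE g) := by
  have : T.σA (T.toE g) = _ := g.2
  rw [this]; rfl
lemma toE_inv_mul (g : T.GU) : T.toE g⁻¹ * T.toE g = 1 := by
  rw [← toE_mul, inv_mul_cancel, toE_one]
lemma toE_mul_inv (g : T.GU) : T.toE g * T.toE g⁻¹ = 1 := by
  rw [← toE_mul, mul_inv_cancel, toE_one]
lemma toE_inv_apply (g : T.GU) (v : Fin 4 → F) : T.toE g⁻¹ (T.toE g v) = v := by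
  rw [← Module.End.mul_apply, toE_inv_mul]; rfl
lemma toE_apply_inv (g : T.GU) (v : Fin 4 → F) : T.toE g (T.toE g⁻¹ v) = v := by
  rw [← Module.End.mul_apply, toE_mul_inv]; rfl
lemma h_toE (g : T.GU) (v w : Fin 4 → F) : T.h (T.toE g v) (T.toE g w) = T.h v w := by
  rw [T.σA_adj, ← toE_inv, toE_inv_apply]
lemma toE_inj {g k : T.GU} (h : T.toE g = T.toE k) : g = k := Subtype.ext (Units.ext h)
lemma rk_conj (g : T.GU) (x y : Fin 4 → F) :
    T.toE g * rk T x y * T.toE g⁻¹ = rk T (T.toE g x) (T.toE g y) := by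
  refine LinearMap.ext fun z => ?_
  simp only [Module.End.mul_apply, rk_apply, map_smul]
  congr 1
  rw [← h_toE g, toE_apply_inv]

lemma exists_G (A : EE F) (hA : ∀ v w, T.h (A v) (A w) = T.h v w) : ∃ g : T.GU, T.toE g = A := by
  have h1 : T.σA A * A = 1 := by
    refine LinearMap.ext fun w => nondeg' (T := T) fun u => ?_
    rw [Module.End.mul_apply, ← T.σA_adj, hA]; rfl
  have h2 : A * T.σA A = 1 := mul_eq_one_comm.1 h1
  exact ⟨⟨⟨A, T.σA A, h2, h1⟩, rfl⟩, rfl⟩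

/-! Cayley -/
lemma lemA {y : EE F} (hy : y ∈ AA T 1) {v : Fin 4 → F} {i : ℤ}
    (h : v - y v ∈ LL T i) : v ∈ LL T i := by
  by_cases hv : v = 0
  · rw [hv]; exact LL_zero _
  obtain ⟨c, hc0, hc, j0, hj0⟩ := exists_scale T hv
  have hu0 : c • v ∈ LL T 0 := by
    intro j
    have : (0 + cc j) / 4 = 0 := by fin_cases j <;> simp [cc]
    rw [this]; exact I0.2 (hc j)
  have hu4 : c • v ∉ LL T 4 := by
    intro h4
    have := h4 j0
    rw [Pi.smul_apply, smul_eq_mul, hj0] at this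
    have e : (1:ℤ) ≤ (4 + cc j0) / 4 := by fin_cases j0 <;> simp [cc]
    exact not_pF_one (I_mono e this)
  obtain ⟨j, hj1, hj2⟩ : ∃ j, c • v ∈ LL T j ∧ c • v ∉ LL T (j + 1) := by
    by_contra hcon
    push Not at hcon
    exact hu4 (hcon 3 (hcon 2 (hcon 1 (hcon 0 hu0))))
  by_cases hk : I T ((i - j + 3) / 4) c⁻¹
  · have := LL_smul hk hj1
    rw [inv_smul_smul₀ hc0] at this
    exact LL_mono (by omega) this
  · exfalso
    have hc1 : I T (1 - (i - j + 3) / 4) c := by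
      have := I_inv (T := T) (j := (i - j + 3) / 4 - 1) (x := c⁻¹) (by simpa using hk)
      rw [inv_inv] at this
      exact I_mono (by omega) this
    have h1 := LL_mono (i := j + 1) (by omega) (LL_smul hc1 h)
    apply hj2
    have h2 := hy _ _ hj1
    have h3 := LL_add h1 h2
    rw [map_smul, ← smul_add, sub_add_cancel] at h3
    exact h3

structure IsCay (T : USetting F (Fin 4 → F)) (y : EE F) (x : T.GU) (D : EE F) : Prop where
  l : D * (1 - (2⁻¹ : F) • y) = 1
  r : (1 - (2⁻¹ : F) • y) * D = 1
  e : T.toE x - 1 = y * D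

lemma Hyp.D_mem (H : Hyp T) {y D : EE F} (hy : y ∈ AA T 1)
    (r : (1 - (2⁻¹ : F) • y) * D = 1) : D ∈ AA T 0 := by
  intro i v hv
  have h1 : D v - ((2⁻¹ : F) • y) (D v) = v := by
    have := congrArg (fun f : EE F => f v) r
    simpa using this
  rw [add_zero]
  apply lemA (AA_smul0 H.half hy)
  rw [h1]; exact hv

lemma Hyp.cay_exists (H : Hyp T) {y : EE F} (hy : y ∈ AA T 1) (hs : T.σA y = -y) :
    ∃ x D, IsCay T y x D := by
  have hy2 := AA_smul0 H.half hy
  have hinj : Function.Injective (1 - (2⁻¹ : F) • y : EE F) := by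
    rw [injective_iff_map_eq_zero]
    intro v hv
    by_contra hv0
    obtain ⟨c, hc0, hc, j0, hj0⟩ := exists_scale T hv0
    have h4 : c • v ∈ LL T 4 := by
      apply lemA hy2
      have : (c • v) - ((2⁻¹ : F) • y) (c • v) = c • ((1 - (2⁻¹ : F) • y : EE F) v) := by
        rw [LinearMap.sub_apply, smul_sub, map_smul]; rfl
      rw [this, hv, smul_zero]; exact LL_zero _
    have := h4 j0
    rw [Pi.smul_apply, smul_eq_mul, hj0] at this
    have e : (1:ℤ) ≤ (4 + cc j0) / 4 := by fin_cases j0 <;> simp [cc]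
    exact not_pF_one (I_mono e this)
  obtain ⟨D, hD⟩ : ∃ D : EE F, D * (1 - (2⁻¹ : F) • y) = 1 := by
    obtain ⟨D, hD⟩ := LinearMap.exists_leftInverse_of_injective _ (LinearMap.ker_eq_bot.2 hinj)
    exact ⟨D, hD⟩
  have hD' := mul_eq_one_comm.1 hD
  have hDa : ∀ v, D v - (2⁻¹ : F) • y (D v) = v := fun v => by
    have := congrArg (fun f : EE F => f v) hD'
    simpa using this
  have hsk : ∀ u w, T.h (y u) w = - T.h u (y w) := fun u w => by
    rw [T.σA_adj, hs, LinearMap.neg_apply, h_neg_right]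
  obtain ⟨x, hx⟩ := exists_G (T := T) ((1 + (2⁻¹ : F) • y) * D) (by
    intro v w
    conv_rhs => rw [← hDa v, ← hDa w]
    simp only [Module.End.mul_apply, LinearMap.add_apply, Module.End.one_apply,
      LinearMap.smul_apply, T.h_add_left, h_add_right, h_sub_left, h_sub_right, T.h_smul_left,
      h_smul_right, half_conj, hsk, map_add, map_sub, map_smul]
    ring)
  refine ⟨x, D, hD, hD', ?_⟩
  rw [hx]
  nth_rewrite 2 [← hD']
  rw [← sub_mul, add_sub_sub_cancel, ← add_smul]
  have : (2⁻¹ : F) + 2⁻¹ = 1 := by have := H.two_ne; field_simp; norm_num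
  rw [this, one_smul]

lemma IsCay.conj {y D : EE F} {x : T.GU} (h : IsCay T y x D) (g : T.GU) :
    IsCay T (T.toE g⁻¹ * y * T.toE g) (g⁻¹ * x * g) (T.toE g⁻¹ * D * T.toE g) := by
  have h1 := toE_mul_inv g
  have h2 := toE_inv_mul g
  have h3 : (1 : EE F) - (2⁻¹ : F) • (T.toE g⁻¹ * y * T.toE g) =
      T.toE g⁻¹ * (1 - (2⁻¹ : F) • y) * T.toE g := by
    rw [mul_sub, sub_mul, mul_one, h2]; simp
  have key : ∀ A B : EE F, (T.toE g⁻¹ * A * T.toE g) * (T.toE g⁻¹ * B * T.toE g)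
      = T.toE g⁻¹ * (A * B) * T.toE g := by
    intro A B
    calc _ = T.toE g⁻¹ * A * (T.toE g * T.toE g⁻¹) * B * T.toE g := by noncomm_ring
      _ = _ := by rw [h1]; noncomm_ring
  refine ⟨?_, ?_, ?_⟩
  · rw [h3, key, h.l, mul_one, h2]
  · rw [h3, key, h.r, mul_one, h2]
  · rw [key, ← h.e, toE_mul, toE_mul, mul_sub, sub_mul, mul_one, h2]

lemma Hyp.cay_mem (H : Hyp T) {y D : EE F} {x : T.GU} (h : IsCay T y x D) {m : ℤ} (hm : 1 ≤ m)
    (hy : y ∈ AA T m) : T.toE x - 1 ∈ AA T m ∧ T.toE x - 1 - y ∈ AA T (2 * m) := by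
  have hD := H.D_mem (AA_mono hm hy) h.r
  constructor
  · rw [h.e]; simpa using AA_mul hy hD
  · have : T.toE x - 1 - y = y * ((2⁻¹ : F) • y) * D := by
      rw [h.e]
      have h1 : D - 1 = (2⁻¹ : F) • y * D := by
        have := h.r
        rw [sub_mul, one_mul] at this
        rw [← this]; abel
      rw [mul_assoc, ← h1, mul_sub, mul_one]
    rw [this]
    have := AA_mul (AA_mul hy (AA_smul0 H.half hy)) hD
    rw [two_mul]; simpa using this

end U4P

namespace U4P
open USetting
variable {F : Type u} [Field F] {T : USetting F (Fin 4 → F)}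

section addl
variable {F₀ : Type w} [Field F₀] [Algebra F₀ F] {ψ₀ : F₀ → ℂ}

lemma chi_two (H : Hyp T) (H0 : Hyp0 T F₀ ψ₀) (x : F) : chi ψ₀ (x + T.conj x) = chi ψ₀ (2 * x) := by
  unfold chi; congr 1
  apply (algebraMap F₀ F).injective
  rw [trace_eq H H0, trace_eq H H0, map_add, T.conj_invol, map_mul, map_ofNat]; ring

lemma addlem (H : Hyp T) (H0 : Hyp0 T F₀ ψ₀) {δ : EE F} (hδ : T.σA δ = -δ) {z : EE F}
    (h : ∀ c ∈ T.O, chi ψ₀ (LinearMap.trace F _ (δ * (c • z - T.σA (c • z)))) = 1) :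
    I T 1 (LinearMap.trace F _ (δ * z)) := by
  have key : ∀ z : EE F, LinearMap.trace F _ (δ * (z - T.σA z)) =
      LinearMap.trace F _ (δ * z) + T.conj (LinearMap.trace F _ (δ * z)) := by
    intro z
    have h1 : δ * T.σA z = - T.σA (z * δ) := by
      rw [T.σA_mul, hδ]
      refine LinearMap.ext fun v => ?_
      simp
    rw [mul_sub, map_sub, h1, map_neg, H.trace_σ, LinearMap.trace_mul_comm F z δ]; ring
  have h2 : I T 1 (2 * LinearMap.trace F _ (δ * z)) := by
    apply chi_nondeg H H0
    intro c hc
    have := h c hc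
    rw [key, chi_two H H0, mul_smul_comm, map_smul, smul_eq_mul] at this
    rw [← this]; congr 1; ring
  have := I_ofO H.half h2
  rwa [inv_mul_cancel_left₀ H.two_ne] at this

lemma psi_cay (H : Hyp T) (H0 : Hyp0 T F₀ ψ₀) {n m : ℤ} {β y D : EE F} {x : T.GU}
    (hβ : β ∈ AA T (-n)) (hm : 1 ≤ m) (hmn : n + 1 ≤ 2 * m) (hy : y ∈ AA T m)
    (h : IsCay T y x D) : T.psiCh F₀ ψ₀ β x = chi ψ₀ (LinearMap.trace F _ (β * y)) := by
  have h1 := (H.cay_mem h hm hy).2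
  have h2 := AA_mono (a := 1) (by omega) (AA_mul hβ h1)
  have h3 := chi_p H H0 (H.trace_mem h2)
  have h4 : β * (T.toE x - 1) = β * y + β * (T.toE x - 1 - y) := by
    rw [← mul_add]; congr 1; abel
  show chi ψ₀ (LinearMap.trace F _ (β * (T.toE x - 1))) = _
  rw [h4, map_add, chi_add H0, h3, mul_one]
end addl

lemma cc_inj : ∀ k j : Fin 4, k ≠ j → cc k ≠ cc j := by decide
lemma cc_bd : ∀ k, 0 ≤ cc k ∧ cc k ≤ 3 := by decide

lemma graded {i : ℤ} {v w : Fin 4 → F} (hv : v ∈ LL T i) (hv' : v ∉ LL T (i + 1))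
    (hw : w ∈ LL T i) : ∃ c ∈ T.O, w - c • v ∈ LL T (i + 1) := by
  obtain ⟨j, hj⟩ : ∃ j, ¬ I T ((i + 1 + cc j) / 4) (v j) := by
    by_contra hcon; push Not at hcon; exact hv' hcon
  have hdiv : (i + 1 + cc j) / 4 = (i + cc j) / 4 + 1 := by
    by_contra hne
    apply hj
    have : (i + 1 + cc j) / 4 = (i + cc j) / 4 := by omega
    rw [this]; exact hv j
  have hvj : v j ≠ 0 := by intro h; rw [h] at hj; exact hj (I_zero _)
  rw [hdiv] at hj
  have hc := I_mul (hw j) (I_inv hj)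
  rw [add_neg_cancel, I0] at hc
  refine ⟨_, hc, fun k => ?_⟩
  by_cases hk : k = j
  · subst hk
    rw [Pi.sub_apply, Pi.smul_apply, smul_eq_mul, inv_mul_cancel_right₀ hvj, sub_self]
    exact I_zero _
  · have h2 : (i + 1 + cc k) / 4 = (i + cc k) / 4 := by
      have := cc_inj k j hk
      have := cc_bd k
      have := cc_bd j
      omega
    rw [h2]
    exact I_sub (hw k) (I_ofO hc (hv k))

lemma nilp_charpoly {y : EE F} (hy : y ∈ AA T 1) (i : ℕ) (hi : i < 4) :
    (LinearMap.charpoly y).coeff i ∈ T.pF := by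
  have hcol : ∀ m : ℕ, ∀ k, (y ^ m) (Pi.single k 1) ∈ LL T (m : ℤ) := by
    intro m
    induction m with
    | zero =>
      intro k
      have : (((0:ℕ):ℤ) + cc k) / 4 = 0 := by fin_cases k <;> simp [cc]
      simp only [pow_zero, Module.End.one_apply]
      apply single_mem; rw [this]; exact I_one
    | succ m ih =>
      intro k
      rw [pow_succ', Module.End.mul_apply]
      have := hy _ _ (ih k)
      exact_mod_cast this
  have hM : ∀ a b, LinearMap.toMatrix' y a b ∈ T.O := by
    intro a b
    rw [LinearMap.toMatrix'_apply]
    have h1 := hcol 1 b a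
    rw [pow_one] at h1
    refine I0.1 (I_mono ?_ h1)
    fin_cases a <;> simp [cc]
  let M : Matrix (Fin 4) (Fin 4) T.O := fun a b => ⟨LinearMap.toMatrix' y a b, hM a b⟩
  have hMm : M.map T.O.subtype = LinearMap.toMatrix' y := by ext a b; rfl
  have hM4 : ∀ a b, I T 1 (((M ^ 4) a b : T.O) : F) := by
    intro a b
    have e1 : ((M ^ 4) a b : F) = LinearMap.toMatrix' (y ^ 4) a b := by
      have h3 : LinearMap.toMatrix' (y ^ 4) = (LinearMap.toMatrix' y) ^ 4 := by
        have := map_pow (LinearMap.toMatrixAlgEquiv' (R := F) (n := Fin 4)) y 4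
        exact this
      rw [h3, ← hMm]
      have h4 := map_pow (T.O.subtype.mapMatrix (m := Fin 4)) M 4
      simp only [RingHom.mapMatrix_apply] at h4
      rw [← h4]; rfl
    rw [e1, LinearMap.toMatrix'_apply]
    have h1 := hcol 4 b a
    refine I_mono ?_ h1
    fin_cases a <;> simp [cc]
  let J : Ideal T.O := Ideal.span {(⟨T.ϖ, T.ϖ_mem⟩ : T.O)}
  have hJ : ∀ x : T.O, x ∈ J ↔ I T 1 (x : F) := by
    intro x
    rw [I1, Ideal.mem_span_singleton]
    constructor
    · rintro ⟨z, rfl⟩; exact ⟨z, z.2, rfl⟩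
    · rintro ⟨z, hz, h⟩; exact ⟨⟨z, hz⟩, Subtype.ext h⟩
  let q := Ideal.Quotient.mk J
  have hnil : IsNilpotent (M.map q) := by
    refine ⟨4, ?_⟩
    have h4 := map_pow (q.mapMatrix (m := Fin 4)) M 4
    simp only [RingHom.mapMatrix_apply] at h4
    rw [← h4]
    ext a b
    simp only [Matrix.map_apply, Matrix.zero_apply]
    rw [Ideal.Quotient.eq_zero_iff_mem, hJ]; exact hM4 a b
  have h5 := Matrix.isNilpotent_charpoly_sub_pow_of_isNilpotent hnil
  rw [Polynomial.isNilpotent_iff] at h5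
  have h6 := h5 i
  have h7 : (M.map q).charpoly = M.charpoly.map q := Matrix.charpoly_map M q
  rw [h7, Polynomial.coeff_sub, Polynomial.coeff_map, Polynomial.coeff_X_pow] at h6
  rw [if_neg (by simp; omega), sub_zero] at h6
  obtain ⟨m, hm⟩ := h6
  rw [← map_pow, Ideal.Quotient.eq_zero_iff_mem, hJ] at hm
  have h8 : (LinearMap.charpoly y).coeff i = ((M.charpoly.coeff i : T.O) : F) := by
    have : LinearMap.charpoly y = (LinearMap.toMatrix' y).charpoly := by
      rw [← LinearMap.charpoly_toMatrix y (Pi.basisFun F (Fin 4))]; rfl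
    rw [this, ← hMm]
    have h9 : (M.map T.O.subtype).charpoly = M.charpoly.map T.O.subtype := Matrix.charpoly_map M _
    rw [h9, Polynomial.coeff_map]; rfl
  rw [h8, ← I1]
  by_contra hcon
  set c : F := ((M.charpoly.coeff i : T.O) : F)
  have hc0 : c ≠ 0 := by intro h; rw [h] at hcon; exact hcon (I_zero _)
  have hi := I_inv (T := T) (j := 0) (x := c) (by simpa using hcon)
  have hO : c⁻¹ ∈ T.O := I0.1 (by simpa using hi)
  apply not_pF_one (T := T)
  have := I_ofO (T.O.pow_mem hO m) hm
  have h10 : c⁻¹ ^ m * ((M.charpoly.coeff i ^ m : T.O) : F) = 1 := by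
    rw [Subring.coe_pow, ← mul_pow, inv_mul_cancel₀ hc0, one_pow]
  rw [h10] at this
  exact this

lemma lead0 {Λ : T.LatSeq} (hΛ : T.IsLam3 Λ) {n : ℤ} (hn : 0 < n) (hn4 : Int.gcd n 4 = 1)
    {β : EE F} (hβ : β ∈ AA T (-n)) (hf : T.IsFundamental Λ n β) (i : ℤ) :
    ¬ ∀ v ∈ LL T i, β v ∈ LL T (i - n + 1) := by
  intro hi
  apply hf
  have hg : Int.gcd Λ.e n = 1 := by rw [hΛ.1, Int.gcd_comm]; exact hn4
  have hnodd : n % 2 = 1 := by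
    by_contra h
    have h2 : (2:ℤ) ∣ n := by omega
    have := Int.dvd_coe_gcd h2 (show (2:ℤ) ∣ 4 by norm_num)
    rw [hn4] at this; omega
  have hy : T.ybeta Λ n β = T.ϖ ^ n • β ^ 4 := by
    unfold USetting.ybeta
    rw [hg, hΛ.1]
    simp only [Nat.cast_one, Int.ediv_one]
    have : ((4:ℤ).toNat) = 4 := rfl
    rw [this]
    congr 1
    conv_rhs => rw [← Int.toNat_of_nonneg hn.le]
    rw [zpow_natCast]
  have hi2 : ∀ k, (4:ℤ) ∣ (k - i) → ∀ v ∈ LL T k, β v ∈ LL T (k - n + 1) := by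
    rintro k ⟨l, hl⟩ v hv
    have h1 := LL_mono (i := i) (by omega) (LL_smul (I_pow (T := T) (-l)) hv)
    have h2 := LL_smul (I_pow (T := T) l) (hi _ h1)
    rw [map_smul, smul_smul, ← zpow_add₀ T.ϖ_ne_zero, add_neg_cancel, zpow_zero, one_smul] at h2
    exact LL_mono (by omega) h2
  have hy1 : T.ybeta Λ n β ∈ AA T 1 := by
    rw [hy]
    have hb4 : β ^ 4 ∈ AA T (-4 * n + 1) := by
      intro k v hv
      have e : (β ^ 4) v = β (β (β (β v))) := by
        simp only [pow_succ, pow_zero, one_mul, Module.End.mul_apply]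
      rw [e]
      have a1 := hβ _ _ hv
      have hh : (4:ℤ) ∣ k - i ∨ (4:ℤ) ∣ k - n - i ∨ (4:ℤ) ∣ k - 2 * n - i ∨ (4:ℤ) ∣ k - 3 * n - i := by
        have hm : n % 4 = 1 ∨ n % 4 = 3 := by omega
        have hm2 : (k - i) % 4 = 0 ∨ (k - i) % 4 = 1 ∨ (k - i) % 4 = 2 ∨ (k - i) % 4 = 3 := by omega
        rcases hm with hm | hm <;> rcases hm2 with h | h | h | h
        · left; omega
        · right; left; omega
        · right; right; left; omega
        · right; right; right; omega
        · left; omega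
        · right; right; right; omega
        · right; right; left; omega
        · right; left; omega
      rcases hh with h | h | h | h
      · exact LL_mono (by omega) (hβ _ _ (hβ _ _ (hβ _ _ (hi2 _ h _ hv))))
      · exact LL_mono (by omega) (hβ _ _ (hβ _ _ (hi2 _ h _ (LL_mono (by omega) a1))))
      · exact LL_mono (by omega) (hβ _ _ (hi2 _ h _ (LL_mono (by omega) (hβ _ _ a1))))
      · exact LL_mono (by omega) (hi2 _ h _ (LL_mono (by omega) (hβ _ _ (hβ _ _ a1))))
    exact AA_mono (by omega) (AA_smul (I_pow n) hb4)
  intro j hj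
  rw [Module.finrank_fin_fun] at hj
  exact nilp_charpoly hy1 j hj

lemma lead {Λ : T.LatSeq} (hΛ : T.IsLam3 Λ) {n : ℤ} (hn : 0 < n) (hn4 : Int.gcd n 4 = 1)
    {β b : EE F} (hβ : β ∈ AA T (-n)) (hf : T.IsFundamental Λ n β) (hb : b ∈ AA T (1 - n))
    {i : ℤ} {v : Fin 4 → F} (hv : v ∈ LL T i) (hv' : v ∉ LL T (i + 1)) :
    (β + b) v ∉ LL T (i - n + 1) := by
  intro h
  apply lead0 hΛ hn hn4 hβ hf i
  intro w hw
  obtain ⟨c, hc, hcw⟩ := graded hv hv' hw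
  have h1 : β v ∈ LL T (i - n + 1) := by
    have h2 := LL_sub h (LL_mono (i := i - n + 1) (by omega) (hb _ _ hv))
    simpa using h2
  have h3 := LL_add (LL_smul0 hc h1) (LL_mono (i := i - n + 1) (by omega) (hβ _ _ hcw))
  rw [← map_smul, ← map_add] at h3
  simpa using h3

end U4P

namespace U4P
open USetting
variable {F : Type u} [Field F] {T : USetting F (Fin 4 → F)}

lemma ϖinv_not : (T.ϖ⁻¹ : F) ∉ T.O := fun h => T.ϖ_not_unit _ h (mul_inv_cancel₀ T.ϖ_ne_zero)

lemma dualfg {V : Type*} [AddCommGroup V] [Module F V] (s : Finset V) (δ : V)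
    (h : ∀ φ : V →ₗ[F] F, (∀ v ∈ s, φ v ∈ T.O) → φ δ ∈ T.O) :
    δ ∈ Submodule.span T.O (s : Set V) := by
  induction hk : s.card using Nat.strong_induction_on generalizing s with
  | _ k ih =>
  by_cases hli : LinearIndependent F (fun a : s => (a : V))
  · have hsp : δ ∈ Submodule.span F (s : Set V) := by
      by_contra hcon
      obtain ⟨f, hf, hf2⟩ := Submodule.exists_le_ker_of_notMem hcon
      have h1 := h ((T.ϖ⁻¹ * (f δ)⁻¹) • f) (by
        intro v hv
        have : f v = 0 := hf2 (Submodule.subset_span hv)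
        rw [LinearMap.smul_apply, this, smul_zero]; exact T.O.zero_mem)
      rw [LinearMap.smul_apply, smul_eq_mul, mul_assoc, inv_mul_cancel₀ hf, mul_one] at h1
      exact ϖinv_not h1
    have hli' : LinearIndepOn F id (s : Set V) := hli
    let B := Module.Basis.extend hli'
    obtain ⟨f, -, hf⟩ := Submodule.mem_span_finset.1 hsp
    rw [← hf]
    refine Submodule.sum_mem _ fun a ha => ?_
    have hae : a ∈ hli'.extend (Set.subset_univ _) := hli'.subset_extend _ ha
    have hB : ∀ b (hb : b ∈ s), B.coord ⟨a, hae⟩ b = if b = a then 1 else 0 := by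
      intro b hb
      have hbe : b ∈ hli'.extend (Set.subset_univ _) := hli'.subset_extend _ hb
      have : b = B ⟨b, hbe⟩ := by simp [B]
      conv_lhs => rw [this]
      rw [Module.Basis.coord_apply, Module.Basis.repr_self, Finsupp.single_apply]
      simp
    have h2 := h (B.coord ⟨a, hae⟩) (by
      intro v hv; rw [hB v hv]; split_ifs
      · exact T.O.one_mem
      · exact T.O.zero_mem)
    have h3 : B.coord ⟨a, hae⟩ δ = f a := by
      rw [← hf, map_sum, Finset.sum_eq_single a]
      · rw [map_smul, hB a ha]; simp
      · intro b hb hba; rw [map_smul, hB b hb]; simp [hba]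
      · intro h; exact absurd ha h
    rw [h3] at h2
    exact Submodule.smul_mem _ (⟨f a, h2⟩ : T.O) (Submodule.subset_span ha)
  · rw [Fintype.not_linearIndependent_iff] at hli
    obtain ⟨g, hg, i, hi⟩ := hli
    obtain ⟨j, -, hj⟩ := exists_dom (T := T) Finset.univ ⟨i, Finset.mem_univ _⟩ g
    have hj0 : g j ≠ 0 := by
      intro h0; obtain ⟨c, -, hc⟩ := hj i (Finset.mem_univ _); rw [h0, mul_zero] at hc; exact hi hc
    choose c hc hcg using fun k => hj k (Finset.mem_univ k)
    have hsum : (j : V) = - ∑ k ∈ Finset.univ.erase j, c k • (k : V) := by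
      have h1 : ∑ k, c k • (k : V) = 0 := by
        have : g j • ∑ k, c k • (k : V) = 0 := by
          rw [Finset.smul_sum, ← hg]
          refine Finset.sum_congr rfl fun k _ => ?_
          rw [smul_smul, hcg k, mul_comm]
        exact (smul_eq_zero.1 this).resolve_left hj0
      have hcj : c j = 1 := by
        have := hcg j
        exact (mul_right_cancel₀ hj0 (by rw [one_mul]; exact this)).symm
      rw [← Finset.add_sum_erase _ _ (Finset.mem_univ j), hcj, one_smul] at h1
      exact eq_neg_of_add_eq_zero_left h1
    have := ih _ (by rw [← hk]; exact Finset.card_erase_lt_of_mem j.2) (s.erase j) (by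
      intro φ hφ
      refine h φ fun v hv => ?_
      by_cases hvj : v = j
      · rw [hvj, hsum, map_neg, map_sum]
        refine T.O.neg_mem (T.O.sum_mem fun k hk => ?_)
        rw [map_smul]
        refine T.O.mul_mem (hc k) (hφ _ ?_)
        rw [Finset.mem_erase]
        refine ⟨fun h => ?_, k.2⟩
        exact (Finset.mem_erase.1 hk).1 (Subtype.ext h)
      · exact hφ _ (Finset.mem_erase.2 ⟨hvj, hv⟩)) rfl
    exact Submodule.span_mono (by simp) this

/-- elementary matrices -/
def Eu (F : Type u) [Field F] (a b : Fin 4) : EE F :=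
  (LinearMap.proj b : (Fin 4 → F) →ₗ[F] F).smulRight (Pi.single a 1)

lemma Eu_apply (a b : Fin 4) (v : Fin 4 → F) : Eu F a b v = v b • Pi.single a 1 := rfl

lemma trace_Eu (H : Hyp T) (z : EE F) (a b : Fin 4) :
    LinearMap.trace F _ (z * Eu F a b) = z (Pi.single a 1) b := by
  rw [H.trace_eq]
  rw [Finset.sum_eq_single b]
  · simp [Eu_apply]
  · intro j _ hj; simp [Eu_apply, hj.symm]
  · simp

lemma decompE (X : EE F) : X = ∑ a, ∑ b, (X (Pi.single b 1) a) • Eu F a b := by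
  refine LinearMap.ext fun v => ?_
  ext k
  conv_lhs => rw [show v = ∑ j, v j • (Pi.single j (1:F) : Fin 4 → F) from pi_eq_sum_univ' v]
  simp [LinearMap.sum_apply, Eu_apply, Finset.sum_apply, Pi.single_apply, mul_comm]

lemma mem_AA_iff {m : ℤ} {X : EE F} :
    X ∈ AA T m ↔ ∀ a b, I T ((m + 3 - cc b + cc a) / 4) (X (Pi.single b 1) a) := by
  constructor
  · intro h a b
    have h1 : (Pi.single b (1:F) : Fin 4 → F) ∈ LL T (3 - cc b) :=
      single_mem (by rw [show (3 - cc b + cc b) / 4 = 0 by omega]; exact I_one)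
    have h2 := h _ _ h1 a
    rwa [show (3 - cc b + m + cc a) = m + 3 - cc b + cc a by ring] at h2
  · intro h i v hv a
    have : X v a = ∑ b, v b * X (Pi.single b 1) a := by
      conv_lhs => rw [show v = ∑ j, v j • (Pi.single j (1:F) : Fin 4 → F) from pi_eq_sum_univ' v]
      simp [Finset.sum_apply]
    rw [this]
    refine I_sum _ _ _ fun b _ => I_mono ?_ (I_mul (hv b) (h a b))
    omega

lemma functional (H : Hyp T) (φ : EE F →ₗ[F] F) : ∃ z : EE F, ∀ X,
    φ X = LinearMap.trace F _ (z * X) := by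
  refine ⟨∑ a, ∑ b, φ (Eu F a b) • Eu F b a, fun X => ?_⟩
  have h1 : ∀ a b, LinearMap.trace F _ ((∑ a, ∑ b, φ (Eu F a b) • Eu F b a) * Eu F a b) = φ (Eu F a b) := by
    intro a b
    rw [trace_Eu H]
    rw [LinearMap.sum_apply, Finset.sum_apply, Finset.sum_eq_single a]
    · simp [LinearMap.sum_apply, Eu_apply, Finset.sum_apply, Pi.single_apply]
    · intro c _ hc
      simp [LinearMap.sum_apply, Eu_apply, Finset.sum_apply, Pi.single_apply, hc]
    · simp
  rw [decompE X]
  simp only [map_sum, map_smul, Finset.mul_sum, mul_smul_comm, h1]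

lemma trace_conj' (g : T.GU) (z X : EE F) :
    LinearMap.trace F _ (z * (T.toE g * X * T.toE g⁻¹)) =
    LinearMap.trace F _ (T.toE g⁻¹ * z * T.toE g * X) := by
  rw [← mul_assoc, LinearMap.trace_mul_comm]; simp only [mul_assoc]

lemma duality (H : Hyp T) (g : T.GU) (r : ℤ) (δ : EE F)
    (h : ∀ z ∈ AA T (r + 1), T.toE g⁻¹ * z * T.toE g ∈ AA T (r + 1) →
      I T 1 (LinearMap.trace F _ (δ * z))) :
    ∃ a ∈ AA T (-r), ∃ b ∈ AA T (-r), δ = a + T.toE g * b * T.toE g⁻¹ := by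
  let k : Fin 4 → Fin 4 → ℤ := fun a b => (-r + 3 - cc b + cc a) / 4
  let e : Fin 4 × Fin 4 → EE F := fun p => T.ϖ ^ (k p.1 p.2) • Eu F p.1 p.2
  have he : ∀ p, e p ∈ AA T (-r) := by
    intro p
    rw [mem_AA_iff]
    intro a b
    by_cases hp : a = p.1 ∧ b = p.2
    · obtain ⟨rfl, rfl⟩ := hp
      simp only [e, LinearMap.smul_apply, Eu_apply]
      simpa using I_pow _
    · have : e p (Pi.single b 1) a = 0 := by
        simp only [e, LinearMap.smul_apply, Eu_apply, Pi.smul_apply, Pi.single_apply, smul_eq_mul]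
        rw [not_and_or] at hp
        rcases hp with hp | hp
        · simp [hp]
        · simp [Ne.symm hp]
      rw [this]; exact I_zero _
  have hdual : ∀ z : EE F, (∀ p, LinearMap.trace F _ (z * e p) ∈ T.O) → T.ϖ • z ∈ AA T (r + 1) := by
    intro z hz
    rw [mem_AA_iff]
    intro a b
    have h1 := hz (b, a)
    simp only [e, mul_smul_comm, map_smul, trace_Eu H, smul_eq_mul] at h1
    rw [← I0, I_shift] at h1
    have h2 := I_mul (I_ϖ (T := T)) h1
    refine I_mono ?_ h2
    simp only [k]; omega
  let s1 : Finset (EE F) := Finset.univ.image e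
  let s2 : Finset (EE F) := Finset.univ.image fun p => T.toE g * e p * T.toE g⁻¹
  have := dualfg (T := T) (s1 ∪ s2) δ (by
    intro φ hφ
    obtain ⟨z, hz⟩ := functional H φ
    have a1 : T.ϖ • z ∈ AA T (r + 1) := hdual z fun p => by
      rw [← hz]; exact hφ _ (by simp [s1])
    have a2 : T.ϖ • (T.toE g⁻¹ * z * T.toE g) ∈ AA T (r + 1) := hdual _ fun p => by
      rw [← trace_conj', ← hz]; exact hφ _ (Finset.mem_union_right _ (by simp [s2]))
    have a3 := h _ a1 (by
      rw [mul_smul_comm, smul_mul_assoc]; exact a2)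
    rw [mul_smul_comm, map_smul, smul_eq_mul, LinearMap.trace_mul_comm, ← hz] at a3
    have a4 : I T 1 (T.ϖ ^ (1:ℤ) * φ δ) := by rw [zpow_one]; exact a3
    rw [I_shift] at a4
    exact I0.1 a4)
  rw [Finset.coe_union, Submodule.span_union, Submodule.mem_sup] at this
  obtain ⟨y, hy, z, hz, rfl⟩ := this
  have cl : ∀ y ∈ Submodule.span T.O (s1 : Set (EE F)), y ∈ AA T (-r) := by
    intro y hy
    induction hy using Submodule.span_induction with
    | mem x hx =>
      simp only [s1, Finset.coe_image, Finset.coe_univ, Set.image_univ, Set.mem_range] at hx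
      obtain ⟨p, rfl⟩ := hx; exact he p
    | zero => exact AA_zero _
    | add x y _ _ hx hy => exact AA_add hx hy
    | smul c x _ hx => exact AA_smul0 c.2 hx
  have cl2 : ∀ y ∈ Submodule.span T.O (s2 : Set (EE F)),
      ∃ b ∈ AA T (-r), y = T.toE g * b * T.toE g⁻¹ := by
    intro y hy
    induction hy using Submodule.span_induction with
    | mem x hx =>
      simp only [s2, Finset.coe_image, Finset.coe_univ, Set.image_univ, Set.mem_range] at hx
      obtain ⟨p, rfl⟩ := hx; exact ⟨_, he p, rfl⟩
    | zero => exact ⟨0, AA_zero _, by simp⟩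
    | add x y _ _ hx hy =>
      obtain ⟨b, hb, rfl⟩ := hx
      obtain ⟨c, hc, rfl⟩ := hy
      exact ⟨_, AA_add hb hc, by rw [mul_add, add_mul]⟩
    | smul c x _ hx =>
      obtain ⟨b, hb, rfl⟩ := hx
      refine ⟨(c:F) • b, AA_smul0 c.2 hb, ?_⟩
      rw [mul_smul_comm, smul_mul_assoc]; rfl
  obtain ⟨b, hb, rfl⟩ := cl2 z hz
  exact ⟨y, cl y hy, b, hb, rfl⟩

section
variable {F₀ : Type w} [Field F₀] [Algebra F₀ F] {ψ₀ : F₀ → ℂ}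

/-- from intertwining to `γ + a = g (β + b) g⁻¹` -/
lemma intertw (H : Hyp T) (H0 : Hyp0 T F₀ ψ₀) {n r : ℤ} (hr : 0 ≤ r) (hnr : n + 1 ≤ 2 * (r + 1))
    {β γ : EE F} (hβ : β ∈ AA T (-n)) (hγ : γ ∈ AA T (-n)) (hβs : T.σA β = -β) (hγs : T.σA γ = -γ)
    (g : T.GU)
    (h : ∀ x, T.toE x - 1 ∈ AA T (r + 1) → T.toE (g⁻¹ * x * g) - 1 ∈ AA T (r + 1) →
      T.psiCh F₀ ψ₀ γ x = T.psiCh F₀ ψ₀ β (g⁻¹ * x * g)) :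
    ∃ a ∈ AA T (-r), ∃ b ∈ AA T (-r),
      γ - T.toE g * β * T.toE g⁻¹ = a + T.toE g * b * T.toE g⁻¹ := by
  apply duality H
  intro z hz hz'
  apply addlem H H0
  · rw [σ_sub, T.σA_mul, T.σA_mul, hγs, hβs, ← toE_inv, ← toE_inv, inv_inv]
    refine LinearMap.ext fun v => ?_
    simp; abel
  · intro c hc
    set y := c • z - T.σA (c • z)
    have hcz := AA_smul0 hc hz
    have hy : y ∈ AA T (r + 1) := AA_sub hcz (H.σ_mem hcz)
    have hys : T.σA y = -y := by
      simp only [y]; rw [σ_sub, T.σA_invol, neg_sub]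
    have hcz' := AA_smul0 hc hz'
    have hy' : T.toE g⁻¹ * y * T.toE g ∈ AA T (r + 1) := by
      have e : T.toE g⁻¹ * y * T.toE g = c • (T.toE g⁻¹ * z * T.toE g) -
          T.σA (c • (T.toE g⁻¹ * z * T.toE g)) := by
        have e2 : T.σA (c • (T.toE g⁻¹ * z * T.toE g)) = T.toE g⁻¹ * T.σA (c • z) * T.toE g := by
          rw [σ_smul, σ_smul, T.σA_mul, T.σA_mul, ← toE_inv, ← toE_inv, inv_inv]
          simp [mul_assoc]
        rw [e2]; simp only [y]
        rw [mul_sub, sub_mul]; simp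
      rw [e]; exact AA_sub hcz' (H.σ_mem hcz')
    obtain ⟨x, D, hx⟩ := H.cay_exists (AA_mono (by omega) hy) hys
    have hx' := hx.conj g
    have h1 := h x (H.cay_mem hx (by omega) hy).1 (H.cay_mem hx' (by omega) hy').1
    rw [psi_cay H H0 hγ (by omega) hnr hy hx, psi_cay H H0 hβ (by omega) hnr hy' hx'] at h1
    have h2 : LinearMap.trace F _ (β * (T.toE g⁻¹ * y * T.toE g)) =
        LinearMap.trace F _ (T.toE g * β * T.toE g⁻¹ * y) := by
      rw [← mul_assoc, LinearMap.trace_mul_comm]; simp only [mul_assoc]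
    rw [h2] at h1
    have h3 : chi ψ₀ (LinearMap.trace F _ (T.toE g * β * T.toE g⁻¹ * y)) ≠ 0 := by
      intro h0
      have := chi_add H0 (LinearMap.trace F _ (T.toE g * β * T.toE g⁻¹ * y))
        (-(LinearMap.trace F _ (T.toE g * β * T.toE g⁻¹ * y)))
      rw [h0, zero_mul, add_neg_cancel, chi_p H H0 (I_zero _)] at this
      exact one_ne_zero this
    have h4 := chi_add H0 (LinearMap.trace F _ ((γ - T.toE g * β * T.toE g⁻¹) * y))
      (LinearMap.trace F _ (T.toE g * β * T.toE g⁻¹ * y))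
    rw [← map_add, ← add_mul, sub_add_cancel, h1] at h4
    exact (mul_right_cancel₀ h3 (by rw [one_mul]; exact h4)).symm
end

end U4P

namespace U4P
open USetting
variable {F : Type u} [Field F] {T : USetting F (Fin 4 → F)}

def Arch (T : USetting F (Fin 4 → F)) : Prop := ∀ x : F, x ≠ 0 → ∃ j, ¬ I T j x

lemma Arch.bd (hA : Arch T) (x : F) : ∃ j : ℕ, I T (-(j:ℤ)) x := by
  by_cases hx : x = 0
  · exact ⟨0, by rw [hx]; exact I_zero _⟩
  obtain ⟨j, hj⟩ := hA x⁻¹ (inv_ne_zero hx)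
  have h1 := I_inv (T := T) (j := j - 1) (x := x⁻¹) (by simpa using hj)
  rw [inv_inv] at h1
  exact ⟨(j - 1).toNat, I_mono (by omega) h1⟩

lemma bd_fin {ι : Type*} [Fintype ι] (hA : Arch T) (f : ι → F) : ∃ j : ℕ, ∀ i, I T (-(j:ℤ)) (f i) := by
  choose j hj using fun i => hA.bd (f i)
  refine ⟨Finset.univ.sup j, fun i => I_mono ?_ (hj i)⟩
  have : j i ≤ Finset.univ.sup j := Finset.le_sup (Finset.mem_univ i)
  omega

lemma Arch.AA (hA : Arch T) (X : EE F) : ∃ m : ℕ, X ∈ AA T (-(m:ℤ)) := by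
  obtain ⟨j, hj⟩ := bd_fin hA fun p : Fin 4 × Fin 4 => X (Pi.single p.2 1) p.1
  refine ⟨4 * j + 6, ?_⟩
  rw [mem_AA_iff]
  intro a b
  refine I_mono ?_ (hj (a, b))
  have := cc_bd a; have := cc_bd b
  push_cast; omega

lemma Arch.ord (hA : Arch T) {v : Fin 4 → F} (hv : v ≠ 0) : ∃ i, v ∈ LL T i ∧ v ∉ LL T (i + 1) := by
  obtain ⟨c, hc0, hc, j, hj⟩ := exists_scale T hv
  obtain ⟨J, hJ⟩ := hA.bd c⁻¹
  obtain ⟨K, hK⟩ := hA c⁻¹ (inv_ne_zero hc0)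
  have h1 : v ∈ LL T (-3 - 4 * J) := by
    intro k
    have := I_ofO (hc k) hJ
    rw [mul_comm, inv_mul_cancel_left₀ hc0] at this
    have := cc_bd k
    refine I_mono (by omega) ‹I T (-(J:ℤ)) (v k)›
  have h2 : v ∉ LL T (4 * K) := by
    intro h
    apply hK
    have h3 := h j
    have : v j = c⁻¹ := by rw [eq_inv_of_mul_eq_one_right hj]
    rw [this] at h3
    have := cc_bd j
    exact I_mono (by omega) h3
  obtain ⟨i, hi, hi2⟩ := Int.exists_greatest_of_bdd (P := fun i => v ∈ LL T i)
    ⟨4 * K, fun z hz => by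
      by_contra hcon; exact h2 (LL_mono (by omega) hz)⟩ ⟨_, h1⟩
  exact ⟨i, hi, fun h => by have := hi2 _ h; omega⟩

lemma mod4 {n : ℤ} (hn4 : Int.gcd n 4 = 1) : n % 4 = 1 ∨ n % 4 = 3 := by
  have : n % 2 = 1 := by
    by_contra h
    have h2 : (2:ℤ) ∣ n := by omega
    have := Int.dvd_coe_gcd h2 (show (2:ℤ) ∣ 4 by norm_num)
    rw [hn4] at this; omega
  omega

lemma uniq (hA : Arch T) {n : ℤ} (hn4 : Int.gcd n 4 = 1) {B C g : EE F} (hBm : B ∈ AA T (-n))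
    (hCm : C ∈ AA T (-n))
    (hB : ∀ i v, v ∈ LL T i → v ∉ LL T (i + 1) → B v ∉ LL T (i - n + 1))
    (hg : ∀ v, g (B v) = C (g v))
    {u0 : Fin 4 → F} {i f : ℤ} (hu : u0 ∈ LL T i) (hu' : u0 ∉ LL T (i + 1)) (hgu : g u0 ∈ LL T (i + f)) :
    g ∈ AA T f := by
  have step : ∀ k : ℕ, ∃ u, u ∈ LL T (i - k * n) ∧ u ∉ LL T (i - k * n + 1) ∧ g u ∈ LL T (i - k * n + f) := by
    intro k
    induction k with
    | zero => exact ⟨u0, by simpa using hu, by simpa using hu', by simpa using hgu⟩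
    | succ k ih =>
      obtain ⟨u, h1, h2, h3⟩ := ih
      refine ⟨B u, ?_, ?_, ?_⟩
      · have := hBm _ _ h1
        refine LL_mono (le_of_eq ?_) this; push_cast; ring
      · have := hB _ _ h1 h2
        intro h; apply this
        refine LL_mono (le_of_eq ?_) h; push_cast; ring
      · rw [hg]
        have := hCm _ _ h3
        refine LL_mono (le_of_eq ?_) this; push_cast; ring
  have any : ∀ l, ∃ u, u ∈ LL T l ∧ u ∉ LL T (l + 1) ∧ g u ∈ LL T (l + f) := by
    intro l
    obtain ⟨k, m, hk⟩ : ∃ k : ℕ, ∃ m : ℤ, l = i - k * n + 4 * m := by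
      have hm := mod4 hn4
      have hm2 : (l - i) % 4 = 0 ∨ (l - i) % 4 = 1 ∨ (l - i) % 4 = 2 ∨ (l - i) % 4 = 3 := by omega
      rcases hm with hm | hm <;> rcases hm2 with h | h | h | h
      · exact ⟨0, (l - i) / 4, by push_cast; omega⟩
      · exact ⟨3, (l - i + 3 * n) / 4, by push_cast; omega⟩
      · exact ⟨2, (l - i + 2 * n) / 4, by push_cast; omega⟩
      · exact ⟨1, (l - i + n) / 4, by push_cast; omega⟩
      · exact ⟨0, (l - i) / 4, by push_cast; omega⟩
      · exact ⟨1, (l - i + n) / 4, by push_cast; omega⟩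
      · exact ⟨2, (l - i + 2 * n) / 4, by push_cast; omega⟩
      · exact ⟨3, (l - i + 3 * n) / 4, by push_cast; omega⟩
    obtain ⟨u, h1, h2, h3⟩ := step k
    refine ⟨T.ϖ ^ m • u, ?_, ?_, ?_⟩
    · rw [hk]; exact LL_smul (I_pow m) h1
    · intro h; apply h2
      have := LL_smul (I_pow (T := T) (-m)) h
      rw [smul_smul, ← zpow_add₀ T.ϖ_ne_zero, neg_add_cancel, zpow_zero, one_smul] at this
      exact LL_mono (by omega) this
    · rw [map_smul]
      exact LL_mono (by omega) (LL_smul (I_pow m) h3)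
  obtain ⟨M, hM⟩ := hA.AA g
  intro l v hv
  have appr : ∀ N : ℕ, ∃ w, w ∈ LL T (l + N) ∧ g (v - w) ∈ LL T (l + f) := by
    intro N
    induction N with
    | zero => exact ⟨v, by simpa using hv, by simp [LL_zero]⟩
    | succ N ih =>
      obtain ⟨w, h1, h2⟩ := ih
      obtain ⟨u, h3, h4, h5⟩ := any (l + N)
      obtain ⟨c, hc, hc'⟩ := graded h3 h4 h1
      refine ⟨w - c • u, by push_cast; rw [← add_assoc]; exact hc', ?_⟩
      have : v - (w - c • u) = (v - w) + c • u := by abel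
      rw [this, map_add, map_smul]
      exact LL_add h2 (LL_smul0 hc (LL_mono (by omega) h5))
  obtain ⟨w, h1, h2⟩ := appr (M + f).toNat
  have h3 := hM _ _ h1
  have h4 := LL_add h2 (LL_mono (i := l + f) (by omega) h3)
  rw [← map_add, sub_add_cancel] at h4
  exact h4

section
variable {F₀ : Type w} [Field F₀] [Algebra F₀ F] {ψ₀ : F₀ → ℂ}

lemma caseA1 (H : Hyp T) (H0 : Hyp0 T F₀ ψ₀) (hA : Arch T) {n : ℤ} (hn : 0 < n)
    (hn4 : Int.gcd n 4 = 1) {Λ : T.LatSeq} (hΛ : T.IsLam3 Λ)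
    {β γ : EE F} (hβ : β ∈ AA T (-n)) (hγ : γ ∈ AA T (-n)) (hβs : T.σA β = -β) (hγs : T.σA γ = -γ)
    (hβf : T.IsFundamental Λ n β) (hγf : T.IsFundamental Λ n γ) (g : T.GU)
    (h : ∀ x, T.toE x - 1 ∈ AA T (n / 2 + 1) → T.toE (g⁻¹ * x * g) - 1 ∈ AA T (n / 2 + 1) →
      T.psiCh F₀ ψ₀ γ x = T.psiCh F₀ ψ₀ β (g⁻¹ * x * g)) :
    T.toE g ∈ AA T 0 ∧ ∀ x, T.toE x - 1 ∈ AA T (n / 2 + 1) →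
      T.toE (g⁻¹ * x * g) - 1 ∈ AA T (n / 2 + 1) ∧
      T.psiCh F₀ ψ₀ γ x = T.psiCh F₀ ψ₀ β (g⁻¹ * x * g) := by
  have hm := mod4 hn4
  obtain ⟨a, ha, b, hb, hab⟩ := intertw H H0 (r := n / 2) (by omega) (by omega) hβ hγ hβs hγs g h
  have hg1 : ∀ v, T.toE g ((β + b) v) = (γ + -a) (T.toE g v) := by
    intro v
    have := congrArg (fun X : EE F => X (T.toE g v)) hab
    simp only [LinearMap.sub_apply, LinearMap.add_apply, Module.End.mul_apply, toE_inv_apply] at this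
    simp only [LinearMap.add_apply, map_add, LinearMap.neg_apply]
    rw [sub_eq_iff_eq_add] at this
    rw [this]; abel
  have hg2 : ∀ v, T.toE g⁻¹ ((γ + -a) v) = (β + b) (T.toE g⁻¹ v) := by
    intro v
    conv_lhs => rw [← toE_apply_inv g v]
    rw [← hg1, toE_inv_apply]
  have hb1 := AA_mono (a := 1 - n) (by omega) hb
  have ha1 := AA_mono (a := 1 - n) (by omega) (AA_neg ha)
  have hB := AA_add hβ (AA_mono (a := -n) (by omega) hb1)
  have hC := AA_add hγ (AA_mono (a := -n) (by omega) ha1)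
  have hu0 : (Pi.single 0 1 : Fin 4 → F) ≠ 0 := by
    intro h; simpa using congrFun h 0
  have hgu0 : T.toE g (Pi.single 0 1 : Fin 4 → F) ≠ 0 := by
    intro h; apply hu0; rw [← toE_inv_apply g (Pi.single 0 1), h, map_zero]
  obtain ⟨i, hi, hi'⟩ := hA.ord hu0
  obtain ⟨k, hk, hk'⟩ := hA.ord hgu0
  have G1 := uniq hA hn4 hB hC (fun _ _ => lead hΛ hn hn4 hβ hβf hb1) hg1 hi hi' (f := k - i)
    (by simpa using hk)
  have G2 := uniq hA hn4 hC hB (fun _ _ => lead hΛ hn hn4 hγ hγf ha1) hg2 hk hk' (f := i - k)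
    (by rw [toE_inv_apply]; simpa using hi)
  have hg0 : T.toE g ∈ AA T 0 := by
    by_cases hf : 0 ≤ k - i
    · exact AA_mono hf G1
    · have := H.σ_mem G2
      rw [toE_inv, T.σA_invol] at this
      exact AA_mono (by omega) this
  have hg0' : T.toE g⁻¹ ∈ AA T 0 := by rw [toE_inv]; exact H.σ_mem hg0
  refine ⟨hg0, fun x hx => ?_⟩
  have hx' : T.toE (g⁻¹ * x * g) - 1 ∈ AA T (n / 2 + 1) := by
    have e : T.toE (g⁻¹ * x * g) - 1 = T.toE g⁻¹ * (T.toE x - 1) * T.toE g := by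
      rw [toE_mul, toE_mul, mul_sub, sub_mul, mul_one, toE_inv_mul]
    rw [e]; simpa using AA_mul (AA_mul hg0' hx) hg0
  exact ⟨hx', h x hx hx'⟩
end

/-- congruence subgroup -/
def PG (H : Hyp T) (k : ℕ) : Subgroup T.GU where
  carrier := {g | T.toE g - 1 ∈ AA T (k : ℤ) ∧ T.toE g ∈ AA T 0}
  one_mem' := by
    refine ⟨?_, AA_one⟩
    rw [toE_one, sub_self]; exact AA_zero _
  mul_mem' := by
    rintro a b ⟨ha, ha'⟩ ⟨hb, hb'⟩
    constructor
    · have : T.toE (a * b) - 1 = T.toE a * (T.toE b - 1) + (T.toE a - 1) := by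
        rw [toE_mul, mul_sub]; simp
      rw [this]
      exact AA_add (by simpa using AA_mul ha' hb) ha
    · rw [toE_mul]; simpa using AA_mul ha' hb'
  inv_mem' := by
    rintro a ⟨ha, ha'⟩
    have h0 : T.toE a⁻¹ ∈ AA T 0 := by rw [toE_inv]; exact H.σ_mem ha'
    refine ⟨?_, h0⟩
    have : T.toE a⁻¹ - 1 = T.σA (T.toE a - 1) := by
      rw [σ_sub, T.σA_one, toE_inv]
    rw [this]; exact H.σ_mem ha

lemma mem_PG (H : Hyp T) {k : ℕ} {g : T.GU} (h : T.toE g - 1 ∈ AA T (k:ℤ)) : g ∈ PG H k := by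
  refine ⟨h, ?_⟩
  have := AA_add (AA_mono (a := 0) (by omega) h) AA_one
  rwa [sub_add_cancel] at this

lemma PG_normal (H : Hyp T) (k m : ℕ) : ((PG H m).subgroupOf (PG H k)).Normal := by
  constructor
  rintro ⟨a, ha⟩ h ⟨g, hg⟩
  rw [Subgroup.mem_subgroupOf] at h ⊢
  apply mem_PG
  have e : T.toE (g * a * g⁻¹) - 1 = T.toE g * (T.toE a - 1) * T.toE g⁻¹ := by
    rw [toE_mul, toE_mul, mul_sub, sub_mul, mul_one, toE_mul_inv]
  show T.toE (g * a * g⁻¹) - 1 ∈ _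
  rw [e]
  simpa using AA_mul (AA_mul hg.2 h.1) ((PG H k).inv_mem hg).2

lemma fin_quot (T : USetting F (Fin 4 → F)) (M : ℕ) :
    Finite (T.O ⧸ ((Ideal.span {(⟨T.ϖ, T.ϖ_mem⟩ : T.O)} : Ideal T.O) ^ M)) := by
  have := T.res_fin
  exact Ideal.finite_quotient_pow ⟨{_}, by simp; rfl⟩ M

lemma PG_fin (H : Hyp T) (k m : ℕ) : Finite (PG H k ⧸ (PG H m).subgroupOf (PG H k)) := by
  have hent : ∀ g : PG H k, ∀ a b, T.ϖ * T.toE g (Pi.single b 1) a ∈ T.O := by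
    intro g a b
    have h1 := mem_AA_iff.1 g.2.2 a b
    have h2 := I_mul (I_ϖ (T := T)) h1
    have := cc_bd a; have := cc_bd b
    exact I0.1 (I_mono (by omega) h2)
  let M : ℕ := m + 4
  have := fin_quot T M
  let f : PG H k → Fin 4 → Fin 4 → (T.O ⧸ ((Ideal.span {(⟨T.ϖ, T.ϖ_mem⟩ : T.O)} : Ideal T.O) ^ M)) :=
    fun g a b => Ideal.Quotient.mk _ ⟨_, hent g a b⟩
  have hf : ∀ g g', f g = f g' → g⁻¹ * g' ∈ (PG H m).subgroupOf (PG H k) := by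
    intro g g' hgg
    have h1 : T.toE g' - T.toE g ∈ AA T (m:ℤ) := by
      rw [mem_AA_iff]
      intro a b
      have h2 := congrFun (congrFun hgg a) b
      simp only [f] at h2
      rw [Ideal.Quotient.eq, Ideal.span_singleton_pow, Ideal.mem_span_singleton] at h2
      obtain ⟨z, hz⟩ := h2
      have hz' : T.ϖ * T.toE g (Pi.single b 1) a - T.ϖ * T.toE g' (Pi.single b 1) a =
        T.ϖ ^ (m + 3 + 1) * (z : F) := congrArg (Subtype.val) hz
      rw [← mul_sub, pow_succ', mul_assoc] at hz'
      have hz2 := mul_left_cancel₀ T.ϖ_ne_zero hz'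
      have h3 : (T.toE g' - T.toE g) (Pi.single b 1) a = -(T.ϖ ^ ((m + 3 : ℕ) : ℤ) * (z:F)) := by
        rw [zpow_natCast, ← hz2]; simp
      rw [h3]
      apply I_neg
      rw [I_shift]
      have := cc_bd a; have := cc_bd b
      refine I_mono ?_ (I0.2 z.2)
      push_cast; omega
    rw [Subgroup.mem_subgroupOf]
    apply mem_PG
    have e : T.toE (((g⁻¹ * g' : PG H k)) : T.GU) - 1 = T.toE (g:T.GU)⁻¹ * (T.toE g' - T.toE g) := by
      rw [mul_sub, toE_inv_mul]; rfl
    rw [e]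
    simpa using AA_mul ((PG H k).inv_mem g.2).2 h1
  refine Finite.of_injective (fun q : PG H k ⧸ (PG H m).subgroupOf (PG H k) => f q.out) ?_
  intro q q' h
  have := hf _ _ h
  rw [← QuotientGroup.eq] at this
  simpa using this

section rep
variable {W : Type v} [AddCommGroup W] [Module ℂ W]

lemma mackey (G : Type u) [Group G] (π : G →* Module.End ℂ W) (P : Subgroup G) (χ : P →* ℂ)
    (wγ wβ : W) (hγ : ∀ x : P, π x wγ = χ x • wγ) (hw0 : wγ ≠ 0)
    (s : Finset G) (c : G → ℂ) (hs : wγ = ∑ g ∈ s, c g • π g wβ)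
    (Q : Subgroup P) (hQ : Q.Normal) (hfin : Finite (P ⧸ Q))
    (hQs : ∀ q ∈ Q, ∀ g ∈ s, π ((q : P) : G) (π g wβ) = π g wβ)
    (hQχ : ∀ q ∈ Q, χ q = 1) :
    ∃ g ∈ s, ∀ x : P, ∀ μ : ℂ, π x (π g wβ) = μ • π g wβ → χ x = μ := by
  by_contra hcon
  push Not at hcon
  have := Fintype.ofFinite (P ⧸ Q)
  let e : Module.End ℂ W := ∑ q : P ⧸ Q, (χ q.out)⁻¹ • π (q.out : P)
  have hχ0 : ∀ x, χ x ≠ 0 := fun x h => by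
    have : χ (x * x⁻¹) = 1 := by rw [mul_inv_cancel, map_one]
    rw [map_mul, h, zero_mul] at this; exact zero_ne_one this
  have key : ∀ v, (∀ q ∈ Q, π ((q : P) : G) v = v) → ∀ x : P, e (π x v) = χ x • e v := by
    intro v hv x
    simp only [e, LinearMap.sum_apply, LinearMap.smul_apply, Finset.smul_sum]
    refine Fintype.sum_equiv (Equiv.mulRight (x : P ⧸ Q)) _ _ fun q => ?_
    simp only [Equiv.coe_mulRight]
    set p := q.out
    set p' := (q * (x : P ⧸ Q)).out
    have h1 : p'⁻¹ * (p * x) ∈ Q := by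
      rw [← QuotientGroup.eq]; simp [p, p']
    have h2 : p * x = p' * (p'⁻¹ * (p * x)) := by group
    have h3 : χ p * χ x = χ p' := by
      rw [← map_mul, h2, map_mul, hQχ _ h1, mul_one]
    have h4 : π p (π x v) = π p' v := by
      have : π ((p * x : P) : G) v = π (p' : G) v := by
        rw [h2, Subgroup.coe_mul, map_mul, Module.End.mul_apply, hv _ h1]
      rw [← this, Subgroup.coe_mul, map_mul, Module.End.mul_apply]
    rw [h4, ← h3, smul_smul]
    congr 1
    have := hχ0 p; have := hχ0 x
    field_simp
  have h0 : ∀ g ∈ s, e (π g wβ) = 0 := by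
    intro g hg
    obtain ⟨x, μ, h1, h2⟩ := hcon g hg
    have h3 := key _ (fun q hq => hQs q hq g hg) x
    rw [h1, map_smul] at h3
    have h4 : (χ x - μ) • e (π g wβ) = 0 := by rw [sub_smul, h3, sub_self]
    exact (smul_eq_zero.1 h4).resolve_left (sub_ne_zero.2 h2)
  have h1 : e wγ = 0 := by
    rw [hs, map_sum]
    refine Finset.sum_eq_zero fun g hg => ?_
    rw [map_smul, h0 g hg, smul_zero]
  have h2 : e wγ = (Fintype.card (P ⧸ Q) : ℂ) • wγ := by
    simp only [e, LinearMap.sum_apply, LinearMap.smul_apply, hγ, smul_smul]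
    simp [hχ0]
    rw [Nat.cast_smul_eq_nsmul]
  rw [h1] at h2
  have := (smul_eq_zero.1 h2.symm).resolve_right hw0
  rw [Nat.cast_eq_zero] at this
  exact Fintype.card_ne_zero this

variable {F₀ : Type w} [Field F₀] [Algebra F₀ F] {ψ₀ : F₀ → ℂ}

lemma psi_triv (H : Hyp T) (H0 : Hyp0 T F₀ ψ₀) {n : ℤ} {β : EE F} (hβ : β ∈ AA T (-n)) {x : T.GU}
    (hx : T.toE x - 1 ∈ AA T (n + 1)) : T.psiCh F₀ ψ₀ β x = 1 := by
  show chi ψ₀ (LinearMap.trace F _ (β * (T.toE x - 1))) = _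
  exact chi_p H H0 (H.trace_mem (AA_mono (by omega) (AA_mul hβ hx)))

lemma irr_span {π : T.GU →* Module.End ℂ W} (hirr : T.Irred π) {u : W} (hu : u ≠ 0) (v : W) :
    v ∈ Submodule.span ℂ (Set.range fun g => π g u) := by
  rcases hirr.2 (Submodule.span ℂ (Set.range fun g => π g u)) (by
    intro g w hw
    induction hw using Submodule.span_induction with
    | mem x hx =>
      obtain ⟨k, rfl⟩ := hx
      exact Submodule.subset_span ⟨g * k, by simp [map_mul]⟩
    | zero => simp
    | add x y _ _ hx hy => rw [map_add]; exact Submodule.add_mem _ hx hy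
    | smul c x _ hx => rw [map_smul]; exact Submodule.smul_mem _ _ hx) with h | h
  · exfalso; apply hu
    have : u ∈ Submodule.span ℂ (Set.range fun g => π g u) := Submodule.subset_span ⟨1, by simp⟩
    rw [h] at this; simpa using this
  · rw [h]; trivial

lemma caseA (H : Hyp T) (H0 : Hyp0 T F₀ ψ₀) (hA : Arch T) {n : ℤ} (hn : 0 < n)
    (hn4 : Int.gcd n 4 = 1) {Λ : T.LatSeq} (hΛ : T.IsLam3 Λ)
    {β γ : EE F} (hβ : β ∈ AA T (-n)) (hγ : γ ∈ AA T (-n)) (hβs : T.σA β = -β) (hγs : T.σA γ = -γ)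
    (hβf : T.IsFundamental Λ n β) (hγf : T.IsFundamental Λ n γ)
    (π : T.GU →* Module.End ℂ W) (hirr : T.Irred π)
    {wβ wγ : W} (hwβ : wβ ≠ 0) (hwγ : wγ ≠ 0)
    (hπβ : ∀ x, T.toE x - 1 ∈ AA T (n / 2 + 1) → π x wβ = T.psiCh F₀ ψ₀ β x • wβ)
    (hπγ : ∀ x, T.toE x - 1 ∈ AA T (n / 2 + 1) → π x wγ = T.psiCh F₀ ψ₀ γ x • wγ) :
    ∃ g, T.toE g ∈ AA T 0 ∧ ∀ x, T.toE x - 1 ∈ AA T (n / 2 + 1) →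
      T.toE (g⁻¹ * x * g) - 1 ∈ AA T (n / 2 + 1) ∧
      T.psiCh F₀ ψ₀ γ x = T.psiCh F₀ ψ₀ β (g⁻¹ * x * g) := by
  obtain ⟨c, hc⟩ := Finsupp.mem_span_range_iff_exists_finsupp.1 (irr_span hirr hwβ wγ)
  have hm := mod4 hn4
  let r : ℕ := (n / 2 + 1).toNat
  have hr : (r : ℤ) = n / 2 + 1 := by simp only [r]; omega
  have hπγ' : ∀ x : PG H r, π x wγ = T.psiCh F₀ ψ₀ γ x • wγ := fun x => hπγ x (hr ▸ x.2.1)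
  have inj : ∀ a b : ℂ, a • wγ = b • wγ → a = b := fun a b h => smul_left_injective ℂ hwγ h
  let χ : PG H r →* ℂ :=
    { toFun := fun x => T.psiCh F₀ ψ₀ γ x
      map_one' := by
        apply inj; rw [← hπγ']; simp
      map_mul' := by
        intro x y
        apply inj
        rw [← hπγ', mul_smul, Subgroup.coe_mul, map_mul, Module.End.mul_apply, hπγ' y, map_smul,
          hπγ' x, smul_comm] }
  choose M hM using fun g : T.GU => hA.AA (T.toE g)
  let N : ℕ := (n + 1).toNat + c.support.sup fun g => M g + M g⁻¹
  have hN : ∀ q, q ∈ PG H N → ∀ g ∈ c.support, T.toE (g⁻¹ * q * g) - 1 ∈ AA T (n + 1) := by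
    intro q hq g hg
    have e : T.toE (g⁻¹ * q * g) - 1 = T.toE g⁻¹ * (T.toE q - 1) * T.toE g := by
      rw [toE_mul, toE_mul, mul_sub, sub_mul, mul_one, toE_inv_mul]
    rw [e]
    have h1 : M g + M g⁻¹ ≤ c.support.sup fun g => M g + M g⁻¹ :=
      Finset.le_sup (f := fun g => M g + M g⁻¹) hg
    refine AA_mono ?_ (AA_mul (AA_mul (hM g⁻¹) hq.1) (hM g))
    simp only [N]; push_cast; omega
  have key : ∀ g x, T.toE (g⁻¹ * x * g) - 1 ∈ AA T (n / 2 + 1) →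
      π x (π g wβ) = T.psiCh F₀ ψ₀ β (g⁻¹ * x * g) • π g wβ := by
    intro g x hx
    have := hπβ _ hx
    rw [← map_smul, ← this, ← Module.End.mul_apply, ← Module.End.mul_apply, ← map_mul, ← map_mul]
    congr 2; group
  obtain ⟨g, hg, h⟩ := mackey T.GU π (PG H r) χ wγ wβ hπγ' hwγ c.support c
    (by rw [← hc]; rfl) ((PG H N).subgroupOf (PG H r)) (PG_normal H _ _) (PG_fin H _ _)
    (by
      intro q hq g hg
      have h1 := hN q (Subgroup.mem_subgroupOf.1 hq) g hg
      rw [key _ _ (AA_mono (by omega) h1), psi_triv H H0 hβ h1, one_smul])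
    (by
      intro q hq
      have h1 := (Subgroup.mem_subgroupOf.1 hq).1
      apply psi_triv H H0 hγ
      refine AA_mono ?_ h1
      simp only [N]; push_cast; omega)
  refine ⟨g, caseA1 H H0 hA hn hn4 hΛ hβ hγ hβs hγs hβf hγf g fun x hx hx' => ?_⟩
  exact h ⟨x, mem_PG H (by rw [hr]; exact hx)⟩ _ (key g x hx')
end rep
end U4P

namespace U4P
open USetting
variable {F : Type u} [Field F] {T : USetting F (Fin 4 → F)}

def Mp (T : USetting F (Fin 4 → F)) (x : F) : Prop := ∀ j, I T j x
def Op (T : USetting F (Fin 4 → F)) (x : F) : Prop := ∃ j, I T j x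

lemma Mp_zero : Mp T 0 := fun j => I_zero j
lemma Mp_add {x y : F} (hx : Mp T x) (hy : Mp T y) : Mp T (x + y) := fun j => I_add (hx j) (hy j)
lemma Mp_neg {x : F} (hx : Mp T x) : Mp T (-x) := fun j => I_neg (hx j)
lemma Mp_sub {x y : F} (hx : Mp T x) (hy : Mp T y) : Mp T (x - y) := fun j => I_sub (hx j) (hy j)
lemma Mp.op {x : F} (hx : Mp T x) : Op T x := ⟨0, hx 0⟩
lemma Op_add {x y : F} (hx : Op T x) (hy : Op T y) : Op T (x + y) := by
  obtain ⟨i, hi⟩ := hx; obtain ⟨j, hj⟩ := hy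
  exact ⟨min i j, I_add (I_mono (min_le_left _ _) hi) (I_mono (min_le_right _ _) hj)⟩
lemma Op_neg {x : F} (hx : Op T x) : Op T (-x) := by
  obtain ⟨i, hi⟩ := hx; exact ⟨i, I_neg hi⟩
lemma Op_sub {x y : F} (hx : Op T x) (hy : Op T y) : Op T (x - y) := by
  rw [sub_eq_add_neg]; exact Op_add hx (Op_neg hy)
lemma Op_mul {x y : F} (hx : Op T x) (hy : Op T y) : Op T (x * y) := by
  obtain ⟨i, hi⟩ := hx; obtain ⟨j, hj⟩ := hy; exact ⟨_, I_mul hi hj⟩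
lemma Mp_mul {x y : F} (hx : Op T x) (hy : Mp T y) : Mp T (x * y) := by
  obtain ⟨i, hi⟩ := hx
  intro j
  have := I_mul hi (hy (j - i))
  rwa [add_sub_cancel] at this
lemma Mp_mul' {x y : F} (hx : Mp T x) (hy : Op T y) : Mp T (x * y) := by
  rw [mul_comm]; exact Mp_mul hy hx
lemma Op_O {x : F} (hx : x ∈ T.O) : Op T x := ⟨0, I0.2 hx⟩
lemma Op_one : Op T (1 : F) := Op_O T.O.one_mem
lemma Op_zero : Op T (0 : F) := Mp_zero.op
lemma Op_ϖ : Op T T.ϖ := Op_O T.ϖ_mem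
lemma Op_ϖinv : Op T (T.ϖ⁻¹) := ⟨-1, by simpa using I_pow (T := T) (-1)⟩
lemma not_Mp_one : ¬ Mp T (1 : F) := fun h => not_pF_one (h 1)
lemma Op_inv {x : F} (h : ¬ Mp T x) : Op T x⁻¹ := by
  unfold Mp at h; push Not at h
  obtain ⟨j, hj⟩ := h
  exact ⟨_, I_inv (T := T) (j := j - 1) (by simpa using hj)⟩
lemma Mp_inv {x : F} (h : ¬ Op T x) : Mp T x⁻¹ := by
  intro j
  have := I_inv (T := T) (j := -j) (x := x) (fun h' => h ⟨_, h'⟩)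
  simpa using this
lemma Mp_conj (H : Hyp T) {x : F} (h : Mp T x) : Mp T (T.conj x) := fun j => H.I_conj (h j)
lemma Op_conj (H : Hyp T) {x : F} (h : Op T x) : Op T (T.conj x) := by
  obtain ⟨j, hj⟩ := h; exact ⟨j, H.I_conj hj⟩
lemma Op_pow {x : F} (h : Op T x) (k : ℕ) : Op T (x ^ k) := by
  induction k with
  | zero => simpa using Op_one
  | succ k ih => rw [pow_succ]; exact Op_mul ih h
lemma Mp_pow {x : F} (h : Mp T x) (k : ℕ) (hk : k ≠ 0) : Mp T (x ^ k) := by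
  obtain ⟨k, rfl⟩ := Nat.exists_eq_succ_of_ne_zero hk
  rw [pow_succ]; exact Mp_mul (Op_pow h.op k) h

lemma norm_Mp (H : Hyp T) {x : F} (h : Mp T (x * T.conj x)) : Mp T x := by
  by_contra hc
  have hx : x ≠ 0 := by rintro rfl; exact hc Mp_zero
  have h1 := Op_inv hc
  have h2 := Mp_mul (Op_mul h1 (Op_conj H h1)) h
  apply not_Mp_one (T := T)
  convert h2 using 1
  have : T.conj x ≠ 0 := by simpa using hx
  rw [map_inv₀]; field_simp
lemma norm_Op (H : Hyp T) {x : F} (h : Op T (x * T.conj x)) : Op T x := by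
  by_contra hc
  have hx : x ≠ 0 := by rintro rfl; exact hc Op_zero
  have h1 := Mp_inv hc
  have h2 := Mp_mul' (Mp_mul h1.op (Mp_conj H h1)) h
  apply not_Mp_one (T := T)
  convert h2 using 1
  have : T.conj x ≠ 0 := by simpa using hx
  rw [map_inv₀]; field_simp

lemma conj_div (x : F) : ∃ c ∈ T.O, T.conj x = c * x := by
  by_cases hx : x = 0
  · exact ⟨0, T.O.zero_mem, by simp [hx]⟩
  rcases I_total (T := T) (T.conj x) x hx with h | ⟨c, hc, h⟩
  · exact h
  · exact ⟨T.conj c, T.conj_O _ hc, by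
      conv_lhs => rw [h]
      rw [map_mul, T.conj_invol]⟩

lemma one_add_Mp {x : F} (h : Mp T x) : 1 + x ≠ 0 ∧ Op T (1 + x)⁻¹ :=
  ⟨(unit_one_add (h 1)).1, Op_O (unit_one_add (h 1)).2⟩

abbrev E1 (F : Type u) [Field F] (j : Fin 4) : Fin 4 → F := Pi.single j 1

def LP (T : USetting F (Fin 4 → F)) (v : Fin 4 → F) : Prop := ∀ j, Op T (v j)
def MP (T : USetting F (Fin 4 → F)) (v : Fin 4 → F) : Prop := ∀ j, Mp T (v j)

lemma MP.lp {v : Fin 4 → F} (h : MP T v) : LP T v := fun j => (h j).op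
lemma LP_add {v w : Fin 4 → F} (hv : LP T v) (hw : LP T w) : LP T (v + w) := fun j => Op_add (hv j) (hw j)
lemma LP_sub {v w : Fin 4 → F} (hv : LP T v) (hw : LP T w) : LP T (v - w) := fun j => Op_sub (hv j) (hw j)
lemma MP_add {v w : Fin 4 → F} (hv : MP T v) (hw : MP T w) : MP T (v + w) := fun j => Mp_add (hv j) (hw j)
lemma MP_sub {v w : Fin 4 → F} (hv : MP T v) (hw : MP T w) : MP T (v - w) := fun j => Mp_sub (hv j) (hw j)
lemma MP_neg {v : Fin 4 → F} (hv : MP T v) : MP T (-v) := fun j => Mp_neg (hv j)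
lemma LP_smul {c : F} {v : Fin 4 → F} (hc : Op T c) (hv : LP T v) : LP T (c • v) := fun j => Op_mul hc (hv j)
lemma MP_smul {c : F} {v : Fin 4 → F} (hc : Op T c) (hv : MP T v) : MP T (c • v) := fun j => Mp_mul hc (hv j)
lemma MP_smul' {c : F} {v : Fin 4 → F} (hc : Mp T c) (hv : LP T v) : MP T (c • v) := fun j => Mp_mul' hc (hv j)
lemma LP_E (j : Fin 4) : LP T (E1 F j) := by
  intro k
  show Op T ((Pi.single j (1:F) : Fin 4 → F) k)
  rw [Pi.single_apply]; split_ifs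
  · exact Op_one
  · exact Op_zero
lemma LP_near {v w : Fin 4 → F} (h : MP T (v - w)) (hw : LP T w) : LP T v := by
  have := LP_add h.lp hw; rwa [sub_add_cancel] at this

lemma h_LP (H : Hyp T) {v w : Fin 4 → F} (hv : LP T v) (hw : LP T w) : Op T (T.h v w) := by
  rw [H.form]
  have a := fun j => Op_conj H (hv j)
  exact Op_add (Op_add (Op_add (Op_mul (a 0) (hw 3)) (Op_mul Op_ϖ (Op_mul (a 1) (hw 1))))
    (Op_mul (a 2) (hw 2))) (Op_mul (a 3) (hw 0))
lemma h_MP_r (H : Hyp T) {v w : Fin 4 → F} (hv : LP T v) (hw : MP T w) : Mp T (T.h v w) := by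
  rw [H.form]
  have a := fun j => Op_conj H (hv j)
  exact Mp_add (Mp_add (Mp_add (Mp_mul (a 0) (hw 3)) (Mp_mul Op_ϖ (Mp_mul (a 1) (hw 1))))
    (Mp_mul (a 2) (hw 2))) (Mp_mul (a 3) (hw 0))
lemma h_MP_l (H : Hyp T) {v w : Fin 4 → F} (hv : MP T v) (hw : LP T w) : Mp T (T.h v w) := by
  rw [T.h_conj_symm]; exact Mp_conj H (h_MP_r H hw hv)

lemma AA_LP {m : ℤ} {X : EE F} (hX : X ∈ AA T m) {v : Fin 4 → F} (hv : LP T v) : LP T (X v) := by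
  intro a
  have : X v a = ∑ b, v b * X (Pi.single b 1) a := by
    conv_lhs => rw [show v = ∑ j, v j • (Pi.single j (1:F) : Fin 4 → F) from pi_eq_sum_univ' v]
    simp [Finset.sum_apply]
  rw [this, Fin.sum_univ_four]
  have h := fun b => Op_mul (hv b) ⟨_, mem_AA_iff.1 hX a b⟩
  exact Op_add (Op_add (Op_add (h 0) (h 1)) (h 2)) (h 3)
lemma AA_MP {m : ℤ} {X : EE F} (hX : X ∈ AA T m) {v : Fin 4 → F} (hv : MP T v) : MP T (X v) := by
  intro a
  have : X v a = ∑ b, v b * X (Pi.single b 1) a := by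
    conv_lhs => rw [show v = ∑ j, v j • (Pi.single j (1:F) : Fin 4 → F) from pi_eq_sum_univ' v]
    simp [Finset.sum_apply]
  rw [this, Fin.sum_univ_four]
  have h := fun b => Mp_mul' (hv b) (⟨_, mem_AA_iff.1 hX a b⟩ : Op T _)
  exact Mp_add (Mp_add (Mp_add (h 0) (h 1)) (h 2)) (h 3)

lemma AA_all {X : EE F} (h : ∀ b, MP T (X (E1 F b))) (m : ℤ) : X ∈ AA T m :=
  mem_AA_iff.2 fun a b => h b a _

/-- index duality -/
def Opp (T : USetting F (Fin 4 → F)) (p p' : Fin 4) : Prop :=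
  (p = 0 ∧ p' = 3) ∨ (p = 3 ∧ p' = 0)
lemma Opp.h (H : Hyp T) {p p' : Fin 4} (hp : Opp T p p') (v : Fin 4 → F) : T.h (E1 F p') v = v p := by
  rcases hp with ⟨rfl, rfl⟩ | ⟨rfl, rfl⟩ <;> rw [H.form] <;> simp [E1]
lemma opp03 : Opp T 0 3 := Or.inl ⟨rfl, rfl⟩
lemma opp30 : Opp T 3 0 := Or.inr ⟨rfl, rfl⟩

lemma leadB {Λ : T.LatSeq} (hΛ : T.IsLam3 Λ) {n : ℤ} (hn : 0 < n) (hn4 : Int.gcd n 4 = 1)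
    {β : EE F} (hβ : β ∈ AA T (-n)) (hf : T.IsFundamental Λ n β) {p p' : Fin 4} (hp : Opp T p p') :
    ∃ j : Fin 4, (j = 1 ∨ j = 2) ∧ ∃ c : F, c * β (E1 F j) p = 1 ∧
      I T ((n / 2 + 1 + 3 - cc p + cc j) / 4) c := by
  have hm := mod4 hn4
  obtain ⟨j, hj, hcc⟩ : ∃ j : Fin 4, (j = 1 ∨ j = 2) ∧ (cc p - n - cc j) % 4 = 0 := by
    have c0 : cc 0 = 1 := rfl
    have c1 : cc 1 = 0 := rfl
    have c2 : cc 2 = 2 := rfl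
    have c3 : cc 3 = 3 := rfl
    rcases hp with ⟨rfl, rfl⟩ | ⟨rfl, rfl⟩ <;> rcases hm with hm | hm
    · exact ⟨1, Or.inl rfl, by omega⟩
    · exact ⟨2, Or.inr rfl, by omega⟩
    · exact ⟨2, Or.inr rfl, by omega⟩
    · exact ⟨1, Or.inl rfl, by omega⟩
  have h1 : E1 F j ∈ LL T (3 - cc j) :=
    single_mem (by rw [show (3 - cc j + cc j) / 4 = 0 by omega]; exact I_one)
  have h2 : E1 F j ∉ LL T (3 - cc j + 1) := by
    intro h
    have := h j
    rw [show (3 - cc j + 1 + cc j) / 4 = 1 by omega] at this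
    simp [E1] at this
    exact not_pF_one this
  have h3 := lead hΛ hn hn4 hβ hf (AA_zero _) h1 h2
  rw [add_zero] at h3
  have h4 := hβ _ _ h1
  have h5 : ¬ I T ((3 - cc j - n + 1 + cc p) / 4) (β (E1 F j) p) := by
    intro h
    apply h3
    intro a
    by_cases ha : a = p
    · rw [ha]; exact h
    · refine I_mono ?_ (h4 a)
      have := cc_inj a p ha
      have := cc_bd a; have := cc_bd p
      omega
  refine ⟨j, hj, (β (E1 F j) p)⁻¹, inv_mul_cancel₀ ?_, ?_⟩
  · intro h0; rw [h0] at h5; exact h5 (I_zero _)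
  · have := I_inv (T := T) (j := (3 - cc j - n + 1 + cc p) / 4 - 1) (by rw [sub_add_cancel]; exact h5)
    refine I_mono ?_ this
    omega
end U4P

namespace U4P
open USetting
variable {F : Type u} [Field F] {T : USetting F (Fin 4 → F)}

structure Good (T : USetting F (Fin 4 → F)) (K : Subgroup T.GU) : Prop where
  fix0 : ∀ g, (∀ b, MP T ((T.toE g - 1) (E1 F b))) → g ∈ K
  Y : ∀ p p', Opp T p p' → ∃ j : Fin 4, (j = 1 ∨ j = 2) ∧ ∀ g ∈ K, ∀ v q, MP T (v - E1 F j) →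
    MP T (q - E1 F p') → LP T (T.toE g v) → MP T (T.toE g q) → False

section
variable {F₀ : Type w} [Field F₀] [Algebra F₀ F] {ψ₀ : F₀ → ℂ}
variable {W : Type v} [AddCommGroup W] [Module ℂ W]

def stab (π : T.GU →* Module.End ℂ W) (u : W) : Subgroup T.GU where
  carrier := {g | π g u = u}
  one_mem' := by simp
  mul_mem' := by
    intro a b (ha : π a u = u) (hb : π b u = u)
    show π (a * b) u = u
    rw [map_mul, Module.End.mul_apply, hb, ha]
  inv_mem' := by
    intro a (ha : π a u = u)
    show π a⁻¹ u = u
    conv_lhs => rw [← ha]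
    rw [← Module.End.mul_apply, ← map_mul]; simp

lemma mem_stab {π : T.GU →* Module.End ℂ W} {u : W} {g : T.GU} : g ∈ stab π u ↔ π g u = u := Iff.rfl

lemma Good_of (H : Hyp T) (H0 : Hyp0 T F₀ ψ₀) {n : ℤ} (hn : 0 < n)
    (hn4 : Int.gcd n 4 = 1) {Λ : T.LatSeq} (hΛ : T.IsLam3 Λ)
    {β : EE F} (hβ : β ∈ AA T (-n)) (hβs : T.σA β = -β)
    (hβf : T.IsFundamental Λ n β)
    (π : T.GU →* Module.End ℂ W) {u : W} (hu : u ≠ 0)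
    (hπ : ∀ x, T.toE x - 1 ∈ AA T (n / 2 + 1) → π x u = T.psiCh F₀ ψ₀ β x • u) :
    Good T (stab π u) := by
  have fix0 : ∀ g, (∀ b, MP T ((T.toE g - 1) (E1 F b))) → g ∈ stab π u := by
    intro g hg
    rw [mem_stab, hπ g (AA_all hg _), psi_triv H H0 hβ (AA_all hg _), one_smul]
  refine ⟨fix0, ?_⟩
  intro p p' hp
  obtain ⟨j, hj, c, hc, hcI⟩ := leadB hΛ hn hn4 hβ hβf hp
  refine ⟨j, hj, ?_⟩
  intro g hg v q hv hq hgv hgq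
  have hcO : Op T c := ⟨_, hcI⟩
  have hvL := LP_near hv (LP_E j)
  have hqL := LP_near hq (LP_E p')
  set Z : EE F := c • rk T q v with hZ
  have hZm : Z ∈ AA T (n / 2 + 1) := by
    have h1 : c • Eu F j p ∈ AA T (n / 2 + 1) := by
      rw [mem_AA_iff]; intro a b
      simp only [LinearMap.smul_apply, Eu_apply, Pi.smul_apply, smul_eq_mul]
      by_cases ha : a = j
      · by_cases hb : b = p
        · subst ha; subst hb; simpa using hcI
        · simp [Pi.single_apply, Ne.symm hb]; exact I_zero _
      · simp [Pi.single_apply, ha]; exact I_zero _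
    have h2 : Z - c • Eu F j p ∈ AA T (n / 2 + 1) := by
      apply AA_all; intro b
      have : (Z - c • Eu F j p) (E1 F b) = c • (T.h (q - E1 F p') (E1 F b) • v +
          (E1 F b p) • (v - E1 F j)) := by
        rw [h_sub_left, hp.h H]
        simp only [hZ, LinearMap.sub_apply, LinearMap.smul_apply, rk_apply, Eu_apply]
        module
      rw [this]
      refine MP_smul hcO (MP_add (MP_smul' (h_MP_l H hq (LP_E b)) hvL) (MP_smul (LP_E b p) hv))
    have := AA_add h2 h1
    rwa [sub_add_cancel] at this
  have key : I T 1 (LinearMap.trace F _ (β * Z)) := by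
    apply addlem H H0 hβs
    intro d hd
    have hdZ := AA_smul0 hd hZm
    have hy := AA_sub hdZ (H.σ_mem hdZ)
    have hys : T.σA (d • Z - T.σA (d • Z)) = -(d • Z - T.σA (d • Z)) := by
      rw [σ_sub, T.σA_invol, neg_sub]
    obtain ⟨x, D, hx⟩ := H.cay_exists (AA_mono (by omega) hy) hys
    rw [← psi_cay H H0 hβ (by omega) (by omega) hy hx]
    have hx2 := hx.conj g⁻¹
    rw [inv_inv] at hx2
    have hyc : T.toE g * (d • Z - T.σA (d • Z)) * T.toE g⁻¹ =
        (d * c) • rk T (T.toE g q) (T.toE g v) - T.conj (d * c) • rk T (T.toE g v) (T.toE g q) := by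
      rw [hZ, smul_smul, σ_smul, σ_rk, mul_sub, sub_mul, ← rk_conj, ← rk_conj]
      simp only [mul_smul_comm, smul_mul_assoc]
    rw [hyc] at hx2
    have hdc : Op T (d * c) := Op_mul (Op_O hd) hcO
    have hym : ∀ m, (d * c) • rk T (T.toE g q) (T.toE g v) -
        T.conj (d * c) • rk T (T.toE g v) (T.toE g q) ∈ AA T m := by
      intro m
      apply AA_all; intro b
      simp only [LinearMap.sub_apply, LinearMap.smul_apply, rk_apply]
      exact MP_sub (MP_smul hdc (MP_smul' (h_MP_l H hgq (LP_E b)) hgv))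
        (MP_smul (Op_conj H hdc) (MP_smul (h_LP H hgv (LP_E b)) hgq))
    have hk : g * x * g⁻¹ ∈ stab π u := by
      have := (H.cay_mem hx2 (m := n + 1) (by omega) (hym _)).1
      rw [mem_stab, hπ _ (AA_mono (by omega) this), psi_triv H H0 hβ this, one_smul]
    have hxk : x ∈ stab π u := by
      have := mul_mem (mul_mem (inv_mem hg) hk) hg
      simpa [mul_assoc] using this
    have h5 := hπ x (H.cay_mem hx (by omega) hy).1
    rw [mem_stab.1 hxk] at h5
    have h6 : (T.psiCh F₀ ψ₀ β x - 1) • u = 0 := by rw [sub_smul, one_smul, ← h5, sub_self]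
    rcases smul_eq_zero.1 h6 with h | h
    · exact sub_eq_zero.1 h
    · exact absurd h hu
  apply not_pF_one (T := T)
  have h7 : LinearMap.trace F _ (β * Z) = 1 + c * (T.h (q - E1 F p') (β v) + (β (v - E1 F j)) p) := by
    rw [hZ, mul_smul_comm, map_smul, mul_rk, trace_rk, h_sub_left, hp.h H, map_sub, Pi.sub_apply, ← hc,
      smul_eq_mul]; ring
  have h8 : Mp T (c * (T.h (q - E1 F p') (β v) + (β (v - E1 F j)) p)) :=
    Mp_mul hcO (Mp_add (h_MP_l H hq (AA_LP hβ hvL)) (AA_MP hβ hv p))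
  have := I_sub key (h8 1)
  rw [h7] at this; simpa using this
end

lemma tv_G {f : Fin 4 → F} {s : F} (hf : T.h f f = 0) (hs : T.conj s = -s) :
    ∃ g : T.GU, T.toE g = 1 + s • rk T f f := by
  apply exists_G
  intro v w
  simp only [LinearMap.add_apply, LinearMap.smul_apply, rk_apply, Module.End.one_apply]
  simp only [T.h_add_left, h_add_right, T.h_smul_left, h_smul_right, hf, hs, ← T.h_conj_symm]
  ring

lemma Good.tv (H : Hyp T) {K : Subgroup T.GU} (hK : Good T K) {g : T.GU} {f : Fin 4 → F} {s : F}
    (hg : T.toE g = 1 + s • rk T f f) (h : ∀ a, Mp T (s * (f a * T.conj (f a)))) : g ∈ K := by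
  apply hK.fix0
  intro b a
  have key : ∀ a b, Mp T (s * (f a * T.conj (f b))) := by
    intro a b
    apply norm_Mp H
    have := Mp_mul (h a).op (Mp_conj H (h b))
    convert this using 1
    simp only [map_mul, T.conj_invol]; ring
  have : (T.toE g - 1) (E1 F b) a = T.conj (E1 F b 0) * 0 + s * (T.h f (E1 F b) * f a) := by
    rw [hg]; simp [rk_apply]
  rw [this, H.form]
  have e := fun k => LP_E (T := T) b k
  have := Mp_add (Mp_add (Mp_add (Mp_mul (e 3) (key a 0)) (Mp_mul (Op_mul Op_ϖ (e 1)) (key a 1)))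
    (Mp_mul (e 2) (key a 2))) (Mp_mul (e 0) (key a 3))
  convert this using 1; ring

lemma Opp.swap {p p' : Fin 4} (hp : Opp T p p') : Opp T p' p := by
  rcases hp with h | h
  · exact Or.inr h.symm
  · exact Or.inl h.symm

lemma Opp.pp {p p' : Fin 4} (hp : Opp T p p') : E1 F p p' = 0 ∧ E1 F p p = 1 := by
  rcases hp with ⟨rfl, rfl⟩ | ⟨rfl, rfl⟩ <;> simp [E1]

lemma Good.X (H : Hyp T) {K : Subgroup T.GU} (hK : Good T K) {g : T.GU} (hgK : g ∈ K)
    {f : Fin 4 → F} {s : F} {p p' : Fin 4} (hp : Opp T p p')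
    (hg : T.toE g = 1 + s • rk T f f) (hff : T.h f f = 0) (hf1 : f p' = 1)
    (hf : MP T (f - E1 F p')) (hs0 : s ≠ 0) (hs : Mp T s⁻¹) : False := by
  obtain ⟨j, hj, hY⟩ := hK.Y p p' hp
  have hfp : T.h f (E1 F p) = 1 := by
    rw [T.h_conj_symm, hp.swap.h H, hf1, map_one]
  refine hY g hgK (E1 F j - T.h f (E1 F j) • E1 F p) (f - s⁻¹ • E1 F p) ?_ ?_ ?_ ?_
  · have h1 : Mp T (T.h f (E1 F j)) := by
      have : T.h f (E1 F j) = T.h (f - E1 F p') (E1 F j) := by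
        rw [h_sub_left, hp.h H]
        have : E1 F j p = 0 := by
          rcases hj with rfl | rfl <;> rcases hp with ⟨rfl, -⟩ | ⟨rfl, -⟩ <;> simp [E1]
        rw [this, sub_zero]
      rw [this]; exact h_MP_l H hf (LP_E j)
    have : E1 F j - T.h f (E1 F j) • E1 F p - E1 F j = -(T.h f (E1 F j) • E1 F p) := by abel
    rw [this]; exact MP_neg (MP_smul' h1 (LP_E p))
  · rw [sub_right_comm]
    exact MP_sub hf (MP_smul' hs (LP_E p))
  · have : T.toE g (E1 F j - T.h f (E1 F j) • E1 F p) = E1 F j - T.h f (E1 F j) • E1 F p := by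
      rw [hg]
      simp only [LinearMap.add_apply, LinearMap.smul_apply, rk_apply, Module.End.one_apply,
        h_sub_right, h_smul_right, hfp, mul_one, sub_self, zero_smul, smul_zero, add_zero]
    rw [this]
    refine LP_sub (LP_E j) (LP_smul (h_LP H (LP_near hf (LP_E p')) (LP_E j)) (LP_E p))
  · have : T.toE g (f - s⁻¹ • E1 F p) = -(s⁻¹ • E1 F p) := by
      rw [hg]
      simp only [LinearMap.add_apply, LinearMap.smul_apply, rk_apply, Module.End.one_apply,
        h_sub_right, h_smul_right, hfp, hff, mul_one, zero_sub, smul_smul]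
      rw [mul_neg, mul_inv_cancel₀ hs0, neg_smul, one_smul]; abel
    rw [this]
    exact MP_neg (MP_smul' hs (LP_E p))
end U4P

namespace U4P
open USetting
variable {F : Type u} [Field F] {T : USetting F (Fin 4 → F)}

lemma tr_small (H : Hyp T) {x y z : F} (h : T.ϖ * (x * T.conj x) + y * T.conj y = -(z + T.conj z)) :
    (∃ k, Op T k ∧ x * T.conj x = z * k) ∧ (∃ k, Op T k ∧ y * T.conj y = z * k) := by
  obtain ⟨c, hc, hcz⟩ := conj_div (T := T) z
  obtain ⟨o₁, ho₁, o₂, ho₂, h1, h2⟩ := H.aniso x y _ h.symm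
  have hϖ := T.ϖ_ne_zero
  have hc' : Op T (-(1 + c)) := Op_neg (Op_add Op_one (Op_O hc))
  constructor
  · refine ⟨T.ϖ⁻¹ * (-(1 + c) * o₁), Op_mul Op_ϖinv (Op_mul hc' (Op_O ho₁)), ?_⟩
    rw [hcz] at h1
    have : x * T.conj x = T.ϖ⁻¹ * (T.ϖ * (x * T.conj x)) := by field_simp
    rw [this, h1]; ring
  · refine ⟨-(1 + c) * o₂, Op_mul hc' (Op_O ho₂), ?_⟩
    rw [hcz] at h2
    rw [h2]; ring

lemma hE (H : Hyp T) (v : Fin 4 → F) : T.h (E1 F 0) v = v 3 ∧ T.h (E1 F 1) v = T.ϖ * v 1 ∧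
    T.h (E1 F 2) v = v 2 ∧ T.h (E1 F 3) v = v 0 := by
  refine ⟨?_, ?_, ?_, ?_⟩ <;> rw [H.form] <;> simp [E1]

lemma hE' (H : Hyp T) (v : Fin 4 → F) : T.h v (E1 F 0) = T.conj (v 3) ∧
    T.h v (E1 F 1) = T.ϖ * T.conj (v 1) ∧
    T.h v (E1 F 2) = T.conj (v 2) ∧ T.h v (E1 F 3) = T.conj (v 0) := by
  refine ⟨?_, ?_, ?_, ?_⟩ <;> rw [H.form] <;> simp [E1]

lemma Good.X4 (H : Hyp T) {K : Subgroup T.GU} (hK : Good T K) {g : T.GU} (hgK : g ∈ K)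
    {y1 y2 z r1 r2 : F} (h3 : T.toE g (E1 F 3) = E1 F 3)
    (h0 : T.toE g (E1 F 0) = E1 F 0 + y1 • E1 F 1 + y2 • E1 F 2 + z • E1 F 3)
    (h1 : T.toE g (E1 F 1) = E1 F 1 + r1 • E1 F 3) (h2 : T.toE g (E1 F 2) = E1 F 2 + r2 • E1 F 3)
    (hz : ¬ Op T z) : False := by
  have hz0 : z ≠ 0 := by rintro rfl; exact hz Op_zero
  have hzc0 : T.conj z ≠ 0 := by simpa using hz0
  have hzi := Mp_inv hz
  have e1 : T.ϖ * T.conj y1 + r1 = 0 := by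
    have := h_toE g (E1 F 0) (E1 F 1)
    rw [h0, h1, H.form, H.form] at this
    simpa [E1, add_comm] using this
  have e2 : T.conj y2 + r2 = 0 := by
    have := h_toE g (E1 F 0) (E1 F 2)
    rw [h0, h2, H.form, H.form] at this
    simpa [E1, add_comm] using this
  have e0 : T.ϖ * (y1 * T.conj y1) + y2 * T.conj y2 = -(z + T.conj z) := by
    have := h_toE g (E1 F 0) (E1 F 0)
    rw [h0, H.form, H.form] at this
    simp [E1] at this
    linear_combination this
  obtain ⟨⟨k1, hk1, n1⟩, ⟨k2, hk2, n2⟩⟩ := tr_small H e0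
  obtain ⟨c, hc, hcz⟩ := conj_div (T := T) z
  have hcz' : z = T.conj c * T.conj z := by
    conv_lhs => rw [← T.conj_invol z, hcz]
    rw [map_mul]
  have hcc := Op_conj H (Op_O hc)
  have small : ∀ y k, Op T k → y * T.conj y = z * k → Mp T (y / z) := by
    intro y k hk hy
    apply norm_Mp H
    have : y / z * T.conj (y / z) = k * T.conj (z⁻¹) := by
      rw [map_div₀, map_inv₀, div_mul_div_comm, hy]; field_simp
    rw [this]; exact Mp_mul hk (Mp_conj H hzi)
  have bdd : ∀ y k y' k', Op T k → Op T k' → y * T.conj y = z * k → y' * T.conj y' = z * k' →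
      Op T (T.conj y * y' / z) := by
    intro y k y' k' hk hk' hy hy'
    apply norm_Op H
    have : T.conj y * y' / z * T.conj (T.conj y * y' / z) = k * k' * T.conj c := by
      rw [map_div₀, map_mul, T.conj_invol, div_mul_div_comm]
      rw [show T.conj y * y' * (y * T.conj y') = (y * T.conj y) * (y' * T.conj y') by ring, hy, hy']
      rw [div_eq_iff (mul_ne_zero hz0 hzc0)]
      linear_combination k * k' * z * hcz'
    rw [this]; exact Op_mul (Op_mul hk hk') hcc
  have s1 := small _ _ hk1 n1
  have s2 := small _ _ hk2 n2
  have conjs : ∀ y k, Op T k → y * T.conj y = z * k → Mp T (T.conj y / z) := by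
    intro y k hk hy
    apply small _ k hk
    rw [T.conj_invol, mul_comm, hy]
  obtain ⟨j, hj, hY⟩ := hK.Y 0 3 opp03
  obtain ⟨r, hr, hgr, hr1, hr2⟩ : ∃ r, Mp T (r / z) ∧ T.toE g (E1 F j) = E1 F j + r • E1 F 3 ∧
      Op T (r * y1 / z) ∧ Op T (r * y2 / z) := by
    rcases hj with rfl | rfl
    · have : r1 = -(T.ϖ * T.conj y1) := by linear_combination e1
      refine ⟨r1, ?_, h1, ?_, ?_⟩
      · have := Mp_neg (Mp_mul Op_ϖ (conjs _ _ hk1 n1)); convert this using 1; rw [‹r1 = _›]; ring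
      · have := Op_neg (Op_mul Op_ϖ (bdd _ _ _ _ hk1 hk1 n1 n1)); convert this using 1; rw [‹r1 = _›]; ring
      · have := Op_neg (Op_mul Op_ϖ (bdd _ _ _ _ hk1 hk2 n1 n2)); convert this using 1; rw [‹r1 = _›]; ring
    · have : r2 = -(T.conj y2) := by linear_combination e2
      refine ⟨r2, ?_, h2, ?_, ?_⟩
      · have := Mp_neg (conjs _ _ hk2 n2); convert this using 1; rw [‹r2 = _›]; ring
      · have := Op_neg (bdd _ _ _ _ hk2 hk1 n2 n1); convert this using 1; rw [‹r2 = _›]; ring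
      · have := Op_neg (bdd _ _ _ _ hk2 hk2 n2 n2); convert this using 1; rw [‹r2 = _›]; ring
  have hzci : Mp T (T.conj z)⁻¹ := by rw [← map_inv₀]; exact Mp_conj H hzi
  have sc : ∀ y, Mp T (y / z) → Mp T (y / T.conj z) := by
    intro y hy
    have := Mp_mul hcc hy
    convert this using 1
    field_simp; linear_combination y * hcz'
  refine hY g hgK (E1 F j - (r / z) • E1 F 0)
    ((T.conj z)⁻¹ • E1 F 0 - (y1 / T.conj z) • E1 F 1 - (y2 / T.conj z) • E1 F 2 + E1 F 3) ?_ ?_ ?_ ?_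
  · rw [sub_right_comm, sub_self, zero_sub]
    exact MP_neg (MP_smul' hr (LP_E 0))
  · rw [add_sub_cancel_right]
    exact MP_sub (MP_sub (MP_smul' hzci (LP_E 0)) (MP_smul' (sc _ s1) (LP_E 1))) (MP_smul' (sc _ s2) (LP_E 2))
  · have : T.toE g (E1 F j - (r / z) • E1 F 0) =
        E1 F j - ((r / z) • E1 F 0 + (r * y1 / z) • E1 F 1 + (r * y2 / z) • E1 F 2) := by
      rw [map_sub, map_smul, hgr, h0]
      have : r = r / z * z := by field_simp
      rw [show r * y1 / z = r / z * y1 by ring, show r * y2 / z = r / z * y2 by ring]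
      nth_rw 1 [this]
      module
    rw [this]
    exact LP_sub (LP_E j) (LP_add (LP_add (LP_smul hr.op (LP_E 0)) (LP_smul hr1 (LP_E 1))) (LP_smul hr2 (LP_E 2)))
  · have : T.toE g ((T.conj z)⁻¹ • E1 F 0 - (y1 / T.conj z) • E1 F 1 - (y2 / T.conj z) • E1 F 2 + E1 F 3) =
        (T.conj z)⁻¹ • E1 F 0 := by
      rw [map_add, map_sub, map_sub, map_smul, map_smul, map_smul, h0, h1, h2, h3]
      have hc3 : (T.conj z)⁻¹ * z - (y1 / T.conj z) * r1 - (y2 / T.conj z) * r2 + 1 = 0 := by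
        field_simp
        linear_combination -e0 - y1 * e1 - y2 * e2 + 2 * e0
      have : ((T.conj z)⁻¹ * z - (y1 / T.conj z) * r1 - (y2 / T.conj z) * r2 + 1) • E1 F 3 = 0 := by
        rw [hc3, zero_smul]
      rw [div_eq_inv_mul, div_eq_inv_mul] at this ⊢
      rw [← sub_eq_zero, ← this]; module
    rw [this]
    exact MP_smul' hzci (LP_E 0)
end U4P

namespace U4P
open USetting
variable {F : Type u} [Field F] {T : USetting F (Fin 4 → F)}

structure Lat (T : USetting F (Fin 4 → F)) (L : Set (Fin 4 → F)) (S : Subgroup T.GU) : Prop where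
  add : ∀ v ∈ L, ∀ w ∈ L, v + w ∈ L
  smul : ∀ c, Op T c → ∀ v ∈ L, c • v ∈ L
  herm : ∀ v ∈ L, ∀ w ∈ L, Op T (T.h v w)
  prim : ∀ e : Fin 4 → F, e ≠ 0 → ∃ a : F, a ≠ 0 ∧ a • e ∈ L ∧ ∃ f ∈ L, T.h (a • e) f = 1
  fix : ∀ g, (∀ v ∈ L, ∀ w ∈ L, Mp T (T.h ((T.toE g - 1) v) w)) → g ∈ S

section
variable (Λ : T.LatSeq)
lemma lat_mono {i j : ℤ} (h : i ≤ j) : Λ.L j ⊆ Λ.L i := by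
  obtain ⟨k, rfl⟩ := Int.le.dest h
  induction k with
  | zero => simp
  | succ k ih =>
    refine subset_trans ?_ (ih (by omega))
    have := Λ.dec (i + k)
    push_cast; rwa [← add_assoc]
lemma lat_up {i : ℤ} {v : Fin 4 → F} (hv : v ∈ Λ.L i) : T.ϖ • v ∈ Λ.L (i + Λ.e) := by
  rw [Λ.periodic]; exact Set.smul_mem_smul_set hv
lemma lat_down {i : ℤ} {v : Fin 4 → F} (hv : v ∈ Λ.L i) : T.ϖ⁻¹ • v ∈ Λ.L (i - Λ.e) := by
  have := Λ.periodic (i - Λ.e)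
  rw [sub_add_cancel] at this
  rw [this] at hv
  obtain ⟨w, hw, rfl⟩ := hv
  simpa [smul_smul, inv_mul_cancel₀ T.ϖ_ne_zero] using hw
lemma lat_pow (j : ℤ) {i : ℤ} {v : Fin 4 → F} (hv : v ∈ Λ.L i) : T.ϖ ^ j • v ∈ Λ.L (i + j * Λ.e) := by
  have h0 := T.ϖ_ne_zero
  induction j using Int.induction_on with
  | zero => simpa using hv
  | succ k ih =>
    have := lat_up Λ ih
    rw [smul_smul, ← zpow_one_add₀ h0, add_assoc, ← add_one_mul, add_comm 1] at this
    exact this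
  | pred k ih =>
    have := lat_down Λ ih
    rw [smul_smul, ← zpow_neg_one, ← zpow_add₀ h0] at this
    rw [show -(k:ℤ) - 1 = -1 + -(k:ℤ) by ring,
      show i + (-1 + -(k:ℤ)) * Λ.e = i + -(k:ℤ) * Λ.e - Λ.e by ring]
    exact this
end

section
variable {W : Type v} [AddCommGroup W] [Module ℂ W]
lemma smooth_Lat (H : Hyp T) {π : T.GU →* Module.End ℂ W} (hs : T.Smooth π) (w : W) :
    ∃ L, Lat T L (stab π w) := by
  obtain ⟨Λ, hfull, ⟨d, hd⟩, k, hk, hfix⟩ := hs w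
  have dual : ∀ i v, v ∈ Λ.L i ↔ ∀ w ∈ Λ.L (d - i), T.h v w ∈ T.O := by
    intro i v
    have := hd (d - i)
    rw [sub_sub_cancel] at this
    rw [← this]; rfl
  refine ⟨{v | ∃ i, v ∈ Λ.L i}, ?_, ?_, ?_, ?_, ?_⟩
  · rintro v ⟨i, hi⟩ w ⟨j, hj⟩
    exact ⟨min i j, Λ.add_mem _ _ _ (lat_mono Λ (min_le_left _ _) hi) (lat_mono Λ (min_le_right _ _) hj)⟩
  · rintro c ⟨j, hj⟩ v ⟨i, hi⟩
    refine ⟨i + j * Λ.e, ?_⟩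
    · have := lat_pow Λ j (Λ.smul_mem _ _ hj _ hi)
      rwa [smul_smul, ← mul_assoc, ← zpow_add₀ T.ϖ_ne_zero, add_neg_cancel, zpow_zero, one_mul] at this
  · rintro v ⟨i, hi⟩ w ⟨j, hj⟩
    refine ⟨-|d - i - j|, ?_⟩
    have h1 := lat_pow Λ (|d - i - j|) hj
    have h2 := (dual i v).1 hi _ (lat_mono Λ (by
      have h3 := Λ.e_pos
      have h4 : |d - i - j| ≤ |d - i - j| * Λ.e := le_mul_of_one_le_right (abs_nonneg _) (by omega)
      have h5 := le_abs_self (d - i - j)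
      omega) h1)
    rw [h_smul_right] at h2
    show _ ∈ T.O
    rwa [neg_neg]
  · intro e he
    obtain ⟨hspan, s, hs1, hs2⟩ := hfull 0
    have hex : ∃ x ∈ s, T.h e x ≠ 0 := by
      by_contra hcon
      push Not at hcon
      apply he
      apply T.h_nondeg
      have h1 : ∀ w ∈ Λ.L 0, T.h e w = 0 := by
        intro w hw
        obtain ⟨c, -, rfl⟩ := hs2 w hw
        have : ∀ r : Finset (Fin 4 → F), r ⊆ s → T.h e (∑ w ∈ r, c w • w) = 0 := by
          intro r
          induction r using Finset.induction_on with
          | empty => intro _; simpa using h_zero_right T e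
          | insert a r ha ih =>
            intro hr
            rw [Finset.sum_insert ha, h_add_right, h_smul_right, hcon a (hr (Finset.mem_insert_self _ _)),
              ih (fun x hx => hr (Finset.mem_insert_of_mem hx)), mul_zero, add_zero]
        exact this s subset_rfl
      intro w
      have hw : w ∈ Submodule.span F (Λ.L 0) := by rw [hspan]; trivial
      induction hw using Submodule.span_induction with
      | mem x hx => exact h1 x hx
      | zero => exact h_zero_right T e
      | add x y _ _ hx hy => rw [h_add_right, hx, hy, add_zero]
      | smul c x _ hx => rw [h_smul_right, hx, mul_zero]
    obtain ⟨x1, hx1, hx1'⟩ := hex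
    obtain ⟨x0, hx0, hdom⟩ := exists_dom (T := T) s ⟨x1, hx1⟩ (fun x => T.h e x)
    have hne : T.h e x0 ≠ 0 := by
      intro h0
      obtain ⟨c, -, hc⟩ := hdom x1 hx1
      simp only [h0, mul_zero] at hc
      exact hx1' hc
    have hne' : T.conj (T.h e x0) ≠ 0 := by simpa using hne
    refine ⟨(T.conj (T.h e x0))⁻¹, inv_ne_zero hne', ⟨d, ?_⟩, x0, ⟨0, hs1 hx0⟩, ?_⟩
    · rw [dual]; intro w hw
      rw [sub_self] at hw
      obtain ⟨c, hc, rfl⟩ := hs2 w hw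
      have : ∀ r : Finset (Fin 4 → F), r ⊆ s →
          T.h ((T.conj (T.h e x0))⁻¹ • e) (∑ w ∈ r, c w • w) ∈ T.O := by
        intro r
        induction r using Finset.induction_on with
        | empty => intro _; simpa [h_zero_right T] using T.O.zero_mem
        | insert a r ha ih =>
          intro hr
          rw [Finset.sum_insert ha, h_add_right, h_smul_right]
          have has := hr (Finset.mem_insert_self _ _)
          refine T.O.add_mem (T.O.mul_mem (hc a has) ?_) (ih (fun x hx => hr (Finset.mem_insert_of_mem hx)))
          rw [T.h_smul_left, map_inv₀, T.conj_invol]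
          obtain ⟨c', hc', e'⟩ := hdom a has
          rw [e']
          convert hc' using 1
          field_simp
      exact this s subset_rfl
    · rw [T.h_smul_left, map_inv₀, T.conj_invol, inv_mul_cancel₀ hne]
  · intro g hg
    apply hfix
    intro i v hv
    rw [dual]
    intro w hw
    exact I0.1 (hg v ⟨_, hv⟩ w ⟨_, hw⟩ 0)
end

lemma Lat.tv (H : Hyp T) {L : Set (Fin 4 → F)} {S : Subgroup T.GU} (hL : Lat T L S) {g : T.GU}
    {f : Fin 4 → F} {s c : F} (hg : T.toE g = 1 + s • rk T f f) (hc : c ≠ 0) (hcf : c • f ∈ L)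
    (h : Mp T (s * (c * T.conj c)⁻¹)) : g ∈ S := by
  apply hL.fix
  intro v hv w hw
  have hc' : T.conj c ≠ 0 := by simpa using hc
  have h1 := hL.herm _ hcf _ hv
  have h2 := hL.herm _ hcf _ hw
  have := Mp_mul (Op_mul (Op_conj H h1) h2) (Mp_conj H h)
  convert this using 1
  rw [hg]
  simp only [LinearMap.add_apply, LinearMap.sub_apply, LinearMap.smul_apply, rk_apply,
    Module.End.one_apply, add_sub_cancel_left, T.h_smul_left, map_mul, map_inv₀, T.conj_invol]
  field_simp

lemma diagG (H : Hyp T) {a b : F} (h : T.conj a * b = 1) : ∃ g : T.GU,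
    (∀ v, T.toE g v = ![a * v 0, v 1, v 2, b * v 3]) ∧
    (∀ v, T.toE g⁻¹ v = ![a⁻¹ * v 0, v 1, v 2, b⁻¹ * v 3]) := by
  have h' : T.conj b * a = 1 := by
    have := congrArg T.conj h
    rwa [map_mul, T.conj_invol, map_one, mul_comm] at this
  have ha : a ≠ 0 := right_ne_zero_of_mul_eq_one h'
  have hb : b ≠ 0 := right_ne_zero_of_mul_eq_one h
  let A : EE F := Matrix.toLin' (Matrix.diagonal ![a, 1, 1, b])
  have hA : ∀ v, A v = ![a * v 0, v 1, v 2, b * v 3] := by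
    intro v
    ext j
    simp only [A, Matrix.toLin'_apply, Matrix.mulVec_diagonal]
    fin_cases j <;> simp
  obtain ⟨g, hg⟩ := exists_G (T := T) A (by
    intro v w
    rw [hA, hA, H.form, H.form]
    simp
    linear_combination T.conj (v 0) * w 3 * h + T.conj (v 3) * w 0 * h')
  refine ⟨g, fun v => by rw [hg, hA], fun v => ?_⟩
  have : v = T.toE g ![a⁻¹ * v 0, v 1, v 2, b⁻¹ * v 3] := by
    rw [hg, hA]
    ext j
    fin_cases j <;> simp [ha, hb]
  conv_lhs => rw [this]
  rw [toE_inv_apply]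

lemma gramD (H : Hyp T) {L : Set (Fin 4 → F)} {S : Subgroup T.GU} (hL : Lat T L S)
    {e1 f e4 f4 : Fin 4 → F} (h1 : e1 ∈ L) (h2 : f ∈ L) (h3 : e4 ∈ L) (h4 : f4 ∈ L)
    (h11 : T.h e1 e1 = 0) (h22 : T.h f f = 0) (h33 : T.h e4 e4 = 0) (h12 : T.h e1 f = 1)
    (h34 : T.h e4 f4 = 1) (hd : Mp T (T.h e1 e4)) : ¬ Mp T (T.h f e4) := by
  intro hb
  let vs : Fin 4 → (Fin 4 → F) := ![e1, f, e4, f4]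
  let B : Matrix (Fin 4) (Fin 4) F := Matrix.of vs
  let Hm : Matrix (Fin 4) (Fin 4) F := !![0,0,0,1; 0,T.ϖ,0,0; 0,0,1,0; 1,0,0,0]
  have hG : Matrix.of (fun k l => T.h (vs k) (vs l)) =
      (T.conj : F →+* F).mapMatrix B * Hm * B.transpose := by
    ext k l
    rw [Matrix.of_apply, H.form]
    simp [Matrix.mul_apply, Fin.sum_univ_four, Hm, B]
    ring
  have hdet := congrArg Matrix.det hG
  rw [Matrix.det_mul, Matrix.det_mul, Matrix.det_transpose, ← RingHom.map_det] at hdet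
  have hHm : Hm.det = -T.ϖ := by
    simp [Hm, Matrix.det_succ_row_zero, Fin.sum_univ_succ, Fin.succAbove]
    try ring
  rw [hHm] at hdet
  have h21 : T.h f e1 = 1 := by rw [T.h_conj_symm, h12, map_one]
  have h43 : T.h f4 e4 = 1 := by rw [T.h_conj_symm, h34, map_one]
  have hGd : (Matrix.of (fun k l => T.h (vs k) (vs l))) =
      !![0, 1, T.h e1 e4, T.h e1 f4; 1, 0, T.h f e4, T.h f f4;
        T.h e4 e1, T.h e4 f, 0, 1; T.h f4 e1, T.h f4 f, 1, T.h f4 f4] := by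
    ext k l
    fin_cases k <;> fin_cases l <;> simp [vs, h11, h22, h33, h12, h34, h21, h43]
  rw [hGd] at hdet
  have hd' : Mp T (T.h e4 e1) := by rw [T.h_conj_symm]; exact Mp_conj H hd
  have hb' : Mp T (T.h e4 f) := by rw [T.h_conj_symm]; exact Mp_conj H hb
  have hx := hL.herm _ h1 _ h4
  have hy := hL.herm _ h2 _ h4
  have hx' := hL.herm _ h4 _ h1
  have hy' := hL.herm _ h4 _ h2
  have hz := hL.herm _ h4 _ h4
  have hexp : ∀ d b d' b' x y x' y' z : F,
      (!![0, 1, d, x; 1, 0, b, y; d', b', 0, 1; x', y', 1, z] : Matrix (Fin 4) (Fin 4) F).det =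
      1 + ((d' * z - x' + x * b' * x' - x * d' * y') * b + (b' * z - y' + y * d' * y' - y * b' * x') * d
        - y * d' - x * b') := by
    intro d b d' b' x y x' y' z
    simp [Matrix.det_succ_row_zero, Fin.sum_univ_succ, Fin.succAbove]
    ring
  rw [hexp] at hdet
  have hm := Mp_sub (Mp_sub (Mp_add (Mp_mul (Op_sub (Op_add (Op_sub (Op_mul hd'.op hz) hx')
    (Op_mul (Op_mul hx hb'.op) hx')) (Op_mul (Op_mul hx hd'.op) hy')) hb)
    (Mp_mul (Op_sub (Op_add (Op_sub (Op_mul hb'.op hz) hy')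
    (Op_mul (Op_mul hy hd'.op) hy')) (Op_mul (Op_mul hy hb'.op) hx')) hd)) (Mp_mul hy hd')) (Mp_mul hx hb')
  have fin : ∀ R, Mp T R → 1 + R = T.conj B.det * -T.ϖ * B.det → False := by
    intro R hm hdet
    have hϖ : T.ϖ * (B.det * T.conj B.det) = -(1 + R) := by rw [hdet]; ring
    have h0 : I T 0 (T.ϖ * (B.det * T.conj B.det)) := by
      rw [hϖ]; exact I_neg (I_add (I0.2 T.O.one_mem) (hm 0))
    have h5 := H.noUnit h0
    rw [hϖ] at h5
    have h6 := I_sub (I_neg h5) (hm 1)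
    rw [neg_neg, add_sub_cancel_right] at h6
    exact not_pF_one h6
  exact fin _ hm hdet
end U4P

namespace U4P
open USetting
variable {F : Type u} [Field F] {T : USetting F (Fin 4 → F)}

structure Env (T : USetting F (Fin 4 → F)) (K S : Subgroup T.GU) (L : Set (Fin 4 → F)) (hh : T.GU)
    (t s : F) : Prop where
  H : Hyp T
  Kg : Good T K
  Lg : Lat T L S
  t0 : t ≠ 0
  tc : T.conj t = t
  tm : Mp T t
  s0 : s ≠ 0
  sc : T.conj s = -s
  so : Op T s
  si : Op T s⁻¹
  hi : ∀ v, T.toE hh⁻¹ v = ![t ^ 4 * v 0, v 1, v 2, (t ^ 4)⁻¹ * v 3]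
  T1 : ∀ g, g ∈ K → g ∈ S → hh⁻¹ * g * hh ∈ K
  T2 : ∀ g, g ∈ S → hh⁻¹ * g * hh ∈ K → g ∈ K

lemma tv_conj {g k : T.GU} {f f' : Fin 4 → F} {s s' c : F} (hg : T.toE g = 1 + s • rk T f f)
    (hf : T.toE k⁻¹ f = c • f') (hs : s' = s * (c * T.conj c)) :
    T.toE (k⁻¹ * g * k) = 1 + s' • rk T f' f' := by
  have h1 := rk_conj k⁻¹ f f
  rw [inv_inv] at h1
  rw [toE_mul, toE_mul, hg, mul_add, add_mul, mul_one, toE_inv_mul, mul_smul_comm, smul_mul_assoc, h1, hf, hs]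
  congr 1
  refine LinearMap.ext fun z => ?_
  simp only [LinearMap.smul_apply, rk_apply, T.h_smul_left, smul_smul]
  congr 1; ring

lemma conj_real {s r : F} (hs : T.conj s = -s) (hr : T.conj r = r) : T.conj (s * r) = -(s * r) := by
  rw [map_mul, hs, hr]; ring

lemma iso0 (H : Hyp T) : T.h (E1 F 0) (E1 F 0) = 0 ∧ T.h (E1 F 3) (E1 F 3) = 0 := by
  rw [(hE H _).1, (hE H _).2.2.2]; simp [E1]

lemma Env.d1 {K S : Subgroup T.GU} {L : Set (Fin 4 → F)} {hh : T.GU} {t s : F} (E : Env T K S L hh t s)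
    {a1 a4 : F} (h1 : a1 ≠ 0) (h4 : a4 ≠ 0) (m1 : a1 • E1 F 0 ∈ L) (m4 : a4 • E1 F 3 ∈ L)
    (hd : ¬ Mp T (T.conj a1 * a4)) : False := by
  have H := E.H
  have t0 := E.t0
  have s0 := E.s0
  have h4' : T.conj a4 ≠ 0 := by simpa using h4
  have h1' : T.conj a1 ≠ 0 := by simpa using h1
  have hsi : Mp T (s * (t ^ 3)⁻¹)⁻¹ := by
    rw [mul_inv, inv_inv]; exact Mp_mul E.si (Mp_pow E.tm 3 (by norm_num))
  have hEn : ∀ (j : Fin 4) (x : F), Mp T x → ∀ a, Mp T (x * (E1 F j a * T.conj (E1 F j a))) :=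
    fun j x hx a => Mp_mul' hx (Op_mul (LP_E j a) (Op_conj H (LP_E j a)))
  have hs5 : Mp T (s * t ^ 5) := Mp_mul E.so (Mp_pow E.tm 5 (by norm_num))
  by_cases hc : Op T (a4⁻¹ * t ^ 2)
  · obtain ⟨g, hg⟩ := tv_G (T := T) (iso0 H).2 (conj_real (r := t ^ 5) E.sc (by rw [map_pow, E.tc]))
    have gK : g ∈ K := E.Kg.tv H hg (hEn _ _ hs5)
    have gS : g ∈ S := by
      apply E.Lg.tv H hg h4 m4
      have := Mp_mul (Op_mul E.so (Op_mul hc (Op_conj H hc))) E.tm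
      convert this using 1
      simp only [map_mul, map_inv₀, map_pow, E.tc]; field_simp
    have hg' := tv_conj (k := hh) (c := (t ^ 4)⁻¹) (f' := E1 F 3) (s' := s * (t ^ 3)⁻¹) hg (by
      rw [E.hi]; ext j; fin_cases j <;> simp [E1]) (by
      simp only [map_inv₀, map_pow, E.tc]; field_simp)
    exact E.Kg.X H (E.T1 g gK gS) opp03 hg' (iso0 H).2 (by simp [E1]) (by rw [sub_self]; exact fun _ => Mp_zero)
      (mul_ne_zero s0 (inv_ne_zero (pow_ne_zero _ t0))) hsi
  · have hm := Mp_inv hc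
    have hdi := Op_inv hd
    obtain ⟨g, hg⟩ := tv_G (T := T) (iso0 H).1 (conj_real (r := (t ^ 3)⁻¹) E.sc (by rw [map_inv₀, map_pow, E.tc]))
    have gS : g ∈ S := by
      apply E.Lg.tv H hg h1 m1
      have := Mp_mul (Op_mul (Op_mul E.so (Op_mul hdi (Op_conj H hdi))) (Op_mul hm.op (Op_conj H hm.op))) E.tm
      convert this using 1
      simp only [map_mul, map_inv₀, map_pow, E.tc, T.conj_invol]; field_simp
    have hg' := tv_conj (k := hh) (c := t ^ 4) (f' := E1 F 0) (s' := s * t ^ 5) hg (by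
      rw [E.hi]; ext j; fin_cases j <;> simp [E1]) (by
      simp only [map_pow, E.tc]; field_simp)
    have gK : g ∈ K := E.T2 g gS (E.Kg.tv H hg' (hEn _ _ hs5))
    exact E.Kg.X H gK opp30 hg (iso0 H).1 (by simp [E1]) (by rw [sub_self]; exact fun _ => Mp_zero)
      (mul_ne_zero s0 (inv_ne_zero (pow_ne_zero _ t0))) hsi

lemma Env.getF {K S : Subgroup T.GU} {L : Set (Fin 4 → F)} {hh : T.GU} {t s : F} (E : Env T K S L hh t s)
    {a1 a4 : F} (h1 : a1 ≠ 0) (h4 : a4 ≠ 0) (m1 : a1 • E1 F 0 ∈ L) (m4 : a4 • E1 F 3 ∈ L)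
    (hd : Mp T (T.conj a1 * a4)) {f1 f4 : Fin 4 → F} (hf1 : f1 ∈ L) (hf4 : f4 ∈ L)
    (e1 : T.h (a1 • E1 F 0) f1 = 1) (e4 : T.h (a4 • E1 F 3) f4 = 1) :
    ∃ (f : Fin 4 → F) (ν : F), f 0 = 1 ∧ f 3 = T.conj ν ∧ ν ≠ 0 ∧ T.h f f = 0 ∧
      (∀ g r, T.toE g = 1 + r • rk T f f → Op T (r * ν) → g ∈ S) ∧
      ∀ v ∈ L, ∀ w ∈ L, Op T (T.conj (T.h (E1 F 3) v) * T.h f w) := by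
  have H := E.H
  have h4' : T.conj a4 ≠ 0 := by simpa using h4
  have h1' : T.conj a1 ≠ 0 := by simpa using h1
  set k := 2⁻¹ * T.h f1 f1 with hk
  have hkc : T.conj k = k := by rw [hk, map_mul, ← T.h_conj_symm, half_conj]
  have hkO : Op T k := Op_mul (Op_O H.half) (E.Lg.herm _ hf1 _ hf1)
  obtain ⟨f, hf⟩ : ∃ f, f = f1 + (-k) • (a1 • E1 F 0) := ⟨_, rfl⟩
  have fL : f ∈ L := by rw [hf]; exact E.Lg.add _ hf1 _ (E.Lg.smul _ (Op_neg hkO) _ m1)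
  have e1' : T.h f1 (a1 • E1 F 0) = 1 := by rw [T.h_conj_symm, e1, map_one]
  have i1 : T.h (a1 • E1 F 0) (a1 • E1 F 0) = 0 := by rw [T.h_smul_left, h_smul_right, (iso0 H).1]; simp
  have i4 : T.h (a4 • E1 F 3) (a4 • E1 F 3) = 0 := by rw [T.h_smul_left, h_smul_right, (iso0 H).2]; simp
  have ff : T.h f f = 0 := by
    have h2 := H.two_ne
    rw [hf]
    simp only [T.h_add_left, h_add_right]
    rw [T.h_smul_left (-k), T.h_smul_left (-k), h_smul_right T (-k), h_smul_right T (-k), e1, e1', i1, map_neg, hkc, hk]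
    field_simp; ring
  have ef : T.h (a1 • E1 F 0) f = 1 := by
    rw [hf, h_add_right, h_smul_right T (-k), e1, i1]; ring
  have hb := gramD H E.Lg m1 fL m4 hf4 i1 ff i4 ef e4 (by
    rw [T.h_smul_left, h_smul_right, (hE H _).1]; simpa [E1] using hd)
  set b := T.h f (a4 • E1 F 3) with hbdef
  have hb0 : b ≠ 0 := by intro h0; rw [h0] at hb; exact hb Mp_zero
  have hbc0 : T.conj b ≠ 0 := by simpa using hb0
  have hbi := Op_inv hb
  have f0 : T.conj (f 0) = b / a4 := by
    rw [hbdef, h_smul_right, (hE' H _).2.2.2]; field_simp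
  have f3 : f 3 = (T.conj a1)⁻¹ := by
    rw [T.h_smul_left, (hE H _).1] at ef
    field_simp; linear_combination ef
  have f0' : f 0 = T.conj b / T.conj a4 := by rw [← T.conj_invol (f 0), f0, map_div₀]
  refine ⟨T.conj (a4 / b) • f, a4 / (b * a1), ?_, ?_, ?_, ?_, ?_, ?_⟩
  · simp only [Pi.smul_apply, smul_eq_mul, f0', map_div₀]; field_simp
  · simp only [Pi.smul_apply, smul_eq_mul, f3, map_div₀, map_mul]; field_simp
  · exact div_ne_zero h4 (mul_ne_zero hb0 h1)
  · rw [T.h_smul_left, h_smul_right, ff]; simp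
  · intro g r hg hr
    refine E.Lg.tv H (c := T.conj (b / a4)) hg (by simpa using ⟨hb0, h4⟩) ?_ ?_
    · rw [smul_smul, ← map_mul, show b / a4 * (a4 / b) = 1 by field_simp, map_one, one_smul]; exact fL
    · have := Mp_mul (Op_mul hr (Op_conj H hbi)) (Mp_conj H hd)
      convert this using 1
      simp only [map_mul, map_inv₀, map_div₀, T.conj_invol]; field_simp
  · intro v hv w hw
    have := Op_mul (Op_mul (Op_conj H (E.Lg.herm _ m4 _ hv)) (E.Lg.herm _ fL _ hw)) hbi
    convert this using 1
    simp only [T.h_smul_left, map_mul, T.conj_invol, map_div₀]; field_simp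
end U4P

namespace U4P
open USetting
variable {F : Type u} [Field F] {T : USetting F (Fin 4 → F)}

lemma hyp_G {x y : Fin 4 → F} {a a' : F} (hx : T.h x x = 0) (hy : T.h y y = 0) (hxy : T.h x y = 1)
    (ha : T.conj a = a) (ha' : T.conj a' = a') (haa : a + a' + a * a' = 0) :
    ∃ g : T.GU, T.toE g = 1 + a • rk T x y + a' • rk T y x := by
  apply exists_G
  intro v w
  have hyx : T.h y x = 1 := by rw [T.h_conj_symm, hxy, map_one]
  simp only [LinearMap.add_apply, LinearMap.smul_apply, rk_apply, Module.End.one_apply]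
  simp only [T.h_add_left, h_add_right, T.h_smul_left, h_smul_right, hx, hy, hxy, hyx, ha, ha']
  have q1 : T.h v x = T.conj (T.h x v) := T.h_conj_symm _ _
  have q2 : T.h v y = T.conj (T.h y v) := T.h_conj_symm _ _
  rw [q1, q2]
  linear_combination (T.conj (T.h x v) * T.h y w + T.conj (T.h y v) * T.h x w) * haa

lemma Env.d2 {K S : Subgroup T.GU} {L : Set (Fin 4 → F)} {hh : T.GU} {t s : F} (E : Env T K S L hh t s)
    {f : Fin 4 → F} {ν : F} (f0 : f 0 = 1) (f3 : f 3 = T.conj ν) (hν : ν ≠ 0) (ff : T.h f f = 0)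
    (fS : ∀ g r, T.toE g = 1 + r • rk T f f → Op T (r * ν) → g ∈ S)
    (fL : ∀ v ∈ L, ∀ w ∈ L, Op T (T.conj (T.h (E1 F 3) v) * T.h f w)) : False := by
  have H := E.H
  have t0 := E.t0
  have s0 := E.s0
  have hνc : T.conj ν ≠ 0 := by simpa using hν
  have tp : ∀ k : ℕ, T.conj (t ^ k) = t ^ k := fun k => by rw [map_pow, E.tc]
  have ff' : T.ϖ * (f 1 * T.conj (f 1)) + f 2 * T.conj (f 2) = -(ν + T.conj ν) := by
    have := ff
    rw [H.form, f0, f3] at this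
    simp only [map_one, T.conj_invol] at this
    linear_combination this
  obtain ⟨⟨k1, hk1, n1⟩, ⟨k2, hk2, n2⟩⟩ := tr_small H ff'
  by_cases c1 : Op T ν⁻¹
  · -- case (i)
    have hr : T.conj (s * (t * (ν * T.conj ν)⁻¹)) = -(s * (t * (ν * T.conj ν)⁻¹)) :=
      conj_real E.sc (by rw [map_mul, map_inv₀, map_mul, T.conj_invol, E.tc, mul_comm ν])
    obtain ⟨g, hg⟩ := tv_G (T := T) ff hr
    have gS : g ∈ S := by
      apply fS g _ hg
      have := Op_mul (Op_mul E.so E.tm.op) (Op_conj H c1)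
      convert this using 1
      simp only [map_inv₀]; field_simp
    have gK : g ∈ K := by
      apply E.Kg.tv H hg
      have b0 : Mp T (s * t) := Mp_mul E.so E.tm
      have cc1 := Op_conj H c1
      intro a; fin_cases a
      · have := Mp_mul' b0 (Op_mul c1 cc1)
        convert this using 1
        simp [f0]; field_simp
      · have := Mp_mul' b0 (Op_mul hk1 cc1)
        convert this using 1
        simp [n1]; field_simp
      · have := Mp_mul' b0 (Op_mul hk2 cc1)
        convert this using 1
        simp [n2]; field_simp
      · convert b0 using 1
        simp [f3, T.conj_invol]; field_simp
    have hg' := tv_conj (k := hh) (c := T.conj ν / t ^ 4)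
      (f' := ![t ^ 8 / T.conj ν, f 1 * t ^ 4 / T.conj ν, f 2 * t ^ 4 / T.conj ν, 1])
      (s' := s * (t ^ 7)⁻¹) hg (by
        rw [E.hi]; ext j; fin_cases j <;> simp [f0, f3] <;> field_simp) (by
        simp only [map_div₀, tp, T.conj_invol]; field_simp)
    refine E.Kg.X H (E.T1 g gK gS) opp03 hg' ?_ (by simp) ?_ (mul_ne_zero s0 (inv_ne_zero (pow_ne_zero _ t0))) ?_
    · rw [H.form]
      simp [E.tc, T.conj_invol]
      field_simp
      linear_combination t ^ 8 * ff'
    · have cc1 := Op_conj H c1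
      rw [map_inv₀] at cc1
      have sm : ∀ x k, Op T k → x * T.conj x = ν * k → Mp T (x * t ^ 4 / T.conj ν) := by
        intro x k hk hx
        apply norm_Mp H
        have := Mp_mul (Op_mul hk cc1) (Mp_pow E.tm 8 (by norm_num))
        convert this using 1
        simp only [map_div₀, map_mul, tp, T.conj_invol]
        field_simp
        linear_combination hx
      intro j; fin_cases j
      · have := Mp_mul' (Mp_pow E.tm 8 (by norm_num)) cc1
        simpa [E1, div_eq_mul_inv] using this
      · simpa [E1] using sm _ _ hk1 n1
      · simpa [E1] using sm _ _ hk2 n2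
      · simpa [E1] using Mp_zero
    · rw [mul_inv, inv_inv]; exact Mp_mul E.si (Mp_pow E.tm 7 (by norm_num))
  have νm : Mp T ν := by simpa using Mp_inv c1
  by_cases c2 : Op T (ν * (t ^ 6)⁻¹)
  · -- case (ii)
    obtain ⟨g, hg⟩ := tv_G (T := T) ff (conj_real (r := t⁻¹) E.sc (by rw [map_inv₀, E.tc]))
    have gS : g ∈ S := by
      apply fS g _ hg
      have := Op_mul (Op_mul E.so (Op_pow E.tm.op 5)) c2
      convert this using 1
      field_simp
    have hg' := tv_conj (k := hh) (c := 1) (f' := ![t ^ 4, f 1, f 2, (t ^ 4)⁻¹ * T.conj ν])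
      (s' := s * t⁻¹) hg (by
        rw [E.hi]; ext j; fin_cases j <;> simp [f0, f3]) (by simp)
    have gK : g ∈ K := by
      apply E.T2 g gS
      apply E.Kg.tv H hg'
      intro a; fin_cases a
      · have := Mp_mul E.so (Mp_pow E.tm 7 (by norm_num))
        convert this using 1
        simp [E.tc]; field_simp
      · have := Mp_mul (Op_mul (Op_mul E.so c2) hk1) (Mp_pow E.tm 5 (by norm_num))
        convert this using 1
        simp [n1]; field_simp
      · have := Mp_mul (Op_mul (Op_mul E.so c2) hk2) (Mp_pow E.tm 5 (by norm_num))
        convert this using 1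
        simp [n2]; field_simp
      · have := Mp_mul (Op_mul E.so (Op_mul c2 (Op_conj H c2))) (Mp_pow E.tm 3 (by norm_num))
        convert this using 1
        simp [E.tc, T.conj_invol]; field_simp
    refine E.Kg.X H gK opp30 hg ff f0 ?_ (mul_ne_zero s0 (inv_ne_zero t0)) ?_
    · have sm : ∀ x k, Op T k → x * T.conj x = ν * k → Mp T x := by
        intro x k hk hx
        apply norm_Mp H
        rw [hx]; exact Mp_mul' νm hk
      intro j; fin_cases j
      · simpa [E1, f0] using Mp_zero
      · simpa [E1] using sm _ _ hk1 n1
      · simpa [E1] using sm _ _ hk2 n2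
      · simpa [E1, f3] using Mp_conj H νm
    · rw [mul_inv, inv_inv]; exact Mp_mul E.si E.tm
  -- case (iii)
  obtain ⟨ta0, tai⟩ := one_add_Mp E.tm
  obtain ⟨a', ha'⟩ : ∃ a', a' = -t * (1 + t)⁻¹ := ⟨_, rfl⟩
  have a'm : Mp T a' := by rw [ha']; exact Mp_mul' (Mp_neg E.tm) tai
  have a'c : T.conj a' = a' := by rw [ha']; simp [E.tc]
  have haa : t + a' + t * a' = 0 := by rw [ha']; field_simp; ring
  have fLP : LP T f := by
    have sm : ∀ x k, Op T k → x * T.conj x = ν * k → Mp T x := by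
      intro x k hk hx
      apply norm_Mp H
      rw [hx]; exact Mp_mul' νm hk
    intro j; fin_cases j
    · simpa [f0] using Op_one
    · exact (sm _ _ hk1 n1).op
    · exact (sm _ _ hk2 n2).op
    · simpa [f3] using (Mp_conj H νm).op
  have e3f : T.h (E1 F 3) f = 1 := by rw [(hE H _).2.2.2, f0]
  obtain ⟨τ, hτ⟩ := hyp_G (T := T) (iso0 H).2 ff e3f E.tc a'c haa
  have τ1 : ∀ v, (T.toE τ - 1) v = t • (T.h (E1 F 3) v • f) + a' • (T.h f v • E1 F 3) := by
    intro v
    rw [hτ]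
    simp only [LinearMap.sub_apply, LinearMap.add_apply, LinearMap.smul_apply, rk_apply, Module.End.one_apply]
    module
  have τK : τ ∈ K := by
    apply E.Kg.fix0
    intro b
    rw [τ1]
    exact MP_add (MP_smul' E.tm (LP_smul (h_LP H (LP_E _) (LP_E _)) fLP))
      (MP_smul' a'm (LP_smul (h_LP H fLP (LP_E _)) (LP_E _)))
  have τS : τ ∈ S := by
    apply E.Lg.fix
    intro v hv w hw
    rw [τ1]
    simp only [T.h_add_left, T.h_smul_left, E.tc, a'c]
    have h2 := Op_conj H (fL w hw v hv)
    rw [map_mul, T.conj_invol, mul_comm] at h2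
    exact Mp_add (Mp_mul' E.tm (fL v hv w hw)) (Mp_mul' a'm h2)
  have gK := E.T1 τ τK τS
  obtain ⟨ζ, hζ⟩ : ∃ ζ, ζ = T.conj ν / t ^ 8 := ⟨_, rfl⟩
  obtain ⟨G, hG⟩ : ∃ G : Fin 4 → F, G = ![1, f 1 / t ^ 4, f 2 / t ^ 4, ζ] := ⟨_, rfl⟩
  have hg' : T.toE (hh⁻¹ * τ * hh) = 1 + t • rk T (E1 F 3) G + a' • rk T G (E1 F 3) := by
    have i3 : T.toE hh⁻¹ (E1 F 3) = (t ^ 4)⁻¹ • E1 F 3 := by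
      rw [E.hi]; ext j; fin_cases j <;> simp [E1]
    have i0 : T.toE hh⁻¹ f = t ^ 4 • G := by
      rw [E.hi, hG, hζ]; ext j; fin_cases j <;> simp [f0, f3] <;> field_simp
    have r1 := rk_conj hh⁻¹ (E1 F 3) f
    have r2 := rk_conj hh⁻¹ f (E1 F 3)
    rw [inv_inv, i3, i0] at r1 r2
    rw [toE_mul, toE_mul, hτ, mul_add, mul_add, add_mul, add_mul, mul_one, toE_inv_mul, mul_smul_comm,
      smul_mul_assoc, r1, mul_smul_comm, smul_mul_assoc, r2]
    have e1 : rk T ((t ^ 4)⁻¹ • E1 F 3) (t ^ 4 • G) = rk T (E1 F 3) G := by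
      refine LinearMap.ext fun z => ?_
      simp only [rk_apply, T.h_smul_left, smul_smul, map_inv₀, tp]
      congr 1; field_simp
    have e2 : rk T (t ^ 4 • G) ((t ^ 4)⁻¹ • E1 F 3) = rk T G (E1 F 3) := by
      refine LinearMap.ext fun z => ?_
      simp only [rk_apply, T.h_smul_left, smul_smul, tp]
      congr 1; field_simp
    rw [e1, e2]
  obtain ⟨τ₀, d1, d2⟩ := diagG H (a := 1 + t) (b := (1 + t)⁻¹) (by rw [map_add, map_one, E.tc]; field_simp)
  have τ₀K : τ₀ ∈ K := by
    apply E.Kg.fix0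
    intro b
    rw [LinearMap.sub_apply, d1]
    have : (1 + t)⁻¹ - 1 = a' := by rw [ha']; field_simp; ring
    intro j
    fin_cases b <;> fin_cases j <;> simp [E1, Mp_zero, E.tm]
    rw [this]; exact a'm
  have g2K : hh⁻¹ * τ * hh * τ₀⁻¹ ∈ K := K.mul_mem gK (K.inv_mem τ₀K)
  have act : ∀ v, T.toE (hh⁻¹ * τ * hh * τ₀⁻¹) v =
      ![(1 + t)⁻¹ * v 0, v 1, v 2, (1 + t) * v 3] + (t * ((1 + t)⁻¹ * v 0)) • G +
      (a' * T.h G ![(1 + t)⁻¹ * v 0, v 1, v 2, (1 + t) * v 3]) • E1 F 3 := by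
    intro v
    rw [toE_mul _ τ₀⁻¹, Module.End.mul_apply, d2, inv_inv, hg']
    simp only [LinearMap.add_apply, LinearMap.smul_apply, rk_apply, Module.End.one_apply, (hE H _).2.2.2, smul_smul]
    simp
  refine E.Kg.X4 H g2K (y1 := t * (1 + t)⁻¹ * (f 1 / t ^ 4)) (y2 := t * (1 + t)⁻¹ * (f 2 / t ^ 4))
    (z := (t * ζ + a' * T.conj ζ) * (1 + t)⁻¹)
    (r1 := a' * (T.ϖ * T.conj (f 1 / t ^ 4))) (r2 := a' * T.conj (f 2 / t ^ 4)) ?_ ?_ ?_ ?_ ?_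
  · rw [act, H.form, hG]
    ext j; fin_cases j <;> simp [E1]
    linear_combination (haa)
  · rw [act, H.form, hG]
    ext j; fin_cases j <;> simp [E1] <;> field_simp
  · rw [act, H.form, hG]
    ext j; fin_cases j <;> simp [E1]
  · rw [act, H.form, hG]
    ext j; fin_cases j <;> simp [E1]
  · intro hz
    apply c2
    obtain ⟨z, hzd⟩ : ∃ z, z = (t * ζ + a' * T.conj ζ) * (1 + t)⁻¹ := ⟨_, rfl⟩
    rw [← hzd] at hz
    have o1 : Op T (1 + t) := Op_add Op_one E.tm.op
    have hq : Op T ((1 + t) ^ 2 * z) := Op_mul (Op_pow o1 2) hz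
    obtain ⟨Q, hQ⟩ : ∃ Q, Q = (1 + t) ^ 2 * z := ⟨_, rfl⟩
    rw [← hQ] at hq
    have hQ' : Q = t * ((1 + t) * ζ - T.conj ζ) := by
      rw [hQ, hzd, ha']; field_simp; ring
    have hQc : T.conj Q = t * ((1 + t) * T.conj ζ - ζ) := by
      rw [hQ']; simp [E.tc, T.conj_invol]
    have key : t ^ 2 * ζ * (2 + t) = t * Q + (Q + T.conj Q) := by rw [hQc, hQ']; ring
    have k2 : Op T (t ^ 2 * ζ * (2 + t)) := by
      rw [key]; exact Op_add (Op_mul E.tm.op hq) (Op_add hq (Op_conj H hq))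
    have h2 := H.two_ne
    obtain ⟨u0, ui⟩ := one_add_Mp (T := T) (Mp_mul (Op_O H.half) E.tm)
    have k3 := Op_conj H (Op_mul (Op_mul k2 ui) (Op_O H.half))
    have e : t ^ 2 * ζ * (2 + t) * (1 + 2⁻¹ * t)⁻¹ * 2⁻¹ = t ^ 2 * ζ := by
      have : t ^ 2 * ζ * (2 + t) = t ^ 2 * ζ * (1 + 2⁻¹ * t) * 2 := by field_simp
      rw [this, mul_right_comm _ (2:F), mul_inv_cancel_right₀ u0, mul_inv_cancel_right₀ h2]
    rw [e, hζ] at k3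
    convert k3 using 1
    simp only [map_mul, map_div₀, tp, T.conj_invol]
    field_simp
end U4P

namespace U4P
open USetting
variable {F : Type u} [Field F] {T : USetting F (Fin 4 → F)}
variable {F₀ : Type w} [Field F₀] [Algebra F₀ F] {ψ₀ : F₀ → ℂ}
variable {W : Type v} [AddCommGroup W] [Module ℂ W]

lemma caseB (H : Hyp T) (H0 : Hyp0 T F₀ ψ₀) (hA : ¬ Arch T) {n : ℤ} (hn : 0 < n)
    (hn4 : Int.gcd n 4 = 1) {Λ : T.LatSeq} (hΛ : T.IsLam3 Λ)
    {β : EE F} (hβ : β ∈ AA T (-n)) (hβs : T.σA β = -β)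
    (hβf : T.IsFundamental Λ n β)
    (π : T.GU →* Module.End ℂ W) (hs : T.Smooth π) {u : W} (hu : u ≠ 0)
    (hπ : ∀ x, T.toE x - 1 ∈ AA T (n / 2 + 1) → π x u = T.psiCh F₀ ψ₀ β x • u) : False := by
  have hK : Good T (stab π u) := Good_of H H0 hn hn4 hΛ hβ hβs hβf π hu hπ
  unfold Arch at hA
  push Not at hA
  obtain ⟨t₀, ht₀, hm⟩ := hA
  have hm : Mp T t₀ := hm
  obtain ⟨s, sO, siO, s0, sc⟩ := H.s0
  obtain ⟨t, ht⟩ : ∃ t, t = t₀ * T.conj t₀ := ⟨_, rfl⟩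
  have t0 : t ≠ 0 := by rw [ht]; exact mul_ne_zero ht₀ (by simpa using ht₀)
  have tc : T.conj t = t := by rw [ht, map_mul, T.conj_invol, mul_comm]
  have tm : Mp T t := by rw [ht]; exact Mp_mul hm.op (Mp_conj H hm)
  obtain ⟨hh, -, hi⟩ := diagG H (a := (t ^ 4)⁻¹) (b := t ^ 4) (by
    rw [map_inv₀, map_pow, tc]; exact inv_mul_cancel₀ (pow_ne_zero _ t0))
  obtain ⟨L, hL⟩ := smooth_Lat H hs (u + π hh u)
  have key : ∀ g, (π g (π hh u) = π hh u) ↔ hh⁻¹ * g * hh ∈ stab π u := by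
    intro g
    rw [mem_stab, map_mul, map_mul, Module.End.mul_apply, Module.End.mul_apply]
    constructor
    · intro h
      rw [h, ← Module.End.mul_apply, ← map_mul]; simp
    · intro h
      have := congrArg (π hh) h
      rw [← Module.End.mul_apply, ← map_mul] at this
      simpa using this
  have E : Env T (stab π u) (stab π (u + π hh u)) L hh t s := by
    refine ⟨H, hK, hL, t0, tc, tm, s0, sc, Op_O sO, Op_O siO, ?_, ?_, ?_⟩
    · intro v; rw [hi, inv_inv]
    · intro g gK gS
      rw [← key]
      rw [mem_stab] at gK gS
      rw [map_add, gK] at gS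
      exact add_left_cancel gS
    · intro g gS h
      rw [← key] at h
      rw [mem_stab] at gS ⊢
      rw [map_add, h] at gS
      exact add_right_cancel gS
  obtain ⟨a1, h1, m1, f1, hf1, e1⟩ := hL.prim (E1 F 0) (by simp [E1])
  obtain ⟨a4, h4, m4, f4, hf4, e4⟩ := hL.prim (E1 F 3) (by simp [E1])
  by_cases hd : Mp T (T.conj a1 * a4)
  · obtain ⟨f, ν, q0, q3, hν, ff, fS, fL⟩ := E.getF h1 h4 m1 m4 hd hf1 hf4 e1 e4
    exact E.d2 q0 q3 hν ff fS fL
  · exact E.d1 h1 h4 m1 m4 hd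
end U4P

open USetting in
/-- **Proposition 4.1.** Let `G` be the non quasi-split
unramified `U(4)` and `gcd(n, 4) = 1`.  If the fundamental skew strata
`[Λ₃, n, [n/2], β]` and `[Λ₃, n, [n/2], γ]` are both contained in the same
irreducible smooth representation of `G`, then
`(P_{[n/2]+1}(Λ₃), ψ_γ)` is a `P₀(Λ₃)`-conjugate of `(P_{[n/2]+1}(Λ₃), ψ_β)`. -/
theorem statement_16
    {F : Type u} [Field F] (T : USetting F (Fin 4 → F))
    (hodd : ¬ (2 ∣ T.residueChar))
    (hform : T.IsU4Form) (hunram : T.IsUnramifiedQuadratic)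
    (F₀ : Type w) [Field F₀] [Algebra F₀ F] [FiniteDimensional F₀ F]
    (hfix : T.FixedField F₀) (hdeg : Module.finrank F₀ F = 2)
    (ψ₀ : F₀ → ℂ) (hψ : T.IsAddCh F₀ ψ₀)
    (n : ℤ) (hn : 0 < n) (hn4 : Int.gcd n 4 = 1)
    (Λ : T.LatSeq) (hΛ : T.IsLam3 Λ)
    (β γ : Module.End F (Fin 4 → F))
    (hβ : β ∈ T.aFil Λ (-n) ∩ T.Aminus) (hγ : γ ∈ T.aFil Λ (-n) ∩ T.Aminus)
    (hβf : T.IsFundamental Λ n β) (hγf : T.IsFundamental Λ n γ)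
    (Wπ : Type*) [AddCommGroup Wπ] [Module ℂ Wπ]
    (π : T.GU →* Module.End ℂ Wπ)
    (hsm : T.Smooth π) (hirr : T.Irred π)
    (hπβ : T.ContainsChar π (T.Pset Λ (n / 2 + 1)) (T.psiCh F₀ ψ₀ β))
    (hπγ : T.ContainsChar π (T.Pset Λ (n / 2 + 1)) (T.psiCh F₀ ψ₀ γ)) :
    ∃ g ∈ T.P0set Λ, ∀ x ∈ T.Pset Λ (n / 2 + 1),
      g⁻¹ * x * g ∈ T.Pset Λ (n / 2 + 1) ∧
      T.psiCh F₀ ψ₀ γ x = T.psiCh F₀ ψ₀ β (g⁻¹ * x * g) := by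
  have H : U4P.Hyp T := ⟨hodd, hform, hunram⟩
  have H0 : U4P.Hyp0 T F₀ ψ₀ := ⟨inferInstance, hfix, hdeg, hψ⟩
  obtain ⟨hβ1, hβ2⟩ := hβ
  obtain ⟨hγ1, hγ2⟩ := hγ
  rw [U4P.aFil_eq hΛ] at hβ1 hγ1
  have hβs : T.σA β = -β := hβ2
  have hγs : T.σA γ = -γ := hγ2
  obtain ⟨wβ, hwβ, hb⟩ := hπβ
  obtain ⟨wγ, hwγ, hc⟩ := hπγ
  simp only [USetting.Pset, USetting.P0set, Set.mem_setOf_eq, U4P.aFil_eq hΛ] at hb hc ⊢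
  by_cases hA : U4P.Arch T
  · exact U4P.caseA H H0 hA hn hn4 hΛ hβ1 hγ1 hβs hγs hβf hγf π hirr hwβ hwγ hb hc
  · exact (U4P.caseB H H0 hA hn hn4 hΛ hβ1 hβs hβf π hsm hwβ hb).elim
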